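/- arXiv:2009.01292 — 3 statements merged into one kernel-verified Lean document; each statement's English description precedes it below -/
import Mathlib

section
/- Let a and b be integers with 2 ≤ a < b that are multiplicatively independent (i.e., a^m = b^n for natural numbers m, n implies m = n = 0). Let A, B ⊆ [0,1] be closed sets that are forward invariant under multiplication: x ∈ A implies Int.fract(a·x) ∈ A, and y ∈ B implies Int.fract(b·y) ∈ B. Set C := A × B ⊆ ℝ². Then for every line L ⊆ ℝ² of the form L = {(x, s·x + c) : x ∈ ℝ} with slope s ≠ 0 (so L is parallel to neither coordinate axis), the Hausdorff dimension satisfies dimH(C ∩ L) ≤ max{dimH C, 1} − 1. -/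
open MeasureTheory Set

namespace ShmerkinWu

section Entropy

variable {Ω β γ δ : Type*} [Fintype Ω]

open Classical in
/-- The mass of the atom of the partition generated by `X` that contains `ω`. -/
noncomputable def atomMass (p : Ω → ℝ) (X : Ω → β) (ω : Ω) : ℝ :=
  ∑ ω', if X ω' = X ω then p ω' else 0

/-- The Shannon entropy of the random variable `X` under the weights `p`. -/
noncomputable def ent (p : Ω → ℝ) (X : Ω → β) : ℝ :=
  ∑ ω, p ω * (-Real.log (atomMass p X ω))

variable {p : Ω → ℝ}

theorem atomMass_nonneg (hp : ∀ ω, 0 ≤ p ω) (X : Ω → β) (ω : Ω) : 0 ≤ atomMass p X ω :=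
  Finset.sum_nonneg fun ω' _ => by split_ifs <;> simp [hp]

theorem le_atomMass (hp : ∀ ω, 0 ≤ p ω) (X : Ω → β) (ω : Ω) : p ω ≤ atomMass p X ω := by
  classical
  have := Finset.single_le_sum (f := fun ω' => if X ω' = X ω then p ω' else 0)
    (fun ω' _ => by split_ifs <;> simp [hp]) (Finset.mem_univ ω)
  simpa [atomMass] using this

theorem atomMass_pos (hp : ∀ ω, 0 ≤ p ω) (X : Ω → β) {ω : Ω} (h : 0 < p ω) :
    0 < atomMass p X ω :=
  h.trans_le (le_atomMass hp X ω)

theorem atomMass_mono (hp : ∀ ω, 0 ≤ p ω) {X : Ω → β} {Y : Ω → γ}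
    {ω : Ω} (h : ∀ ω', 0 < p ω' → X ω' = X ω → Y ω' = Y ω) :
    atomMass p X ω ≤ atomMass p Y ω := by
  classical
  refine Finset.sum_le_sum fun ω' _ => ?_
  rcases (hp ω').eq_or_lt with h0 | h0
  · simp [← h0]
  by_cases hX : X ω' = X ω
  · simp [hX, h ω' h0 hX]
  · simp only [hX, if_false]
    split_ifs <;> simp [hp]

theorem atomMass_congr {X : Ω → β} {ω ω' : Ω} (h : X ω = X ω') :
    atomMass p X ω = atomMass p X ω' := by
  unfold atomMass
  rw [h]

theorem ent_mono (hp : ∀ ω, 0 ≤ p ω) {X : Ω → β} {Y : Ω → γ}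
    (h : ∀ ω ω', 0 < p ω → 0 < p ω' → X ω = X ω' → Y ω = Y ω') : ent p Y ≤ ent p X := by
  refine Finset.sum_le_sum fun ω _ => ?_
  rcases (hp ω).eq_or_lt with h0 | h0
  · simp [← h0]
  refine mul_le_mul_of_nonneg_left (neg_le_neg ?_) (hp ω)
  exact Real.log_le_log (atomMass_pos hp X h0)
    (atomMass_mono hp fun ω' h' e => h ω' ω h' h0 e)

theorem ent_congr (hp : ∀ ω, 0 ≤ p ω) {X : Ω → β} {Y : Ω → γ}
    (h : ∀ ω ω', 0 < p ω → 0 < p ω' → (X ω = X ω' ↔ Y ω = Y ω')) : ent p Y = ent p X :=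
  le_antisymm (ent_mono hp fun ω ω' h1 h2 => (h ω ω' h1 h2).1)
    (ent_mono hp fun ω ω' h1 h2 => (h ω ω' h1 h2).2)

theorem ent_nonneg (hp : ∀ ω, 0 ≤ p ω) (h1 : ∑ ω, p ω = 1) (X : Ω → β) : 0 ≤ ent p X := by
  classical
  refine Finset.sum_nonneg fun ω _ => mul_nonneg (hp ω) (neg_nonneg.2 ?_)
  refine Real.log_nonpos (atomMass_nonneg hp X ω) ?_
  rw [← h1]
  exact Finset.sum_le_sum fun ω' _ => by split_ifs <;> simp [hp]

theorem sum_mul_log_nonpos (hp : ∀ ω, 0 ≤ p ω) {r : Ω → ℝ} (hr : ∀ ω, 0 < p ω → 0 < r ω)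
    (h : ∑ ω, p ω * r ω ≤ ∑ ω, p ω) : ∑ ω, p ω * Real.log (r ω) ≤ 0 := by
  have : ∑ ω, p ω * Real.log (r ω) ≤ ∑ ω, (p ω * r ω - p ω) := by
    refine Finset.sum_le_sum fun ω _ => ?_
    rcases (hp ω).eq_or_lt with h0 | h0
    · simp [← h0]
    have := Real.log_le_sub_one_of_pos (hr ω h0)
    nlinarith
  rw [Finset.sum_sub_distrib] at this
  linarith

/-- Integrating `p / atomMass p X` over a set contained in one atom of `X` gives at most one. -/
theorem sum_div_atomMass_le_one (hp : ∀ ω, 0 ≤ p ω) {X : Ω → β} (T : Finset Ω)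
    (hT : ∀ ω ∈ T, ∀ ω' ∈ T, X ω = X ω') : ∑ ω ∈ T, p ω / atomMass p X ω ≤ 1 := by
  classical
  rcases T.eq_empty_or_nonempty with rfl | ⟨ω₀, h₀⟩
  · simp
  have : ∑ ω ∈ T, p ω / atomMass p X ω = (∑ ω ∈ T, p ω) / atomMass p X ω₀ := by
    rw [Finset.sum_div]
    exact Finset.sum_congr rfl fun ω hω => by rw [atomMass_congr (hT ω hω ω₀ h₀)]
  rw [this]
  refine div_le_one_of_le₀ ?_ (atomMass_nonneg hp X ω₀)
  calc ∑ ω ∈ T, p ω = ∑ ω ∈ T, if X ω = X ω₀ then p ω else 0 :=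
        Finset.sum_congr rfl fun ω hω => by simp [hT ω hω ω₀ h₀]
    _ ≤ _ := Finset.sum_le_sum_of_subset_of_nonneg (Finset.subset_univ T)
        fun ω _ _ => by split_ifs <;> simp [hp]

/-- Submodularity of Shannon entropy. -/
theorem ent_submodular (hp : ∀ ω, 0 ≤ p ω) (X : Ω → β) (Y : Ω → γ) (Z : Ω → δ) :
    ent p (fun ω => (X ω, Y ω, Z ω)) + ent p Z
      ≤ ent p (fun ω => (X ω, Z ω)) + ent p (fun ω => (Y ω, Z ω)) := by
  classical
  set F := fun ω => (X ω, Y ω, Z ω)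
  set G := fun ω => (X ω, Z ω)
  set H := fun ω => (Y ω, Z ω)
  set r : Ω → ℝ := fun ω => atomMass p G ω * atomMass p H ω / (atomMass p F ω * atomMass p Z ω)
  have hr : ∀ ω, 0 < p ω → 0 < r ω := fun ω h =>
    div_pos (mul_pos (atomMass_pos hp _ h) (atomMass_pos hp _ h))
      (mul_pos (atomMass_pos hp _ h) (atomMass_pos hp _ h))
  have key : ∑ ω, p ω * r ω ≤ ∑ ω, p ω := by
    have e1 : ∀ ω, p ω * r ω = ∑ ω₁, ∑ ω₂, p ω₁ * p ω₂ *
        (if G ω₁ = G ω ∧ H ω₂ = H ω then p ω / (atomMass p F ω * atomMass p Z ω) else 0) := by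
      intro ω
      have : p ω * r ω = atomMass p G ω * atomMass p H ω *
          (p ω / (atomMass p F ω * atomMass p Z ω)) := by simp only [r]; ring
      rw [this, atomMass, atomMass, Finset.sum_mul_sum, Finset.sum_mul]
      refine Finset.sum_congr rfl fun ω₁ _ => ?_
      rw [Finset.sum_mul]
      refine Finset.sum_congr rfl fun ω₂ _ => ?_
      by_cases h1 : G ω₁ = G ω <;> by_cases h2 : H ω₂ = H ω <;> simp [h1, h2]
    calc ∑ ω, p ω * r ω
        = ∑ ω₁, ∑ ω₂, p ω₁ * p ω₂ * ∑ ω,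
          (if G ω₁ = G ω ∧ H ω₂ = H ω then p ω / (atomMass p F ω * atomMass p Z ω) else 0) := by
          simp_rw [e1]
          rw [Finset.sum_comm]
          refine Finset.sum_congr rfl fun ω₁ _ => ?_
          rw [Finset.sum_comm]
          exact Finset.sum_congr rfl fun ω₂ _ => (Finset.mul_sum _ _ _).symm
      _ ≤ ∑ ω₁, ∑ ω₂, p ω₁ * p ω₂ * (if Z ω₂ = Z ω₁ then 1 / atomMass p Z ω₁ else 0) := by
          refine Finset.sum_le_sum fun ω₁ _ => Finset.sum_le_sum fun ω₂ _ =>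
            mul_le_mul_of_nonneg_left ?_ (mul_nonneg (hp _) (hp _))
          by_cases hZ : Z ω₂ = Z ω₁
          · rw [if_pos hZ, ← Finset.sum_filter]
            have : ∀ ω ∈ Finset.univ.filter (fun ω => G ω₁ = G ω ∧ H ω₂ = H ω),
                p ω / (atomMass p F ω * atomMass p Z ω)
                  = p ω / atomMass p F ω * (1 / atomMass p Z ω₁) := by
              intro ω hω
              simp only [Finset.mem_filter, G, H, Prod.mk.injEq] at hω
              rw [atomMass_congr (X := Z) hω.2.1.2, div_mul_eq_div_mul_one_div]
            rw [Finset.sum_congr rfl this, ← Finset.sum_mul]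
            refine mul_le_of_le_one_left (one_div_nonneg.2 (atomMass_nonneg hp _ _)) ?_
            refine sum_div_atomMass_le_one hp _ fun ω hω ω' hω' => ?_
            simp only [Finset.mem_filter, G, H, Prod.mk.injEq] at hω hω'
            simp only [F, Prod.mk.injEq]
            exact ⟨hω.2.1.1.symm.trans hω'.2.1.1, hω.2.2.1.symm.trans hω'.2.2.1,
              hω.2.2.2.symm.trans hω'.2.2.2⟩
          · rw [if_neg hZ]
            refine (Finset.sum_eq_zero fun ω _ => if_neg ?_).le
            simp only [G, H, Prod.mk.injEq]
            rintro ⟨⟨-, h1⟩, -, h2⟩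
            exact hZ (h2.trans h1.symm)
      _ ≤ ∑ ω₁, p ω₁ := by
          refine Finset.sum_le_sum fun ω₁ _ => ?_
          have : ∑ ω₂, p ω₁ * p ω₂ * (if Z ω₂ = Z ω₁ then 1 / atomMass p Z ω₁ else 0)
              = p ω₁ * (atomMass p Z ω₁ / atomMass p Z ω₁) := by
            conv_rhs => rw [atomMass.eq_def, Finset.sum_div, Finset.mul_sum]
            refine Finset.sum_congr rfl fun ω₂ _ => ?_
            split_ifs
            · rw [← atomMass.eq_def]; ring
            · simp
          rw [this]
          exact mul_le_of_le_one_right (hp _) (div_self_le_one _)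
  have main := sum_mul_log_nonpos hp hr key
  have e : ∑ ω, p ω * Real.log (r ω) = ent p F + ent p Z - ent p G - ent p H := by
    simp only [ent, ← Finset.sum_add_distrib, ← Finset.sum_sub_distrib]
    refine Finset.sum_congr rfl fun ω _ => ?_
    rcases (hp ω).eq_or_lt with h0 | h0
    · simp [← h0]
    have hF := (atomMass_pos hp F h0).ne'
    have hG := (atomMass_pos hp G h0).ne'
    have hH := (atomMass_pos hp H h0).ne'
    have hZ := (atomMass_pos hp Z h0).ne'
    simp only [r]
    rw [Real.log_div (mul_ne_zero hG hH) (mul_ne_zero hF hZ), Real.log_mul hG hH,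
      Real.log_mul hF hZ]
    ring
  linarith

/-- The conditional entropy of `W` given `Y` is at most the mean logarithm of the number of values
of `W` on the atoms of `Y`. -/
theorem ent_prod_le_of_card_le (hp : ∀ ω, 0 ≤ p ω) (W : Ω → β) (Y : Ω → γ) (N : γ → ℝ)
    (hN : ∀ ω, 0 < p ω → ∃ T : Finset β,
      (∀ ω', 0 < p ω' → Y ω' = Y ω → W ω' ∈ T) ∧ (T.card : ℝ) ≤ N (Y ω)) :
    ent p (fun ω => (W ω, Y ω)) ≤ ent p Y + ∑ ω, p ω * Real.log (N (Y ω)) := by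
  classical
  set F := fun ω => (W ω, Y ω)
  have hNpos : ∀ ω, 0 < p ω → 0 < N (Y ω) := by
    intro ω hω
    obtain ⟨T, hT, hc⟩ := hN ω hω
    have : 0 < T.card := Finset.card_pos.2 ⟨_, hT ω hω rfl⟩
    exact lt_of_lt_of_le (by exact_mod_cast this) hc
  set r : Ω → ℝ := fun ω => atomMass p Y ω / (atomMass p F ω * N (Y ω))
  have hr : ∀ ω, 0 < p ω → 0 < r ω := fun ω h =>
    div_pos (atomMass_pos hp _ h) (mul_pos (atomMass_pos hp _ h) (hNpos ω h))
  have key : ∑ ω, p ω * r ω ≤ ∑ ω, p ω := by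
    have e1 : ∀ ω, p ω * r ω = ∑ ω₁, p ω₁ *
        (if Y ω₁ = Y ω then p ω / atomMass p F ω / N (Y ω₁) else 0) := by
      intro ω
      have : p ω * r ω = atomMass p Y ω * (p ω / atomMass p F ω / N (Y ω)) := by
        simp only [r, div_eq_mul_inv, mul_inv]; ring
      rw [this, atomMass, Finset.sum_mul]
      refine Finset.sum_congr rfl fun ω₁ _ => ?_
      by_cases h1 : Y ω₁ = Y ω <;> simp [h1]
    simp_rw [e1]
    rw [Finset.sum_comm]
    refine Finset.sum_le_sum fun ω₁ _ => ?_
    rw [← Finset.mul_sum]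
    rcases (hp ω₁).eq_or_lt with h0 | h0
    · simp [← h0]
    refine mul_le_of_le_one_right (hp _) ?_
    obtain ⟨T, hT, hc⟩ := hN ω₁ h0
    rw [← Finset.sum_filter, ← Finset.sum_div]
    refine div_le_one_of_le₀ ?_ (hNpos ω₁ h0).le
    set A := Finset.univ.filter (fun ω => Y ω₁ = Y ω)
    have : ∑ ω ∈ A, p ω / atomMass p F ω
        = ∑ ω ∈ A.filter (fun ω => 0 < p ω), p ω / atomMass p F ω := by
      refine (Finset.sum_filter_of_ne fun ω _ h => (hp ω).lt_of_ne' ?_).symm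
      rintro h0
      simp [h0] at h
    rw [this, ← Finset.sum_fiberwise_of_maps_to (t := T) (g := W)]
    · refine le_trans ?_ hc
      rw [Finset.card_eq_sum_ones, Nat.cast_sum, Nat.cast_one]
      refine Finset.sum_le_sum fun w _ => sum_div_atomMass_le_one hp _ fun ω hω ω' hω' => ?_
      simp only [Finset.mem_filter, A] at hω hω'
      simp only [F, Prod.mk.injEq]
      exact ⟨hω.2.trans hω'.2.symm, hω.1.1.2.symm.trans hω'.1.1.2⟩
    · intro ω hω
      simp only [Finset.mem_filter, A] at hω
      exact hT ω hω.2 hω.1.2.symm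
  have main := sum_mul_log_nonpos hp hr key
  have e : ∑ ω, p ω * Real.log (r ω)
      = ent p F - ent p Y - ∑ ω, p ω * Real.log (N (Y ω)) := by
    simp only [ent, ← Finset.sum_sub_distrib]
    refine Finset.sum_congr rfl fun ω _ => ?_
    rcases (hp ω).eq_or_lt with h0 | h0
    · simp [← h0]
    have hF := (atomMass_pos hp F h0).ne'
    have hY := (atomMass_pos hp Y h0).ne'
    simp only [r]
    rw [Real.log_div hY (mul_ne_zero hF (hNpos ω h0).ne'), Real.log_mul hF (hNpos ω h0).ne']
    ring
  linarith

theorem ent_const (h1 : ∑ ω, p ω = 1) (c : β) : ent p (fun _ => c) = 0 := by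
  simp [ent, atomMass, h1]

theorem ent_prod_le_add (hp : ∀ ω, 0 ≤ p ω) (h1 : ∑ ω, p ω = 1) (X : Ω → β) (Y : Ω → γ) :
    ent p (fun ω => (X ω, Y ω)) ≤ ent p X + ent p Y := by
  have h := ent_submodular hp X Y (fun _ => ())
  rw [ent_const h1] at h
  have e1 : ent p (fun ω => (X ω, Y ω)) = ent p (fun ω => (X ω, Y ω, ())) :=
    ent_congr hp (by simp)
  have e2 : ent p (fun ω => (X ω, ())) = ent p X := ent_congr hp (by simp)
  have e3 : ent p (fun ω => (Y ω, ())) = ent p Y := ent_congr hp (by simp)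
  linarith

theorem ent_le_log_card (hp : ∀ ω, 0 ≤ p ω) (h1 : ∑ ω, p ω = 1) {X : Ω → β} {T : Finset β}
    (hT : ∀ ω, 0 < p ω → X ω ∈ T) : ent p X ≤ Real.log T.card := by
  have h := ent_prod_le_of_card_le hp X (fun _ => ()) (fun _ => (T.card : ℝ))
    (fun ω _ => ⟨T, fun ω' h _ => hT ω' h, le_rfl⟩)
  rw [ent_const h1, ← Finset.sum_mul, h1] at h
  have e2 : ent p (fun ω => (X ω, ())) = ent p X := ent_congr hp (by simp)
  linarith

theorem le_ent_of_atomMass_le (hp : ∀ ω, 0 ≤ p ω) (h1 : ∑ ω, p ω = 1) {X : Ω → β} {q : ℝ}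
    (h : ∀ ω, 0 < p ω → atomMass p X ω ≤ q) : -Real.log q ≤ ent p X := by
  have : ∑ ω, p ω * (-Real.log q) ≤ ent p X := by
    refine Finset.sum_le_sum fun ω _ => ?_
    rcases (hp ω).eq_or_lt with h0 | h0
    · simp [← h0]
    exact mul_le_mul_of_nonneg_left (neg_le_neg
      (Real.log_le_log (atomMass_pos hp X h0) (h ω h0))) (hp ω)
  rwa [← Finset.sum_mul, h1, one_mul] at this

theorem ent_comp_equiv (X : Ω → β) (e : Ω ≃ Ω) (he : ∀ ω, p (e ω) = p ω) :
    ent p (fun ω => X (e ω)) = ent p X := by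
  classical
  have h : ∀ ω, atomMass p (fun ω => X (e ω)) ω = atomMass p X (e ω) := by
    intro ω
    rw [atomMass, atomMass, ← Equiv.sum_comp e (fun ω' => if X ω' = X (e ω) then p ω' else 0)]
    simp only [he]
  rw [ent, ent, ← Equiv.sum_comp e (fun ω => p ω * (-Real.log (atomMass p X ω)))]
  simp only [he, h]

end Entropy

section RelativeProduct

variable {Ω Ω' β γ δ : Type*} [Fintype Ω] [Fintype Ω'] {p : Ω → ℝ}

theorem ent_comp_of_marginal {q : Ω' → ℝ} (π : Ω' → Ω)
    (hq : ∀ f : Ω → ℝ, ∑ z, q z * f (π z) = ∑ ω, p ω * f ω) (X : Ω → β) :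
    ent q (fun z => X (π z)) = ent p X := by
  classical
  have h : ∀ z, atomMass q (fun z => X (π z)) z = atomMass p X (π z) := by
    intro z
    have := hq (fun ω => if X ω = X (π z) then 1 else 0)
    simpa [atomMass] using this
  simp only [ent, h]
  exact hq (fun ω => -Real.log (atomMass p X ω))

open Classical in
/-- The weights of the relatively independent self-joining of `p` over the map `P`. -/
noncomputable def relProd (p : Ω → ℝ) (P : Ω → γ) (z : Ω × Ω) : ℝ :=
  if P z.1 = P z.2 then p z.1 * p z.2 / atomMass p P z.1 else 0

variable {P : Ω → γ}

theorem relProd_nonneg (hp : ∀ ω, 0 ≤ p ω) (z : Ω × Ω) : 0 ≤ relProd p P z := by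
  unfold relProd
  split_ifs
  · exact div_nonneg (mul_nonneg (hp _) (hp _)) (atomMass_nonneg hp _ _)
  · exact le_rfl

theorem relProd_pos_iff (hp : ∀ ω, 0 ≤ p ω) {z : Ω × Ω} :
    0 < relProd p P z ↔ 0 < p z.1 ∧ 0 < p z.2 ∧ P z.1 = P z.2 := by
  unfold relProd
  split_ifs with h
  · refine ⟨fun h' => ?_, fun h' => div_pos (mul_pos h'.1 h'.2.1) (atomMass_pos hp _ h'.1)⟩
    refine ⟨(hp _).lt_of_ne' ?_, (hp _).lt_of_ne' ?_, h⟩ <;>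
    · intro h0
      simp [h0] at h'
  · simp [h]

theorem sum_relProd_snd (hp : ∀ ω, 0 ≤ p ω) (ω : Ω) :
    ∑ ω', relProd p P (ω, ω') = p ω := by
  classical
  rcases (hp ω).eq_or_lt with h0 | h0
  · simp [relProd, ← h0]
  have : ∀ ω', relProd p P (ω, ω') = p ω / atomMass p P ω * (if P ω' = P ω then p ω' else 0) := by
    intro ω'
    simp only [relProd, eq_comm (a := P ω)]
    split_ifs
    · ring
    · simp
  simp_rw [this, ← Finset.mul_sum]
  have h1 := (atomMass_pos hp P h0).ne'
  have h2 : (∑ i, if P i = P ω then p i else 0) = atomMass p P ω := by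
    unfold atomMass
    exact Finset.sum_congr rfl fun _ _ => by congr
  rw [h2, div_mul_cancel₀ _ h1]

theorem relProd_swap (ω ω' : Ω) : relProd p P (ω, ω') = relProd p P (ω', ω) := by
  unfold relProd
  by_cases h : P ω = P ω'
  · simp only [h, if_true, atomMass_congr h]
    ring
  · simp [h, Ne.symm h]

theorem sum_relProd_mul_fst (hp : ∀ ω, 0 ≤ p ω) (f : Ω → ℝ) :
    ∑ z, relProd p P z * f z.1 = ∑ ω, p ω * f ω := by
  rw [Fintype.sum_prod_type]
  refine Finset.sum_congr rfl fun ω _ => ?_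
  change ∑ y, relProd p P (ω, y) * f ω = _
  rw [← Finset.sum_mul, sum_relProd_snd hp]

theorem sum_relProd_mul_snd (hp : ∀ ω, 0 ≤ p ω) (f : Ω → ℝ) :
    ∑ z, relProd p P z * f z.2 = ∑ ω, p ω * f ω := by
  rw [Fintype.sum_prod_type_right]
  refine Finset.sum_congr rfl fun ω _ => ?_
  change ∑ y, relProd p P (y, ω) * f ω = _
  rw [← Finset.sum_mul]
  simp only [relProd_swap _ ω]
  rw [sum_relProd_snd hp]

theorem sum_relProd (hp : ∀ ω, 0 ≤ p ω) : ∑ z, relProd p P z = ∑ ω, p ω := by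
  simpa using sum_relProd_mul_fst (P := P) hp (fun _ => 1)

theorem ent_relProd_fst (hp : ∀ ω, 0 ≤ p ω) (X : Ω → β) :
    ent (relProd p P) (fun z => X z.1) = ent p X :=
  ent_comp_of_marginal Prod.fst (sum_relProd_mul_fst hp) X

theorem ent_relProd_snd (hp : ∀ ω, 0 ≤ p ω) (X : Ω → β) :
    ent (relProd p P) (fun z => X z.2) = ent p X :=
  ent_comp_of_marginal Prod.snd (sum_relProd_mul_snd hp) X

/-- In the relatively independent self-joining, the second coordinate depends on the first one only
through `P`. -/
theorem ent_relProd_snd_fst (hp : ∀ ω, 0 ≤ p ω) (W : Ω → β) :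
    ent (relProd p P) (fun z => (W z.2, z.1)) - ent (relProd p P) Prod.fst
      = ent p (fun ω => (W ω, P ω)) - ent p P := by
  classical
  rw [ent_relProd_fst hp (fun ω => ω)]
  have h2 := sum_relProd_mul_snd (P := P) hp (fun ω => -Real.log (atomMass p P ω))
  have h3 := sum_relProd_mul_snd (P := P) hp
    (fun ω => -Real.log (atomMass p (fun ω => (W ω, P ω)) ω))
  have h1 := sum_relProd_mul_fst (P := P) hp
    (fun ω => -Real.log (atomMass p (fun ω => ω) ω))
  rw [ent, ent, ent, ent, ← h1, ← h2, ← h3, ← Finset.sum_sub_distrib, ← Finset.sum_sub_distrib]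
  refine Finset.sum_congr rfl fun z _ => ?_
  rcases (relProd_nonneg (P := P) hp z).eq_or_lt with h0 | h0
  · simp [← h0]
  obtain ⟨hz1, hz2, hP⟩ := (relProd_pos_iff hp).1 h0
  have hm : atomMass (relProd p P) (fun z => (W z.2, z.1)) z
      = atomMass p (fun ω => ω) z.1 / atomMass p P z.2
        * atomMass p (fun ω => (W ω, P ω)) z.2 := by
    have a1 : atomMass p (fun ω => ω) z.1 = p z.1 := by simp [atomMass]
    rw [a1, atomMass.eq_def _ _ z, atomMass.eq_def p (fun ω => (W ω, P ω)) z.2,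
      Fintype.sum_prod_type, Finset.sum_eq_single z.1, Finset.mul_sum]
    · refine Finset.sum_congr rfl fun ω' _ => ?_
      by_cases hW : W ω' = W z.2 <;> by_cases hP' : P ω' = P z.2
      · simp only [relProd, hP, hW, hP', if_true, atomMass_congr hP]
        ring
      · simp [relProd, hP, hW, hP', Ne.symm hP']
      · simp [hW]
      · simp [hW]
    · intro ω _ hω
      exact Finset.sum_eq_zero fun ω' _ => if_neg fun h => hω (Prod.mk.inj h).2
    · simp
  have b1 := (atomMass_pos hp (fun ω => ω) hz1).ne'
  have b2 := (atomMass_pos hp P hz2).ne'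
  have b3 := (atomMass_pos hp (fun ω => (W ω, P ω)) hz2).ne'
  rw [hm, Real.log_mul (div_ne_zero b1 b2) b3, Real.log_div b1 b2]
  ring

/-- The entropy inequality behind the count of a bush of slices: sample two points of a slice
independently; the pair of their words nearly determines the direction `U` of the slice unless the
words are `near`. -/
theorem ent_bush {υ : Type*} (hp : ∀ ω, 0 ≤ p ω) (h1 : ∑ ω, p ω = 1) (P : Ω → γ) (W : Ω → β)
    (U : Ω → υ) (near : β → β → Prop) {N₀ N₁ Q₀ Q₁ : ℝ}
    (hN₀ : ∀ ω, 0 < p ω → ∃ T : Finset β,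
      (∀ ω', 0 < p ω' → P ω = P ω' → W ω' ∈ T) ∧ (T.card : ℝ) ≤ N₀)
    (hN₁ : ∀ ω, 0 < p ω → ∃ T : Finset β,
      (∀ ω', 0 < p ω' → P ω = P ω' → near (W ω) (W ω') → W ω' ∈ T) ∧ (T.card : ℝ) ≤ N₁)
    (hQ₀ : ∀ ω ω', 0 < p ω → 0 < p ω' → P ω = P ω' → ¬ near (W ω) (W ω') → ∃ T : Finset υ,
      (∀ ν ν', 0 < p ν → 0 < p ν' → P ν = P ν' → W ν = W ω → W ν' = W ω' → U ν ∈ T) ∧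
        (T.card : ℝ) ≤ Q₀)
    (hQ₁ : ∃ T : Finset υ, (∀ ω, 0 < p ω → U ω ∈ T) ∧ (T.card : ℝ) ≤ Q₁) :
    ∃ t : ℝ, 0 ≤ t ∧ t ≤ 1 ∧
      ent p (fun ω => (W ω, P ω)) - ent p P
        ≤ Real.log 2 + (t * Real.log N₁ + (1 - t) * Real.log N₀) ∧
      ent p (fun ω => (W ω, U ω)) + (ent p (fun ω => (W ω, P ω)) - ent p P)
        ≤ 2 * ent p W + (t * Real.log Q₁ + (1 - t) * Real.log Q₀) := by
  classical
  set q := relProd p P with hq_def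
  have hq : ∀ z, 0 ≤ q z := relProd_nonneg hp
  have hq1 : ∑ z, q z = 1 := (sum_relProd hp).trans h1
  have hpos : ∀ z, 0 < q z → 0 < p z.1 ∧ 0 < p z.2 ∧ P z.1 = P z.2 :=
    fun z => (relProd_pos_iff hp).1
  set Z : Ω × Ω → Bool := fun z => decide (near (W z.1) (W z.2)) with hZ
  set t : ℝ := ∑ z, if Z z then q z else 0 with ht
  have hsplit : ∀ A B : ℝ, ∑ z, q z * Real.log (if Z z then A else B)
      = t * Real.log A + (1 - t) * Real.log B := by
    intro A B
    have : ∀ z, q z * Real.log (if Z z then A else B)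
        = (if Z z then q z else 0) * Real.log A
          + (q z - (if Z z then q z else 0)) * Real.log B := by
      intro z
      split_ifs <;> ring
    simp_rw [this]
    rw [Finset.sum_add_distrib, ← Finset.sum_mul, ← Finset.sum_mul, Finset.sum_sub_distrib, hq1]
  have ht0 : 0 ≤ t := Finset.sum_nonneg fun z _ => by split_ifs <;> simp [hq]
  have ht1 : t ≤ 1 := by
    rw [← hq1]
    exact Finset.sum_le_sum fun z _ => by split_ifs <;> simp [hq]
  refine ⟨t, ht0, ht1, ?_, ?_⟩
  · rw [← ent_relProd_snd_fst hp]
    have a1 : ent q (fun z => (W z.2, z.1)) ≤ ent q (fun z => (W z.2, (z.1, Z z))) :=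
      ent_mono hq (by simp +contextual)
    have a2 : ent q (fun z => (z.1, Z z)) ≤ ent q Prod.fst + ent q Z :=
      ent_prod_le_add hq hq1 _ _
    have a3 : ent q Z ≤ Real.log 2 := by
      simpa using ent_le_log_card hq hq1 (X := Z) (T := Finset.univ) (by simp)
    have a4 := ent_prod_le_of_card_le hq (fun z => W z.2) (fun z => (z.1, Z z))
      (fun y => if y.2 then N₁ else N₀) (by
        intro z hz
        obtain ⟨b1, b2, b3⟩ := hpos z hz
        cases hzz : Z z
        · obtain ⟨T, hT, hc⟩ := hN₀ z.1 b1
          refine ⟨T, fun z' hz' e => ?_, by simpa using hc⟩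
          obtain ⟨c1, c2, c3⟩ := hpos z' hz'
          have e1 := (Prod.mk.inj e).1
          exact hT z'.2 c2 (by rw [← c3, e1])
        · obtain ⟨T, hT, hc⟩ := hN₁ z.1 b1
          refine ⟨T, fun z' hz' e => ?_, by simpa using hc⟩
          obtain ⟨c1, c2, c3⟩ := hpos z' hz'
          obtain ⟨e1, e2⟩ := Prod.mk.inj e
          refine hT z'.2 c2 (by rw [← c3, e1]) ?_
          rw [← e1]
          simpa [hZ] using e2)
    simp only [hsplit] at a4
    linarith
  · have a1 : ent q (fun z => (W z.1, W z.2)) ≤ ent p W + ent p W := by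
      have := ent_prod_le_add hq hq1 (fun z => W z.1) (fun z => W z.2)
      rwa [ent_relProd_fst hp, ent_relProd_snd hp] at this
    have a2 := ent_prod_le_of_card_le hq (fun z => U z.1) (fun z => (W z.1, W z.2))
      (fun y => if decide (near y.1 y.2) then Q₁ else Q₀) (by
        intro z hz
        obtain ⟨b1, b2, b3⟩ := hpos z hz
        by_cases hn : near (W z.1) (W z.2)
        · obtain ⟨T, hT, hc⟩ := hQ₁
          exact ⟨T, fun z' hz' _ => hT z'.1 (hpos z' hz').1, by simpa [hn] using hc⟩
        · obtain ⟨T, hT, hc⟩ := hQ₀ z.1 z.2 b1 b2 b3 hn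
          refine ⟨T, fun z' hz' e => ?_, by simpa [hn] using hc⟩
          obtain ⟨c1, c2, c3⟩ := hpos z' hz'
          obtain ⟨e1, e2⟩ := Prod.mk.inj e
          exact hT z'.1 z'.2 c1 c2 c3 e1 e2)
    have a2' : ent q (fun z => (U z.1, (W z.1, W z.2)))
        ≤ ent q (fun z => (W z.1, W z.2)) + (t * Real.log Q₁ + (1 - t) * Real.log Q₀) := by
      rw [← hsplit]
      exact a2
    have a3 := ent_submodular hq (fun z => W z.2) (fun z => z.1) (fun z => (W z.1, U z.1))
    have a4 : ent q (fun z => (W z.1, U z.1)) = ent p (fun ω => (W ω, U ω)) :=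
      ent_relProd_fst hp (fun ω => (W ω, U ω))
    have a5 : ent q (fun z => (z.1, (W z.1, U z.1))) = ent q Prod.fst :=
      ent_congr hq (by simp +contextual)
    have a6 : ent q (fun z => (W z.2, z.1, (W z.1, U z.1))) = ent q (fun z => (W z.2, z.1)) :=
      ent_congr hq (by simp +contextual)
    have a7 : ent q (fun z => (W z.2, (W z.1, U z.1))) = ent q (fun z => (U z.1, (W z.1, W z.2))) :=
      ent_congr hq (by simp; tauto)
    have a8 := ent_relProd_snd_fst (P := P) hp W
    rw [← hq_def] at a8
    linarith

end RelativeProduct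

section Stationary

variable {Ω β υ δ ι : Type*} [Fintype Ω] {p : Ω → ℝ}

/-- Subadditivity of conditional entropy along a list of random variables. -/
theorem ent_list_le (hp : ∀ ω, 0 ≤ p ω) (X : ℕ → Ω → β) (Y : Ω → δ) {c : ℝ}
    (N : ℕ) (h : ∀ t < N, ent p (fun ω => (X t ω, Y ω)) ≤ ent p Y + c) :
    ent p (fun ω => ((List.range N).map fun t => X t ω, Y ω)) ≤ ent p Y + N * c := by
  induction N with
  | zero =>
    simp only [List.range_zero, List.map_nil, Nat.cast_zero, zero_mul, add_zero]
    exact ent_mono hp (by simp)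
  | succ N ih =>
    have h1 := ent_submodular hp (fun ω => (List.range N).map fun t => X t ω) (X N) Y
    have h2 := ih fun t ht => h t (ht.trans N.lt_succ_self)
    have h3 := h N N.lt_succ_self
    have h4 : ent p (fun ω => ((List.range (N + 1)).map fun t => X t ω, Y ω))
        ≤ ent p (fun ω => ((List.range N).map (fun t => X t ω), X N ω, Y ω)) := by
      refine ent_mono hp fun ω ω' _ _ e => ?_
      simp only [Prod.mk.injEq] at e
      simp only [List.range_succ, List.map_append, Prod.mk.injEq, List.map_cons, List.map_nil]
      exact ⟨by rw [e.1, e.2.1], e.2.2⟩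
    push_cast
    linarith

open Classical in
theorem ent_stationary_le (hp : ∀ ω, 0 ≤ p ω) (h1 : ∑ ω, p ω = 1) (N : ℕ) (σ : ℕ → Ω ≃ Ω)
    (hσ : ∀ t ω, p (σ t ω) = p ω) (W : Ω → β) (U : Ω → υ) (V : Ω → ι) (E : Ω → Prop)
    {K L η : ℝ} (hE : ∑ ω, (if E ω then p ω else 0) ≤ η) (hK : 1 ≤ K) (hL : 1 ≤ L)
    (hUK : ∃ T : Finset υ, (∀ ω, U ω ∈ T) ∧ (T.card : ℝ) ≤ K)
    (hVL : ∃ T : Finset ι, (∀ ω, V ω ∈ T) ∧ (T.card : ℝ) ≤ L)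
    (hV : ∀ ω ω', ¬ E ω → ¬ E ω' → (∀ t < N, W (σ t ω) = W (σ t ω')) → V ω = V ω')
    (hU : ∀ t < N, ∀ ω, ∃ T : Finset υ,
      (∀ ω', ¬ E ω' → U ω' = U ω → U (σ t ω') ∈ T) ∧ (T.card : ℝ) ≤ 3) :
    ent p V ≤ Real.log 2 + η * Real.log L + Real.log K
      + N * (Real.log 2 + Real.log 3 + η * Real.log K
        + (ent p (fun ω => (W ω, U ω)) - ent p U)) := by
  set e : Ω → Bool := fun ω => decide (E ω) with he
  have he2 : ent p e ≤ Real.log 2 := by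
    simpa using ent_le_log_card hp h1 (X := e) (T := Finset.univ) (by simp)
  have hsum : ∀ A B : ℝ, 1 ≤ A → 1 ≤ B → ∑ ω, p ω * Real.log (if e ω then A else B)
      ≤ η * Real.log A + Real.log B := by
    intro A B hA hB
    have a1 : ∑ ω, p ω * Real.log (if e ω then A else B)
        ≤ ∑ ω, ((if E ω then p ω else 0) * Real.log A + p ω * Real.log B) := by
      refine Finset.sum_le_sum fun ω _ => ?_
      have := mul_nonneg (hp ω) (Real.log_nonneg hB)
      by_cases h : E ω <;> simp [he, h, this]
    rw [Finset.sum_add_distrib, ← Finset.sum_mul, ← Finset.sum_mul, h1, one_mul] at a1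
    have := mul_le_mul_of_nonneg_right hE (Real.log_nonneg hA)
    linarith
  have hUent : ent p U ≤ Real.log K := by
    obtain ⟨T, hT, hc⟩ := hUK
    refine (ent_le_log_card hp h1 fun ω _ => hT ω).trans ?_
    rcases T.eq_empty_or_nonempty with rfl | hne
    · simpa using Real.log_nonneg hK
    · exact Real.log_le_log (by exact_mod_cast hne.card_pos) hc
  have step : ∀ t < N, ent p (fun ω => (W (σ t ω), U ω)) ≤ ent p U
      + (Real.log 2 + Real.log 3 + η * Real.log K
        + (ent p (fun ω => (W ω, U ω)) - ent p U)) := by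
    intro t ht
    have b1 := ent_submodular hp (fun ω => W (σ t ω)) U (fun ω => U (σ t ω))
    have b2 : ent p (fun ω => (W (σ t ω), U (σ t ω))) = ent p (fun ω => (W ω, U ω)) :=
      ent_comp_equiv (fun ω => (W ω, U ω)) (σ t) (hσ t)
    have b3 : ent p (fun ω => U (σ t ω)) = ent p U := ent_comp_equiv U (σ t) (hσ t)
    have b4 : ent p (fun ω => (W (σ t ω), U ω))
        ≤ ent p (fun ω => (W (σ t ω), U ω, U (σ t ω))) := ent_mono hp (by simp +contextual)
    have b5 : ent p (fun ω => (U ω, U (σ t ω))) ≤ ent p (fun ω => (U (σ t ω), (U ω, e ω))) :=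
      ent_mono hp (by simp +contextual)
    have b6 := ent_prod_le_of_card_le hp (fun ω => U (σ t ω)) (fun ω => (U ω, e ω))
      (fun y => if y.2 then K else 3) (by
        intro ω _
        by_cases h : E ω
        · obtain ⟨T, hT, hc⟩ := hUK
          exact ⟨T, fun ω' _ _ => hT _, by simpa [he, h] using hc⟩
        · obtain ⟨T, hT, hc⟩ := hU t ht ω
          refine ⟨T, fun ω' _ hω' => ?_, by simpa [he, h] using hc⟩
          obtain ⟨e1, e2⟩ := Prod.mk.inj hω'
          exact hT ω' (by simpa [he, h] using e2) e1)
    have b7 := ent_prod_le_add hp h1 U e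
    have b8 := hsum K 3 hK (by norm_num)
    simp only at b6
    linarith
  have c1 := ent_list_le hp (fun t ω => W (σ t ω)) U N step
  set G : Ω → List β := fun ω => (List.range N).map fun t => W (σ t ω) with hG
  have c2 : ent p (fun ω => (V ω, (G ω, e ω))) ≤ ent p (fun ω => (G ω, e ω)) + η * Real.log L := by
    refine (ent_prod_le_of_card_le hp V (fun ω => (G ω, e ω)) (fun y => if y.2 then L else 1)
      ?_).trans ?_
    · intro ω _
      by_cases h : E ω
      · obtain ⟨T, hT, hc⟩ := hVL
        exact ⟨T, fun ω' _ _ => hT _, by simpa [he, h] using hc⟩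
      · refine ⟨{V ω}, fun ω' _ hω' => ?_, by simp [he, h]⟩
        obtain ⟨e1, e2⟩ := Prod.mk.inj hω'
        have : ¬ E ω' := by simpa [he, h] using e2
        rw [Finset.mem_singleton]
        refine hV ω' ω this h fun t ht => ?_
        simp only [hG] at e1
        exact List.map_inj_left.1 e1 t (List.mem_range.2 ht)
    · have := hsum L 1 hL le_rfl
      simp only [Real.log_one, add_zero] at this ⊢
      linarith
  have c3 : ent p V ≤ ent p (fun ω => (V ω, (G ω, e ω))) := ent_mono hp (by simp +contextual)
  have c4 := ent_prod_le_add hp h1 G e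
  have c5 : ent p G ≤ ent p (fun ω => (G ω, U ω)) := ent_mono hp (by simp +contextual)
  linarith

end Stationary

/-- Rotation of the time coordinate. -/
def timeShift (n : ℕ) [NeZero n] (F : Type*) (k : ℕ) : Fin n × F ≃ Fin n × F :=
  (Equiv.addRight (Fin.ofNat n k)).prodCongr (Equiv.refl F)

theorem timeShift_apply {F : Type*} {n : ℕ} [NeZero n] (k : ℕ) (ω : Fin n × F) (h : ω.1 + k < n) :
    ((timeShift n F k ω).1 : ℕ) = ω.1 + k ∧ (timeShift n F k ω).2 = ω.2 := by
  refine ⟨?_, rfl⟩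
  simp [timeShift, Fin.val_add, Nat.mod_eq_of_lt h]

section Uniform

variable {F β γ : Type*} [Fintype F]

/-- The uniform weights on a finite type. -/
noncomputable def unif (F : Type*) [Fintype F] (_ : F) : ℝ := (Fintype.card F : ℝ)⁻¹

theorem unif_nonneg (x : F) : 0 ≤ unif F x := by unfold unif; positivity

theorem unif_pos (x : F) : 0 < unif F x := by
  have : 0 < Fintype.card F := Fintype.card_pos_iff.2 ⟨x⟩
  unfold unif; positivity

theorem sum_unif [Nonempty F] : ∑ x, unif F x = 1 := by
  simp [unif]

theorem ent_unif_of_injective [Nonempty F] {X : F → β} (hX : Function.Injective X) :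
    ent (unif F) X = Real.log (Fintype.card F) := by
  have : ∀ x, atomMass (unif F) X x = (Fintype.card F : ℝ)⁻¹ := by
    intro x
    rw [atomMass, Finset.sum_eq_single x (fun y _ hy => if_neg fun e => hy (hX e)) (by simp)]
    simp [unif]
  simp only [ent, this, Real.log_inv, neg_neg]
  rw [← Finset.sum_mul, sum_unif, one_mul]

theorem ent_unif_fin_prod {n : ℕ} [NeZero n] [Nonempty F] (X : ℕ → F → β) :
    ent (unif (Fin n × F)) (fun ω => ((ω.1 : ℕ), X ω.1 ω.2))
      = Real.log n + (n : ℝ)⁻¹ * ∑ j ∈ Finset.range n, ent (unif F) (X j) := by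
  classical
  have hn : (n : ℝ) ≠ 0 := by exact_mod_cast NeZero.ne n
  have h : ∀ ω : Fin n × F, atomMass (unif (Fin n × F)) (fun ω => ((ω.1 : ℕ), X ω.1 ω.2)) ω
      = (n : ℝ)⁻¹ * atomMass (unif F) (X ω.1) ω.2 := by
    intro ω
    rw [atomMass.eq_def, Fintype.sum_prod_type, Finset.sum_eq_single ω.1, atomMass.eq_def,
      Finset.mul_sum]
    · refine Finset.sum_congr rfl fun x _ => ?_
      by_cases hx : X ω.1 x = X ω.1 ω.2 <;> simp [hx, unif, mul_comm]
    · intro j _ hj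
      refine Finset.sum_eq_zero fun x _ => if_neg fun e => hj (Fin.ext (Prod.mk.inj e).1)
    · simp
  rw [ent.eq_def (unif (Fin n × F))]
  simp only [h]
  rw [Fintype.sum_prod_type]
  have h2 : ∀ j : Fin n, ∑ x, unif (Fin n × F) (j, x)
        * (-Real.log ((n : ℝ)⁻¹ * atomMass (unif F) (X j) x))
      = (n : ℝ)⁻¹ * Real.log n + (n : ℝ)⁻¹ * ent (unif F) (X j) := by
    intro j
    have h3 : ∀ x, unif (Fin n × F) (j, x)
        * (-Real.log ((n : ℝ)⁻¹ * atomMass (unif F) (X j) x))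
        = (n : ℝ)⁻¹ * Real.log n * unif F x
          + (n : ℝ)⁻¹ * (unif F x * (-Real.log (atomMass (unif F) (X j) x))) := by
      intro x
      rw [Real.log_mul (inv_ne_zero hn) (atomMass_pos unif_nonneg _ (unif_pos x)).ne',
        Real.log_inv]
      simp [unif]
      ring
    simp_rw [h3]
    rw [Finset.sum_add_distrib, ← Finset.mul_sum, ← Finset.mul_sum, sum_unif, mul_one, ent]
  simp_rw [h2]
  rw [← Fin.sum_univ_eq_sum_range (fun j => ent (unif F) (X j)), Finset.sum_add_distrib,
    ← Finset.mul_sum _ (fun j : Fin n => ent (unif F) (X j))]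
  simp [hn]

theorem sum_range_shift_sub (h : ℕ → ℝ) (n m : ℕ) :
    ∑ j ∈ Finset.range n, h (j + m) - ∑ j ∈ Finset.range n, h j
      = ∑ j ∈ Finset.range m, h (n + j) - ∑ j ∈ Finset.range m, h j := by
  have h1 := Finset.sum_range_add h n m
  have h2 := Finset.sum_range_add h m n
  simp only [add_comm m] at h2
  linarith

/-- Telescoping of the entropy increments along a tower of words. -/
theorem le_ent_increment {n m : ℕ} [NeZero n] [Nonempty F] (X : ℕ → F → β) {B : ℝ}
    (hinj : ∀ i, n ≤ i → Function.Injective (X i))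
    (hB : ∀ i < m, ent (unif F) (X i) ≤ B) :
    m * (Real.log (Fintype.card F) - B) / n
      ≤ ent (unif (Fin n × F)) (fun ω => ((ω.1 : ℕ), X (ω.1 + m) ω.2))
        - ent (unif (Fin n × F)) (fun ω => ((ω.1 : ℕ), X ω.1 ω.2)) := by
  rw [ent_unif_fin_prod (fun j => X (j + m)), ent_unif_fin_prod X]
  have h1 := sum_range_shift_sub (fun j => ent (unif F) (X j)) n m
  have h2 : ∑ j ∈ Finset.range m, ent (unif F) (X (n + j)) = m * Real.log (Fintype.card F) := by
    simp [ent_unif_of_injective (hinj _ (Nat.le_add_right n _))]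
  have h3 : ∑ j ∈ Finset.range m, ent (unif F) (X j) ≤ m * B := by
    refine (Finset.sum_le_card_nsmul _ _ B fun i hi => hB i (Finset.mem_range.1 hi)).trans ?_
    simp
  have h4 : (0 : ℝ) ≤ (n : ℝ)⁻¹ := by positivity
  have h5 : m * (Real.log (Fintype.card F) - B)
      ≤ ∑ j ∈ Finset.range n, ent (unif F) (X (j + m))
        - ∑ j ∈ Finset.range n, ent (unif F) (X j) := by
    rw [h1, h2]
    linarith
  have := mul_le_mul_of_nonneg_left h5 h4
  rw [mul_sub] at this
  rw [div_eq_inv_mul]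
  linarith

open Classical in
theorem sum_unif_late_le {n : ℕ} [NeZero n] [Nonempty F] (l : ℕ) :
    ∑ ω : Fin n × F, (if n ≤ ω.1 + l then unif (Fin n × F) ω else 0) ≤ l / n := by
  have hn : (n : ℝ) ≠ 0 := by exact_mod_cast NeZero.ne n
  have hF : (Fintype.card F : ℝ) ≠ 0 := by exact_mod_cast Fintype.card_ne_zero
  rw [Fintype.sum_prod_type]
  have : ∀ j : Fin n, ∑ x : F, (if n ≤ (j : ℕ) + l then unif (Fin n × F) (j, x) else 0)
      = if n ≤ (j : ℕ) + l then (n : ℝ)⁻¹ else 0 := by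
    intro j
    split_ifs
    · simp [unif, hF]
    · simp
  simp only [this]
  rw [Fin.sum_univ_eq_sum_range (fun j => if n ≤ j + l then (n : ℝ)⁻¹ else 0), ← Finset.sum_filter,
    Finset.sum_const, nsmul_eq_mul, div_eq_mul_inv]
  refine mul_le_mul_of_nonneg_right ?_ (by positivity)
  have hsub : (Finset.range n).filter (fun j => n ≤ j + l) ⊆ Finset.Ico (n - l) n := by
    intro j
    simp only [Finset.mem_filter, Finset.mem_range, Finset.mem_Ico]
    omega
  have := Finset.card_le_card hsub
  rw [Nat.card_Ico] at this
  exact_mod_cast this.trans (by omega)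

end Uniform

section FloorFract

theorem fract_pow_mul_fract (c j m : ℕ) (x : ℝ) :
    Int.fract ((c : ℝ) ^ m * Int.fract ((c : ℝ) ^ j * x)) = Int.fract ((c : ℝ) ^ (j + m) * x) := by
  rw [Int.fract_eq_fract]
  refine ⟨-(c ^ m * ⌊(c : ℝ) ^ j * x⌋), ?_⟩
  rw [Int.fract]
  push_cast
  ring

theorem floor_pow_add (c j m : ℕ) (x : ℝ) :
    ⌊(c : ℝ) ^ (j + m) * x⌋
      = c ^ m * ⌊(c : ℝ) ^ j * x⌋ + ⌊(c : ℝ) ^ m * Int.fract ((c : ℝ) ^ j * x)⌋ := by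
  have : (c : ℝ) ^ (j + m) * x = ((c ^ m * ⌊(c : ℝ) ^ j * x⌋ : ℤ) : ℝ)
      + (c : ℝ) ^ m * Int.fract ((c : ℝ) ^ j * x) := by
    rw [Int.fract]
    push_cast
    ring
  rw [this, Int.floor_intCast_add]

theorem floor_pow_mul_mem {c m : ℕ} {x : ℝ} (hx : x ∈ Ico (0 : ℝ) 1) (hc : 0 < c) :
    ⌊(c : ℝ) ^ m * x⌋ ∈ Finset.Ico (0 : ℤ) (c ^ m) := by
  have hc' : (0 : ℝ) < (c : ℝ) ^ m := by positivity
  rw [Finset.mem_Ico, Int.le_floor, Int.floor_lt]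
  push_cast
  exact ⟨mul_nonneg hc'.le hx.1, by nlinarith [hx.2]⟩

theorem floor_pow_eq_ediv {c : ℕ} (hc : 0 < c) (j m : ℕ) (x : ℝ) :
    ⌊(c : ℝ) ^ j * x⌋ = ⌊(c : ℝ) ^ (j + m) * x⌋ / (c : ℤ) ^ m := by
  have h := Finset.mem_Ico.1 (floor_pow_mul_mem (c := c) (m := m)
    (x := Int.fract ((c : ℝ) ^ j * x)) ⟨Int.fract_nonneg _, Int.fract_lt_one _⟩ hc)
  have hc' : ((c : ℤ) ^ m) ≠ 0 := by positivity
  rw [floor_pow_add, Int.mul_add_ediv_left _ _ hc', Int.ediv_eq_zero_of_lt h.1 h.2, add_zero]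

end FloorFract

section Dynamics

/-- The number of base-`b` digits read while `m` base-`a` digits are read, for lines whose
logarithmic slope (base `b`) is `u`. -/
noncomputable def btime (a b : ℕ) (u : ℝ) (m : ℕ) : ℕ := ⌈m * Real.logb b a - u⌉₊

/-- The logarithmic slope after `m` steps: the rotation by `-logb b a` on `[0, 1)`. -/
noncomputable def rot (a b : ℕ) (u : ℝ) (m : ℕ) : ℝ := u - m * Real.logb b a + btime a b u m

/-- The point reached after `m` steps. -/
noncomputable def pt (a b : ℕ) (u : ℝ) (m : ℕ) (p : ℝ × ℝ) : ℝ × ℝ :=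
  (Int.fract ((a : ℝ) ^ m * p.1), Int.fract ((b : ℝ) ^ btime a b u m * p.2))

/-- The approximate square of side `a ^ (-m)` that contains a point. -/
noncomputable def word (a b : ℕ) (u : ℝ) (m : ℕ) (p : ℝ × ℝ) : ℤ × ℤ × ℕ :=
  (⌊(a : ℝ) ^ m * p.1⌋, ⌊(b : ℝ) ^ btime a b u m * p.2⌋, btime a b u m)

/-- The line of slope `s * b ^ u` and intercept `c`. -/
def sline (b : ℕ) (s u c : ℝ) : Set (ℝ × ℝ) := {p | p.2 = s * (b : ℝ) ^ u * p.1 + c}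

variable {a b : ℕ} {u c s : ℝ}

theorem logb_pos' (ha : 2 ≤ a) (hb : 2 ≤ b) : 0 < Real.logb b a :=
  Real.logb_pos (by exact_mod_cast hb) (by exact_mod_cast ha)

theorem btime_eq (t : ℕ) {m : ℕ} (h0 : 0 ≤ u - m * Real.logb b a + t)
    (h1 : u - m * Real.logb b a + t < 1) : btime a b u m = t := by
  rcases t.eq_zero_or_pos with rfl | ht
  · rw [btime, Nat.ceil_eq_zero]
    simp at h0
    linarith
  · rw [btime, Nat.ceil_eq_iff ht.ne', Nat.cast_sub ht]
    push_cast
    constructor <;> linarith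

theorem rot_mem (ha : 2 ≤ a) (hb : 2 ≤ b) (hu : u ∈ Ico (0 : ℝ) 1) (m : ℕ) :
    rot a b u m ∈ Ico (0 : ℝ) 1 := by
  have hα := logb_pos' ha hb
  have hm : 0 ≤ m * Real.logb b a := by positivity
  unfold rot btime
  have h1 := Nat.le_ceil (m * Real.logb b a - u)
  refine ⟨by linarith, ?_⟩
  rcases le_total 0 (m * Real.logb b a - u) with h | h
  · have := Nat.ceil_lt_add_one h
    linarith
  · rw [Nat.ceil_eq_zero.2 h]
    have := hu.2
    push_cast
    linarith

theorem btime_add (ha : 2 ≤ a) (hb : 2 ≤ b) (hu : u ∈ Ico (0 : ℝ) 1) (j m : ℕ) :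
    btime a b u (j + m) = btime a b u j + btime a b (rot a b u j) m := by
  have h := rot_mem ha hb (rot_mem ha hb hu j) m
  have e : u - ((j + m : ℕ) : ℝ) * Real.logb b a
      + ((btime a b u j + btime a b (rot a b u j) m : ℕ) : ℝ) = rot a b (rot a b u j) m := by
    conv_rhs => rw [rot]
    conv_rhs => rw [rot.eq_def a b u j]
    push_cast
    rw [rot.eq_def a b u j]
    ring
  exact btime_eq _ (e ▸ h.1) (e ▸ h.2)

theorem rot_add (ha : 2 ≤ a) (hb : 2 ≤ b) (hu : u ∈ Ico (0 : ℝ) 1) (j m : ℕ) :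
    rot a b u (j + m) = rot a b (rot a b u j) m := by
  rw [rot.eq_def a b u (j + m), btime_add ha hb hu, rot.eq_def a b (rot a b u j) m]
  push_cast
  rw [rot.eq_def a b u j]
  ring

theorem btime_le (ha : 2 ≤ a) (hab : a < b) (hu : u ∈ Ico (0 : ℝ) 1) (m : ℕ) :
    btime a b u m ≤ m := by
  refine Nat.ceil_le.2 ?_
  have hb : (1 : ℝ) < b := by exact_mod_cast (by omega : 1 < b)
  have : Real.logb b a ≤ 1 := by
    rw [Real.logb_le_iff_le_rpow hb (by positivity), Real.rpow_one]
    exact_mod_cast hab.le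
  have hm : (0 : ℝ) ≤ m := by positivity
  nlinarith [hu.1]

theorem pow_btime_mul_rpow (ha : 2 ≤ a) (hb : 2 ≤ b) (u : ℝ) (m : ℕ) :
    (b : ℝ) ^ btime a b u m * (b : ℝ) ^ u = (a : ℝ) ^ m * (b : ℝ) ^ rot a b u m := by
  have hb0 : (0 : ℝ) < b := by positivity
  have hb1 : (b : ℝ) ≠ 1 := by exact_mod_cast (by omega : b ≠ 1)
  have h1 : (a : ℝ) ^ m = (b : ℝ) ^ (m * Real.logb b a) := by
    rw [mul_comm, Real.rpow_mul hb0.le, Real.rpow_logb hb0 hb1 (by positivity), Real.rpow_natCast]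
  rw [h1, ← Real.rpow_natCast, ← Real.rpow_add hb0, ← Real.rpow_add hb0, rot]
  congr 1
  ring

theorem rpow_rot_mem (hb : 2 ≤ b) (hu : u ∈ Ico (0 : ℝ) 1) :
    (b : ℝ) ^ u ∈ Icc (1 : ℝ) b := by
  have hb1 : (1 : ℝ) ≤ b := by exact_mod_cast (by omega : 1 ≤ b)
  refine ⟨Real.one_le_rpow hb1 hu.1, ?_⟩
  simpa using Real.rpow_le_rpow_of_exponent_le hb1 hu.2.le

theorem pt_pt (ha : 2 ≤ a) (hb : 2 ≤ b) (hu : u ∈ Ico (0 : ℝ) 1) (j m : ℕ) (p : ℝ × ℝ) :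
    pt a b (rot a b u j) m (pt a b u j p) = pt a b u (j + m) p := by
  simp only [pt, btime_add ha hb hu, fract_pow_mul_fract]

theorem word_add (ha : 2 ≤ a) (hb : 2 ≤ b) (hu : u ∈ Ico (0 : ℝ) 1) (j m : ℕ) (p : ℝ × ℝ) :
    word a b u (j + m) p =
      (a ^ m * (word a b u j p).1 + (word a b (rot a b u j) m (pt a b u j p)).1,
        b ^ (word a b (rot a b u j) m (pt a b u j p)).2.2 * (word a b u j p).2.1
          + (word a b (rot a b u j) m (pt a b u j p)).2.1,
        (word a b u j p).2.2 + (word a b (rot a b u j) m (pt a b u j p)).2.2) := by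
  simp only [word, pt, btime_add ha hb hu, floor_pow_add]

theorem word_eq_of_word_add_eq (ha : 2 ≤ a) (hb : 2 ≤ b) (hu : u ∈ Ico (0 : ℝ) 1) {j m : ℕ}
    {p p' : ℝ × ℝ} (h : word a b u (j + m) p = word a b u (j + m) p') :
    word a b u j p = word a b u j p' ∧
      word a b (rot a b u j) m (pt a b u j p) = word a b (rot a b u j) m (pt a b u j p') := by
  have h1 : word a b u j p = word a b u j p' := by
    simp only [word, btime_add ha hb hu, Prod.mk.injEq, and_true] at h ⊢
    rw [floor_pow_eq_ediv (by omega) j m p.1, floor_pow_eq_ediv (by omega) j m p'.1, h.1,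
      floor_pow_eq_ediv (by omega) _ (btime a b (rot a b u j) m) p.2,
      floor_pow_eq_ediv (by omega) _ (btime a b (rot a b u j) m) p'.2, h.2]
    exact ⟨rfl, rfl⟩
  refine ⟨h1, ?_⟩
  rw [word_add ha hb hu, word_add ha hb hu, h1] at h
  have h2 : (word a b (rot a b u j) m (pt a b u j p)).2.2
      = (word a b (rot a b u j) m (pt a b u j p')).2.2 := rfl
  simp only [Prod.mk.injEq, h2, add_right_inj] at h
  exact Prod.ext h.1 (Prod.ext h.2.1 h2)

theorem pt_mem_sline (ha : 2 ≤ a) (hb : 2 ≤ b) {p : ℝ × ℝ}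
    (hp : p ∈ sline b s u c) (j : ℕ) :
    pt a b u j p ∈ sline b s (rot a b u j)
      (s * (b : ℝ) ^ rot a b u j * (word a b u j p).1 + (b : ℝ) ^ (word a b u j p).2.2 * c
        - (word a b u j p).2.1) := by
  have h := pow_btime_mul_rpow ha hb u j
  simp only [sline, mem_ofPred_eq] at hp ⊢
  simp only [pt, word, Int.fract]
  generalize ⌊(a : ℝ) ^ j * p.1⌋ = P
  generalize ⌊(b : ℝ) ^ btime a b u j * p.2⌋ = Q
  rw [hp]
  linear_combination s * p.1 * h

theorem abs_floor_sub_le (ha : 2 ≤ a) (hb : 2 ≤ b) (hu : u ∈ Ico (0 : ℝ) 1) {m : ℕ}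
    {p p' : ℝ × ℝ} (hp : p ∈ sline b s u c) (hp' : p' ∈ sline b s u c)
    (h : ⌊(a : ℝ) ^ m * p.1⌋ = ⌊(a : ℝ) ^ m * p'.1⌋) :
    |(word a b u m p').2.1 - (word a b u m p).2.1| ≤ ⌈|s| * b⌉₊ + 1 := by
  have h1 := Int.abs_sub_lt_one_of_floor_eq_floor h
  have h2 := pow_btime_mul_rpow ha hb u m
  have h3 : (b : ℝ) ^ btime a b u m * p.2 - (b : ℝ) ^ btime a b u m * p'.2
      = s * (b : ℝ) ^ rot a b u m * ((a : ℝ) ^ m * p.1 - (a : ℝ) ^ m * p'.1) := by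
    simp only [sline, mem_ofPred_eq] at hp hp'
    rw [hp, hp']
    linear_combination s * (p.1 - p'.1) * h2
  have h4 : |(b : ℝ) ^ btime a b u m * p.2 - (b : ℝ) ^ btime a b u m * p'.2| ≤ |s| * b := by
    have h5 := rpow_rot_mem hb (rot_mem ha hb hu m)
    have h6 : (0 : ℝ) ≤ (b : ℝ) ^ rot a b u m := by linarith [h5.1]
    rw [h3, abs_mul, abs_mul, abs_of_nonneg h6]
    calc |s| * (b : ℝ) ^ rot a b u m * |(a : ℝ) ^ m * p.1 - (a : ℝ) ^ m * p'.1|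
        ≤ |s| * (b : ℝ) ^ rot a b u m * 1 :=
          mul_le_mul_of_nonneg_left h1.le (by positivity)
      _ ≤ |s| * b := by rw [mul_one]; exact mul_le_mul_of_nonneg_left h5.2 (abs_nonneg s)
  simp only [word]
  set y := (b : ℝ) ^ btime a b u m * p.2
  set y' := (b : ℝ) ^ btime a b u m * p'.2
  have h7 := Nat.le_ceil (|s| * b)
  have e1 := Int.floor_le y
  have e2 := Int.lt_floor_add_one y
  have e3 := Int.floor_le y'
  have e4 := Int.lt_floor_add_one y'
  rw [abs_le] at h4 ⊢
  have i1 : (⌊y'⌋ : ℝ) - ⌊y⌋ < ⌈|s| * b⌉₊ + 1 := by linarith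
  have i2 : (⌊y⌋ : ℝ) - ⌊y'⌋ < ⌈|s| * b⌉₊ + 1 := by linarith
  have j1 : ⌊y'⌋ - ⌊y⌋ < (⌈|s| * b⌉₊ : ℤ) + 1 := by exact_mod_cast i1
  have j2 : ⌊y⌋ - ⌊y'⌋ < (⌈|s| * b⌉₊ : ℤ) + 1 := by exact_mod_cast i2
  constructor <;> omega

/-- The multiplicity with which approximate squares on a line share their first coordinate. -/
noncomputable def mult (b : ℕ) (s : ℝ) : ℕ := 2 * (⌈|s| * b⌉₊ + 1) + 1

theorem exists_words_card_le (ha : 2 ≤ a) (hb : 2 ≤ b) (hu : u ∈ Ico (0 : ℝ) 1) (m : ℕ)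
    {R : Set (ℝ × ℝ)} (hR : R ⊆ sline b s u c) (X : Finset ℤ)
    (hX : ∀ p ∈ R, ⌊(a : ℝ) ^ m * p.1⌋ ∈ X) :
    ∃ T : Finset (ℤ × ℤ × ℕ), (∀ p ∈ R, word a b u m p ∈ T) ∧ T.card ≤ mult b s * X.card := by
  have hrep : ∀ v : ℤ, ∃ q : ℤ, ∀ p ∈ R, ⌊(a : ℝ) ^ m * p.1⌋ = v →
      |(word a b u m p).2.1 - q| ≤ ⌈|s| * b⌉₊ + 1 := by
    intro v
    by_cases h : ∃ p ∈ R, ⌊(a : ℝ) ^ m * p.1⌋ = v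
    · obtain ⟨p, hp, rfl⟩ := h
      exact ⟨_, fun p' hp' e => abs_floor_sub_le ha hb hu (hR hp) (hR hp') e.symm⟩
    · push Not at h
      exact ⟨0, fun p hp e => absurd e (h p hp)⟩
  choose q hq using hrep
  set D : ℤ := ⌈|s| * b⌉₊ + 1 with hD
  refine ⟨(X ×ˢ Finset.Icc (-D) D).image fun z => (z.1, q z.1 + z.2, btime a b u m), ?_, ?_⟩
  · intro p hp
    rw [Finset.mem_image]
    refine ⟨(⌊(a : ℝ) ^ m * p.1⌋, (word a b u m p).2.1 - q ⌊(a : ℝ) ^ m * p.1⌋), ?_, ?_⟩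
    · rw [Finset.mem_product, Finset.mem_Icc]
      exact ⟨hX p hp, abs_le.1 (hq _ p hp rfl)⟩
    · simp [word]
  · refine Finset.card_image_le.trans ?_
    rw [Finset.card_product, Int.card_Icc, mul_comm]
    refine Nat.mul_le_mul_right _ ?_
    rw [mult]
    omega

end Dynamics

section Counting

/-- Joint invariance under multiplication by `a` and `b` in the two coordinates, modulo one. -/
structure IsInvariant (a b : ℕ) (S : Set (ℝ × ℝ)) : Prop where
  subset : S ⊆ Ico 0 1 ×ˢ Ico 0 1
  fract_mem : ∀ p ∈ S, ∀ i j : ℕ,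
    (Int.fract ((a : ℝ) ^ i * p.1), Int.fract ((b : ℝ) ^ j * p.2)) ∈ S

/-- The `a`-adic intervals of generation `m` met by a slice of `S`. -/
def xset (a b : ℕ) (s : ℝ) (S : Set (ℝ × ℝ)) (u c : ℝ) (m : ℕ) : Set ℤ :=
  (fun p : ℝ × ℝ => ⌊(a : ℝ) ^ m * p.1⌋) '' (S ∩ sline b s u c)

/-- The maximal number of `a`-adic intervals of generation `m` met by a slice of `S` with
logarithmic slope in `[0, 1)`. -/
noncomputable def maxCount (a b : ℕ) (s : ℝ) (S : Set (ℝ × ℝ)) (m : ℕ) : ℕ :=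
  sSup {k | ∃ u ∈ Ico (0 : ℝ) 1, ∃ c, (xset a b s S u c m).ncard = k}

variable {a b : ℕ} {u c s : ℝ} {S : Set (ℝ × ℝ)}

theorem xset_subset (ha : 2 ≤ a) (hS : IsInvariant a b S) (u c : ℝ) (m : ℕ) :
    xset a b s S u c m ⊆ (Finset.Ico (0 : ℤ) (a ^ m) : Set ℤ) := by
  rintro _ ⟨p, hp, rfl⟩
  exact floor_pow_mul_mem (hS.subset hp.1).1 (by omega)

theorem finite_xset (ha : 2 ≤ a) (hS : IsInvariant a b S) (u c : ℝ) (m : ℕ) :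
    (xset a b s S u c m).Finite :=
  (Finset.finite_toSet _).subset (xset_subset ha hS u c m)

theorem ncard_xset_le (ha : 2 ≤ a) (hS : IsInvariant a b S) (u c : ℝ) (m : ℕ) :
    (xset a b s S u c m).ncard ≤ a ^ m := by
  refine (Set.ncard_le_ncard (xset_subset ha hS u c m) (Finset.finite_toSet _)).trans ?_
  rw [Set.ncard_coe_finset, Int.card_Ico]
  simp only [sub_zero]
  exact_mod_cast le_rfl

theorem bddAbove_ncard_xset (ha : 2 ≤ a) (hS : IsInvariant a b S) (m : ℕ) :
    BddAbove {k | ∃ u ∈ Ico (0 : ℝ) 1, ∃ c, (xset a b s S u c m).ncard = k} :=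
  ⟨a ^ m, by rintro _ ⟨u, _, c, rfl⟩; exact ncard_xset_le ha hS u c m⟩

theorem ncard_xset_le_maxCount (ha : 2 ≤ a) (hS : IsInvariant a b S) (hu : u ∈ Ico (0 : ℝ) 1)
    (c : ℝ) (m : ℕ) : (xset a b s S u c m).ncard ≤ maxCount a b s S m :=
  le_csSup (bddAbove_ncard_xset ha hS m) ⟨u, hu, c, rfl⟩

theorem exists_ncard_xset_eq (ha : 2 ≤ a) (hS : IsInvariant a b S) (s : ℝ) (m : ℕ) :
    ∃ u ∈ Ico (0 : ℝ) 1, ∃ c, (xset a b s S u c m).ncard = maxCount a b s S m :=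
  Nat.sSup_mem (s := {k | ∃ u ∈ Ico (0 : ℝ) 1, ∃ c, (xset a b s S u c m).ncard = k})
    ⟨_, 0, by simp, 0, rfl⟩ (bddAbove_ncard_xset ha hS m)

theorem one_le_maxCount (ha : 2 ≤ a) (hS : IsInvariant a b S) (hne : S.Nonempty) (s : ℝ) (m : ℕ) :
    1 ≤ maxCount a b s S m := by
  obtain ⟨p, hp⟩ := hne
  refine le_trans ?_ (ncard_xset_le_maxCount (s := s) ha hS (u := 0) (by simp)
    (p.2 - s * (b : ℝ) ^ (0 : ℝ) * p.1) m)
  rw [Nat.one_le_iff_ne_zero, Ne, Set.ncard_eq_zero (finite_xset ha hS _ _ _)]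
  exact Set.Nonempty.ne_empty ⟨_, p, ⟨hp, by simp [sline]⟩, rfl⟩

theorem pt_mem (hS : IsInvariant a b S) {p : ℝ × ℝ} (hp : p ∈ S) (j : ℕ) : pt a b u j p ∈ S :=
  hS.fract_mem p hp _ _

theorem exists_xset_fiber_card_le (ha : 2 ≤ a) (hb : 2 ≤ b) (hS : IsInvariant a b S)
    (hu : u ∈ Ico (0 : ℝ) 1) (c : ℝ) (k l : ℕ) (v : ℤ) :
    ∃ T : Finset ℤ, (∀ p ∈ S ∩ sline b s u c, ⌊(a : ℝ) ^ k * p.1⌋ = v →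
      ⌊(a : ℝ) ^ (k + l) * p.1⌋ ∈ T) ∧ T.card ≤ mult b s * maxCount a b s S l := by
  obtain ⟨T₀, hT₀, hc⟩ := exists_words_card_le ha hb hu k (c := c) (s := s)
    (R := {p | p ∈ S ∩ sline b s u c ∧ ⌊(a : ℝ) ^ k * p.1⌋ = v}) (fun p hp => hp.1.2) {v}
    (fun p hp => by simpa using hp.2)
  set X : ℤ × ℤ × ℕ → Finset ℤ := fun z =>
    (finite_xset (s := s) ha hS (rot a b u k)
      (s * (b : ℝ) ^ rot a b u k * z.1 + (b : ℝ) ^ z.2.2 * c - z.2.1) l).toFinset with hX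
  refine ⟨T₀.biUnion fun z => (X z).image fun w => a ^ l * v + w, fun p hp hv => ?_, ?_⟩
  · refine Finset.mem_biUnion.2 ⟨_, hT₀ p ⟨hp, hv⟩, Finset.mem_image.2
      ⟨⌊(a : ℝ) ^ l * Int.fract ((a : ℝ) ^ k * p.1)⌋, ?_, ?_⟩⟩
    · rw [hX, Set.Finite.mem_toFinset]
      exact ⟨pt a b u k p, ⟨pt_mem hS hp.1 k, pt_mem_sline ha hb hp.2 k⟩, rfl⟩
    · rw [floor_pow_add, hv]
  · refine (Finset.card_biUnion_le_card_mul _ _ (maxCount a b s S l) fun z _ => ?_).trans ?_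
    · refine Finset.card_image_le.trans ?_
      rw [hX, ← Set.ncard_eq_toFinset_card _ (finite_xset ha hS _ _ _)]
      exact ncard_xset_le_maxCount ha hS (rot_mem ha hb hu k) _ l
    · rw [Finset.card_singleton, mul_one] at hc
      exact Nat.mul_le_mul_right _ hc

theorem maxCount_add_le (ha : 2 ≤ a) (hb : 2 ≤ b) (hS : IsInvariant a b S) (s : ℝ) (k l : ℕ) :
    maxCount a b s S (k + l) ≤ maxCount a b s S k * (mult b s * maxCount a b s S l) := by
  obtain ⟨u, hu, c, h⟩ := exists_ncard_xset_eq ha hS s (k + l)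
  choose T hT hc using exists_xset_fiber_card_le (s := s) ha hb hS hu c k l
  set X := (finite_xset (s := s) ha hS u c k).toFinset with hX
  have hsub : xset a b s S u c (k + l) ⊆ (X.biUnion T : Finset ℤ) := by
    rintro _ ⟨p, hp, rfl⟩
    refine Finset.mem_coe.2 (Finset.mem_biUnion.2 ⟨⌊(a : ℝ) ^ k * p.1⌋, ?_, hT _ p hp rfl⟩)
    rw [hX, Set.Finite.mem_toFinset]
    exact ⟨p, hp, rfl⟩
  rw [← h]
  refine (Set.ncard_le_ncard hsub (Finset.finite_toSet _)).trans ?_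
  rw [Set.ncard_coe_finset]
  refine (Finset.card_biUnion_le_card_mul _ _ _ fun v _ => hc v).trans
    (Nat.mul_le_mul_right _ ?_)
  rw [hX, ← Set.ncard_eq_toFinset_card _ (finite_xset ha hS _ _ _)]
  exact ncard_xset_le_maxCount ha hS hu c k

/-- A maximal slice of generation `n`, represented by one point per `a`-adic interval. -/
theorem exists_finset_maxCount (ha : 2 ≤ a) (hS : IsInvariant a b S) (s : ℝ) (n : ℕ) :
    ∃ u ∈ Ico (0 : ℝ) 1, ∃ c, ∃ F : Finset (ℝ × ℝ), ↑F ⊆ S ∩ sline b s u c ∧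
      InjOn (fun p : ℝ × ℝ => ⌊(a : ℝ) ^ n * p.1⌋) F ∧ F.card = maxCount a b s S n := by
  obtain ⟨u, hu, c, h⟩ := exists_ncard_xset_eq ha hS s n
  obtain ⟨F, hF, hinj⟩ := Set.exists_subset_bijOn (S ∩ sline b s u c)
    (fun p : ℝ × ℝ => ⌊(a : ℝ) ^ n * p.1⌋)
  have hfin : F.Finite :=
    Set.Finite.of_finite_image (hinj.image_eq ▸ finite_xset ha hS u c n) hinj.injOn
  refine ⟨u, hu, c, hfin.toFinset, by simpa using hF, by simpa using hinj.injOn, ?_⟩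
  rw [← h, ← Set.ncard_eq_toFinset_card F hfin, ← hinj.injOn.ncard_image, hinj.image_eq, xset]

section Scenery

theorem exists_scenery_card_le (ha : 2 ≤ a) (hb : 2 ≤ b) (hS : IsInvariant a b S)
    (hu : u ∈ Ico (0 : ℝ) 1) (c : ℝ) (j m : ℕ) (z : ℤ × ℤ × ℕ) :
    ∃ T : Finset (ℤ × ℤ × ℕ), (∀ p ∈ S ∩ sline b s u c, word a b u j p = z →
      word a b (rot a b u j) m (pt a b u j p) ∈ T) ∧
      T.card ≤ mult b s * maxCount a b s S m := by
  set c' := s * (b : ℝ) ^ rot a b u j * z.1 + (b : ℝ) ^ z.2.2 * c - z.2.1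
  obtain ⟨T, hT, hc⟩ := exists_words_card_le ha hb (rot_mem ha hb hu j) m
    (R := S ∩ sline b s (rot a b u j) c') inter_subset_right
    (finite_xset (s := s) ha hS (rot a b u j) c' m).toFinset
    (fun p hp => by rw [Set.Finite.mem_toFinset]; exact ⟨p, hp, rfl⟩)
  refine ⟨T, fun p hp hz => hT _ ⟨pt_mem hS hp.1 j, ?_⟩, hc.trans (Nat.mul_le_mul_left _ ?_)⟩
  · have := pt_mem_sline ha hb hp.2 j
    rwa [hz] at this
  · rw [← Set.ncard_eq_toFinset_card _ (finite_xset ha hS _ _ _)]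
    exact ncard_xset_le_maxCount ha hS (rot_mem ha hb hu j) c' m

theorem exists_near_scenery_card_le (ha : 2 ≤ a) (hb : 2 ≤ b) (hS : IsInvariant a b S)
    (hu : u ∈ Ico (0 : ℝ) 1) (c : ℝ) (j k l : ℕ) (z : ℤ × ℤ × ℕ) (v : ℤ) :
    ∃ T : Finset (ℤ × ℤ × ℕ), (∀ p ∈ S ∩ sline b s u c, word a b u j p = z →
      |v - (word a b (rot a b u j) (k + l) (pt a b u j p)).1 / (a : ℤ) ^ l| ≤ 1 →
      word a b (rot a b u j) (k + l) (pt a b u j p) ∈ T) ∧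
      T.card ≤ 3 * mult b s ^ 2 * maxCount a b s S l := by
  set c' := s * (b : ℝ) ^ rot a b u j * z.1 + (b : ℝ) ^ z.2.2 * c - z.2.1
  have hu' := rot_mem ha hb hu j
  choose X hX hcX using exists_xset_fiber_card_le (s := s) ha hb hS hu' c' k l
  obtain ⟨T, hT, hc⟩ := exists_words_card_le ha hb hu' (k + l) (s := s) (c := c')
    (R := {p | p ∈ S ∩ sline b s (rot a b u j) c' ∧
      |v - ⌊(a : ℝ) ^ (k + l) * p.1⌋ / (a : ℤ) ^ l| ≤ 1}) (fun p hp => hp.1.2)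
    ((Finset.Icc (v - 1) (v + 1)).biUnion X) (fun p hp => by
      refine Finset.mem_biUnion.2 ⟨⌊(a : ℝ) ^ k * p.1⌋, ?_, hX _ p hp.1 rfl⟩
      have := hp.2
      rw [← floor_pow_eq_ediv (by omega), abs_le] at this
      rw [Finset.mem_Icc]
      omega)
  refine ⟨T, fun p hp hz hv => hT _ ⟨⟨pt_mem hS hp.1 j, ?_⟩, hv⟩, hc.trans ?_⟩
  · have := pt_mem_sline ha hb hp.2 j
    rwa [hz] at this
  · have h1 := Finset.card_biUnion_le_card_mul (Finset.Icc (v - 1) (v + 1)) X _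
      (fun v _ => hcX v)
    have h2 : (Finset.Icc (v - 1) (v + 1)).card = 3 := by
      rw [Int.card_Icc]; omega
    rw [h2] at h1
    calc mult b s * _ ≤ mult b s * (3 * (mult b s * maxCount a b s S l)) :=
          Nat.mul_le_mul_left _ h1
      _ = _ := by ring

end Scenery

end Counting

section Equidistribution

theorem floor_mul_fract_add {K : ℕ} (hK : 0 < K) (x y : ℝ) :
    ⌊(K : ℝ) * Int.fract (x + y)⌋ = (⌊(K : ℝ) * Int.fract x⌋ + ⌊(K : ℝ) * Int.fract y⌋) % (K : ℤ) ∨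
      ⌊(K : ℝ) * Int.fract (x + y)⌋
        = (⌊(K : ℝ) * Int.fract x⌋ + ⌊(K : ℝ) * Int.fract y⌋ + 1) % (K : ℤ) := by
  have hK' : (0 : ℝ) < K := by exact_mod_cast hK
  set w := ⌊(K : ℝ) * Int.fract (x + y)⌋ with hw
  have hw0 : 0 ≤ w ∧ w < K := by
    rw [hw, Int.le_floor, Int.floor_lt]
    push_cast
    exact ⟨mul_nonneg hK'.le (Int.fract_nonneg _), by nlinarith [Int.fract_lt_one (x + y)]⟩
  obtain ⟨z, hz⟩ : ∃ z : ℤ, Int.fract x + Int.fract y = Int.fract (x + y) + z :=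
    ⟨⌊x + y⌋ - ⌊x⌋ - ⌊y⌋, by push_cast [Int.fract]; ring⟩
  have h : (K : ℝ) * Int.fract x + K * Int.fract y
      = K * Int.fract (x + y) + ((K * z : ℤ) : ℝ) := by
    push_cast
    rw [← mul_add, hz]
    ring
  have h1 : w + K * z = ⌊(K : ℝ) * Int.fract x⌋ + ⌊(K : ℝ) * Int.fract y⌋ ∨
      w + K * z = ⌊(K : ℝ) * Int.fract x⌋ + ⌊(K : ℝ) * Int.fract y⌋ + 1 := by
    rw [hw, ← Int.floor_add_intCast, ← h]
    have e1 := Int.le_floor_add ((K : ℝ) * Int.fract x) (K * Int.fract y)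
    have e2 := Int.le_floor_add_floor ((K : ℝ) * Int.fract x) (K * Int.fract y)
    omega
  have h2 : (w + K * z) % (K : ℤ) = w := by
    rw [Int.add_mul_emod_self_left, Int.emod_eq_of_lt hw0.1 hw0.2]
  rcases h1 with h1 | h1
  · exact Or.inl (by rw [← h1, h2])
  · exact Or.inr (by rw [← h1, h2])

theorem exists_nat_mul_fract_floor_eq {α : ℝ} (hα : Irrational α) {K : ℕ} {i : ℕ} (hi : i < K) :
    ∃ t : ℕ, ⌊(K : ℝ) * Int.fract (t * α)⌋ = i := by
  have hK : (0 : ℝ) < K := by exact_mod_cast (Nat.zero_le i).trans_lt hi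
  have hd : DenseRange (· • (α : AddCircle (1 : ℝ)) : ℕ → AddCircle (1 : ℝ)) := by
    rw [← denseRange_zsmul_iff_nsmul, AddCircle.denseRange_zsmul_coe_iff, div_one]
    exact hα
  have hopen : IsOpen ((fun x : ℝ => (x : AddCircle (1 : ℝ))) ''
      Ioo ((i : ℝ) / K) ((i + 1 : ℝ) / K)) := QuotientAddGroup.isOpenMap_coe _ isOpen_Ioo
  obtain ⟨t, x, hx, hxt⟩ := hd.exists_mem_open hopen
    ((nonempty_Ioo.2 (by gcongr; linarith)).image _)
  refine ⟨t, ?_⟩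
  have hi1 : (i + 1 : ℝ) ≤ K := by exact_mod_cast hi
  rw [mem_Ioo, div_lt_iff₀ hK, lt_div_iff₀ hK] at hx
  have hx0 : 0 ≤ x ∧ x < 1 := by
    have : (0 : ℝ) ≤ i := by positivity
    constructor <;> nlinarith
  have : Int.fract (t * α) = x := by
    have h0 : ((t * α - x : ℝ) : AddCircle (1 : ℝ)) = 0 := by
      change (x : AddCircle (1 : ℝ)) = _ at hxt
      rw [AddCircle.coe_sub, hxt, ← nsmul_eq_mul, AddCircle.coe_nsmul, sub_self]
    rw [AddCircle.coe_eq_zero_iff] at h0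
    obtain ⟨z, hz⟩ := h0
    rw [Int.fract_eq_iff]
    exact ⟨hx0.1, hx0.2, z, by rw [← hz]; simp⟩
  rw [this, Int.floor_eq_iff]
  push_cast
  constructor <;> linarith

theorem irrational_logb {a b : ℕ} (ha : 2 ≤ a) (hb : 2 ≤ b)
    (hindep : ∀ m n : ℕ, a ^ m = b ^ n → m = 0 ∧ n = 0) : Irrational (Real.logb b a) := by
  rintro ⟨r, hr⟩
  have hpos := logb_pos' ha hb
  have hr0 : 0 < r := by rw [← hr] at hpos; exact_mod_cast hpos
  have hb0 : (0 : ℝ) < b := by positivity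
  have hden : (r.den : ℝ) ≠ 0 := by exact_mod_cast r.den_ne_zero
  have h1 : (r.den : ℝ) * Real.logb b a = (r.num.toNat : ℕ) := by
    have e : ((r.num.toNat : ℕ) : ℤ) = r.num := Int.toNat_of_nonneg (Rat.num_nonneg.2 hr0.le)
    have e' : ((r.num.toNat : ℕ) : ℝ) = (r.num : ℝ) := by exact_mod_cast e
    rw [e', ← hr]
    have : (r : ℝ) = r.num / r.den := Rat.cast_def r
    rw [this]
    field_simp
  have h2 : (a : ℝ) ^ r.den = (b : ℝ) ^ r.num.toNat := by
    have e : (b : ℝ) ^ Real.logb b a = a := Real.rpow_logb hb0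
      (by exact_mod_cast (by omega : b ≠ 1)) (by positivity)
    rw [← Real.rpow_natCast (b : ℝ), ← h1, mul_comm, Real.rpow_mul hb0.le, e, Real.rpow_natCast]
  exact r.den_ne_zero (hindep _ _ (by exact_mod_cast h2)).1

variable {a b : ℕ} {u : ℝ}

theorem rot_eq_fract (ha : 2 ≤ a) (hb : 2 ≤ b) (hu : u ∈ Ico (0 : ℝ) 1) (j : ℕ) :
    rot a b u j = Int.fract (u - j * Real.logb b a) := by
  have h := rot_mem ha hb hu j
  symm
  rw [Int.fract_eq_iff]
  refine ⟨h.1, h.2, -btime a b u j, ?_⟩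
  rw [rot]
  push_cast
  ring

theorem rot_add_eq_fract (ha : 2 ≤ a) (hb : 2 ≤ b) (hu : u ∈ Ico (0 : ℝ) 1) (j l : ℕ) :
    rot a b u (j + l) = Int.fract ((u - j * Real.logb b a) + l * -Real.logb b a) := by
  rw [rot_eq_fract ha hb hu]
  congr 1
  push_cast
  ring

theorem exists_rot_shift_card_le (ha : 2 ≤ a) (hb : 2 ≤ b) (hu : u ∈ Ico (0 : ℝ) 1) {K : ℕ}
    (hK : 0 < K) (l : ℕ) (v : ℤ) :
    ∃ T : Finset ℤ, (∀ j, ⌊(K : ℝ) * rot a b u j⌋ = v → ⌊(K : ℝ) * rot a b u (j + l)⌋ ∈ T) ∧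
      T.card ≤ 2 := by
  refine ⟨{(v + ⌊(K : ℝ) * Int.fract (l * -Real.logb b a)⌋) % K,
    (v + ⌊(K : ℝ) * Int.fract (l * -Real.logb b a)⌋ + 1) % K}, fun j hj => ?_,
    Finset.card_le_two⟩
  have h := floor_mul_fract_add hK (u - j * Real.logb b a) (l * -Real.logb b a)
  rw [← rot_add_eq_fract ha hb hu, ← rot_eq_fract ha hb hu, hj] at h
  simpa using h

open Classical in
/-- Irrational rotations visit intervals of length `1 / K` with frequency at most `4 / K`. -/
theorem exists_card_visits_le (ha : 2 ≤ a) (hb : 2 ≤ b) (hα : Irrational (Real.logb b a)) {K : ℕ}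
    (hK : 0 < K) :
    ∃ n₀ : ℕ, ∀ n, n₀ ≤ n → ∀ u ∈ Ico (0 : ℝ) 1, ∀ v : ℤ,
      K * ((Finset.range n).filter fun j => ⌊(K : ℝ) * rot a b u j⌋ = v).card ≤ 4 * n := by
  have hex : ∀ i, ∃ t : ℕ, i < K → ⌊(K : ℝ) * Int.fract (t * -Real.logb b a)⌋ = i := by
    intro i
    by_cases hi : i < K
    · obtain ⟨t, ht⟩ := exists_nat_mul_fract_floor_eq hα.neg hi
      exact ⟨t, fun _ => ht⟩
    · exact ⟨0, fun h => absurd h hi⟩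
  choose t ht using hex
  set T := ∑ i ∈ Finset.range K, t i with hT
  have htT : ∀ i < K, t i ≤ T := fun i hi =>
    Finset.single_le_sum (f := t) (fun _ _ => Nat.zero_le _) (Finset.mem_range.2 hi)
  refine ⟨T, fun n hn u hu v => ?_⟩
  set A := (Finset.range n).filter fun j => ⌊(K : ℝ) * rot a b u j⌋ = v with hA
  set r : ℕ → ℤ := fun j => ⌊(K : ℝ) * rot a b u j⌋ with hr
  set B : Finset (ℕ × ℕ) := (Finset.range (n + T)).biUnion fun j =>
    {(j, ((r j - v) % K).toNat), (j, ((r j - v - 1) % K).toNat)} with hB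
  have h1 : (A ×ˢ Finset.range K).card ≤ B.card := by
    refine Finset.card_le_card_of_injOn (fun z => (z.1 + t z.2, z.2)) ?_ ?_
    · rintro ⟨j, i⟩ hz
      simp only [Finset.mem_coe, Finset.mem_product, Finset.mem_range, hA,
        Finset.mem_filter] at hz
      obtain ⟨⟨hj, hv⟩, hi⟩ := hz
      have hti := htT i hi
      refine Finset.mem_coe.2 (Finset.mem_biUnion.2
        ⟨j + t i, Finset.mem_range.2 (by omega), ?_⟩)
      have h := floor_mul_fract_add hK (u - j * Real.logb b a) (t i * -Real.logb b a)
      rw [← rot_add_eq_fract ha hb hu, ← rot_eq_fract ha hb hu, hv, ht i hi] at h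
      have hmod : (i : ℤ) % K = i := Int.emod_eq_of_lt (by positivity) (by exact_mod_cast hi)
      have hr' : r (j + t i) = (v + i) % K ∨ r (j + t i) = (v + i + 1) % K := h
      simp only [Finset.mem_insert, Finset.mem_singleton, Prod.mk.injEq, true_and]
      rcases hr' with e | e
      · left
        rw [e, Int.emod_sub_emod, add_sub_cancel_left, hmod, Int.toNat_natCast]
      · right
        have : (v + i + 1) % (K : ℤ) - v - 1 = (v + i + 1) % (K : ℤ) - (v + 1) := by ring
        rw [e, this, Int.emod_sub_emod, show v + i + 1 - (v + 1) = (i : ℤ) by ring, hmod,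
          Int.toNat_natCast]
    · rintro ⟨j, i⟩ _ ⟨j', i'⟩ _ h
      simp only [Prod.mk.injEq] at h
      obtain ⟨h, rfl⟩ := h
      rw [Nat.add_right_cancel h]
  have h2 : B.card ≤ (n + T) * 2 := by
    refine (Finset.card_biUnion_le_card_mul _ _ 2 fun j _ => Finset.card_le_two).trans ?_
    rw [Finset.card_range]
  rw [Finset.card_product, Finset.card_range] at h1
  rw [mul_comm]
  omega

end Equidistribution

section Scenery

variable {a b : ℕ} {u c s : ℝ} {S : Set (ℝ × ℝ)}

/-- A finite set containing all words of generation `m`. -/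
noncomputable def wordBox (a b m : ℕ) : Finset (ℤ × ℤ × ℕ) :=
  Finset.Ico (0 : ℤ) (a ^ m) ×ˢ Finset.Ico (0 : ℤ) (b ^ m) ×ˢ Finset.range (m + 1)

theorem card_wordBox_le (a b m : ℕ) : ((wordBox a b m).card : ℝ) ≤ (2 * a * b : ℝ) ^ m := by
  have h : (wordBox a b m).card = a ^ m * (b ^ m * (m + 1)) := by
    have e : ∀ c : ℕ, ((c : ℤ) ^ m).toNat = c ^ m := fun c => by
      rw [← Nat.cast_pow, Int.toNat_natCast]
    simp [wordBox, e]
  have h2 : ((m + 1 : ℕ) : ℝ) ≤ 2 ^ m := by exact_mod_cast Nat.lt_two_pow_self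
  rw [h]
  calc ((a ^ m * (b ^ m * (m + 1)) : ℕ) : ℝ) = (a : ℝ) ^ m * ((b : ℝ) ^ m * ((m + 1 : ℕ) : ℝ)) := by
        push_cast; ring
    _ ≤ (a : ℝ) ^ m * ((b : ℝ) ^ m * 2 ^ m) := by gcongr
    _ = _ := by rw [mul_pow, mul_pow]; ring

theorem word_mem_wordBox (ha : 2 ≤ a) (hab : a < b) (hu : u ∈ Ico (0 : ℝ) 1) (m : ℕ) {p : ℝ × ℝ}
    (hp : p ∈ Ico (0 : ℝ) 1 ×ˢ Ico (0 : ℝ) 1) : word a b u m p ∈ wordBox a b m := by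
  have hle := btime_le ha hab hu m
  have h1 := floor_pow_mul_mem (c := a) (m := m) hp.1 (by omega)
  have h2 := floor_pow_mul_mem (c := b) (m := btime a b u m) hp.2 (by omega)
  have h3 : (b : ℤ) ^ btime a b u m ≤ b ^ m := pow_le_pow_right₀ (by omega) hle
  rw [Finset.mem_Ico] at h2
  refine Finset.mem_product.2 ⟨h1, Finset.mem_product.2 ⟨?_, Finset.mem_range.2 ?_⟩⟩
  · exact Finset.mem_Ico.2 ⟨h2.1, h2.2.trans_le h3⟩
  · simp only [word]; omega

/-- The word of generation `m` of the scenery at a random time of a random point. -/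
noncomputable def sceneryWord (a b : ℕ) (u : ℝ) {n : ℕ} {F : Finset (ℝ × ℝ)} (m : ℕ)
    (ω : Fin n × F) : ℤ × ℤ × ℕ :=
  word a b (rot a b u ω.1) m (pt a b u ω.1 ω.2)

/-- The direction of the scenery at a random time, at scale `a ^ (-m)`. -/
noncomputable def sceneryDir (a b : ℕ) (u : ℝ) {n : ℕ} {F : Finset (ℝ × ℝ)} (m : ℕ)
    (ω : Fin n × F) : ℤ :=
  ⌊((a ^ m : ℕ) : ℝ) * rot a b u ω.1⌋

/-- The past of a random point at a random time. -/
noncomputable def sceneryPast (a b : ℕ) (u : ℝ) {n : ℕ} {F : Finset (ℝ × ℝ)}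
    (ω : Fin n × F) : ℕ × ℤ × ℤ × ℕ :=
  ((ω.1 : ℕ), word a b u ω.1 ω.2)

variable {n : ℕ} {F : Finset (ℝ × ℝ)}

theorem sceneryWord_mem_wordBox (ha : 2 ≤ a) (hab : a < b) (hS : IsInvariant a b S)
    (hu : u ∈ Ico (0 : ℝ) 1) (hF : ↑F ⊆ S ∩ sline b s u c) (m : ℕ) (ω : Fin n × F) :
    sceneryWord a b u m ω ∈ wordBox a b m :=
  word_mem_wordBox ha hab (rot_mem ha (by omega) hu _) m
    (hS.subset (pt_mem hS (hF ω.2.2).1 _))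

theorem log_card_wordBox_le (ha : 2 ≤ a) (hab : a < b) (m : ℕ) :
    Real.log (wordBox a b m).card ≤ m * Real.log (2 * a * b) := by
  rw [← Real.log_pow]
  rcases (wordBox a b m).card.eq_zero_or_pos with h | h
  · have : (1 : ℝ) ≤ 2 * a * b := by
      exact_mod_cast Nat.one_le_iff_ne_zero.2 (by have : b ≠ 0 := by omega
                                                  positivity)
    rw [h, Nat.cast_zero, Real.log_zero]
    exact Real.log_nonneg (one_le_pow₀ this)
  · exact Real.log_le_log (by exact_mod_cast h) (card_wordBox_le a b m)

theorem ent_sceneryWord_le [NeZero n] [Nonempty F] (ha : 2 ≤ a) (hab : a < b)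
    (hS : IsInvariant a b S) (hu : u ∈ Ico (0 : ℝ) 1) (hF : ↑F ⊆ S ∩ sline b s u c) (m : ℕ) :
    ent (unif (Fin n × F)) (sceneryWord a b u m) ≤ m * Real.log (2 * a * b) :=
  (ent_le_log_card unif_nonneg sum_unif
    fun ω _ => sceneryWord_mem_wordBox ha hab hS hu hF m ω).trans (log_card_wordBox_le ha hab m)

theorem sceneryWord_mul_eq (ha : 2 ≤ a) (hb : 2 ≤ b) [NeZero n]
    (hu : u ∈ Ico (0 : ℝ) 1) (m : ℕ) {ω ω' : Fin n × F} {N : ℕ} (h : ω.1 + N * m < n)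
    (h' : ω'.1 + N * m < n)
    (e : ∀ t < N, sceneryWord a b u m (timeShift n F (t * m) ω)
      = sceneryWord a b u m (timeShift n F (t * m) ω')) :
    sceneryWord a b u (N * m) ω = sceneryWord a b u (N * m) ω' := by
  induction N with
  | zero =>
    have h0 : ∀ ω : Fin n × F, sceneryWord a b u (0 * m) ω = (0, 0, 0) := by
      intro ω
      have hr := (rot_mem ha hb hu ω.1).1
      have hz : btime a b (rot a b u ω.1) 0 = 0 := by
        rw [btime, Nat.ceil_eq_zero]
        simpa using hr
      have i1 : ⌊(pt a b u ω.1 ω.2).1⌋ = 0 := by simp [pt]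
      have i2 : ⌊(pt a b u ω.1 ω.2).2⌋ = 0 := by simp [pt]
      rw [sceneryWord, zero_mul, word, hz, pow_zero, pow_zero, one_mul, one_mul, i1, i2]
    rw [h0, h0]
  | succ N ih =>
    rw [Nat.succ_mul] at h h'
    have h1 := ih (by omega) (by omega) fun t ht => e t (by omega)
    have h2 := e N N.lt_succ_self
    have hs : ∀ ω : Fin n × F, ω.1 + N * m < n →
        sceneryWord a b u m (timeShift n F (N * m) ω)
        = word a b (rot a b (rot a b u ω.1) (N * m)) m
          (pt a b (rot a b u ω.1) (N * m) (pt a b u ω.1 ω.2)) := by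
      intro ω hω
      obtain ⟨i1, i2⟩ := timeShift_apply (N * m) ω hω
      rw [sceneryWord, i1, i2, rot_add ha hb hu, pt_pt ha hb hu]
    rw [hs _ (by omega), hs _ (by omega)] at h2
    simp only [sceneryWord] at h1
    simp only [sceneryWord, Nat.succ_mul]
    rw [word_add ha hb (rot_mem ha hb hu _), word_add ha hb (rot_mem ha hb hu _), h1, h2]

theorem ent_sceneryWord_mul_le [NeZero n] [Nonempty F] (ha : 2 ≤ a) (hab : a < b)
    (hS : IsInvariant a b S) (hu : u ∈ Ico (0 : ℝ) 1) (hF : ↑F ⊆ S ∩ sline b s u c) (N m : ℕ) :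
    ent (unif (Fin n × F)) (sceneryWord a b u (N * m)) ≤
      Real.log 2 + ((N * m : ℕ) : ℝ) / n * ((N * m : ℕ) * Real.log (2 * a * b)) + m * Real.log a
      + N * (Real.log 2 + Real.log 3 + ((N * m : ℕ) : ℝ) / n * (m * Real.log a)
        + (ent (unif (Fin n × F)) (fun ω => (sceneryWord a b u m ω, sceneryDir a b u m ω))
          - ent (unif (Fin n × F)) (sceneryDir a b u m))) := by
  have hb : 2 ≤ b := by omega
  have h := ent_stationary_le (unif_nonneg (F := Fin n × F)) sum_unif N
    (fun t => timeShift n F (t * m)) (fun _ _ => rfl) (sceneryWord a b u m)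
    (sceneryDir a b u m) (sceneryWord a b u (N * m)) (fun ω => n ≤ ω.1 + N * m)
    (K := (a : ℝ) ^ m) (L := (2 * a * b : ℝ) ^ (N * m)) (η := ((N * m : ℕ) : ℝ) / n)
    (by convert sum_unif_late_le (n := n) (F := F) (N * m))
    (one_le_pow₀ (by exact_mod_cast (by omega : 1 ≤ a)))
    (one_le_pow₀ (by exact_mod_cast Nat.one_le_iff_ne_zero.2 (by positivity)))
    ⟨Finset.Ico 0 (a ^ m), fun ω => ?_, ?_⟩
    ⟨wordBox a b (N * m), sceneryWord_mem_wordBox ha hab hS hu hF _, card_wordBox_le a b _⟩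
    (fun ω ω' h1 h2 e => sceneryWord_mul_eq ha hb hu m (by omega) (by omega) e)
    (fun t ht ω => ?_)
  · rw [Real.log_pow, Real.log_pow] at h
    exact h
  · have := floor_pow_mul_mem (c := a) (m := m) (rot_mem ha hb hu ω.1) (by omega)
    simpa [sceneryDir] using this
  · rw [Int.card_Ico, sub_zero, ← Nat.cast_pow, Int.toNat_natCast, Nat.cast_pow]
  · obtain ⟨T, hT, hc⟩ := exists_rot_shift_card_le ha hb hu (K := a ^ m) (by positivity) (t * m)
      (sceneryDir a b u m ω)
    refine ⟨T, fun ω' hω' e => ?_, ?_⟩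
    · have hlt : ω'.1 + t * m < n := by
        have : t * m ≤ N * m := Nat.mul_le_mul_right _ ht.le
        omega
      rw [sceneryDir, (timeShift_apply (t * m) ω' hlt).1]
      exact hT _ e
    · have : (T.card : ℝ) ≤ 2 := by exact_mod_cast hc
      linarith

theorem exists_le_ent_sceneryDir (ha : 2 ≤ a) (hb : 2 ≤ b) (hα : Irrational (Real.logb b a))
    (m : ℕ) :
    ∃ n₀ : ℕ, ∀ (n : ℕ) [NeZero n], n₀ ≤ n → ∀ u ∈ Ico (0 : ℝ) 1, ∀ (F : Finset (ℝ × ℝ))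
      [Nonempty F], m * Real.log a - Real.log 4
        ≤ ent (unif (Fin n × F)) (sceneryDir a b u m) := by
  obtain ⟨n₀, hn₀⟩ := exists_card_visits_le ha hb hα (K := a ^ m) (by positivity)
  refine ⟨n₀, fun n _ hn u hu F _ => ?_⟩
  have ha0 : (0 : ℝ) < a := by positivity
  have h := le_ent_of_atomMass_le (unif_nonneg (F := Fin n × F)) sum_unif
    (X := sceneryDir a b u m) (q := 4 / (a : ℝ) ^ m) fun ω _ => ?_
  · rwa [Real.log_div (by norm_num) (by positivity), Real.log_pow, neg_sub] at h
  have hv := hn₀ n hn u hu (sceneryDir a b u m ω)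
  have hn0 : (0 : ℝ) < n := by exact_mod_cast Nat.pos_of_ne_zero (NeZero.ne n)
  have hF0 : (Fintype.card F : ℝ) ≠ 0 := by exact_mod_cast Fintype.card_ne_zero
  have hmass : atomMass (unif (Fin n × F)) (sceneryDir a b u m) ω
      = (((Finset.range n).filter fun j =>
          ⌊((a ^ m : ℕ) : ℝ) * rot a b u j⌋ = sceneryDir a b u m ω).card : ℝ) / n := by
    rw [Finset.card_filter, Finset.sum_range, Nat.cast_sum, Finset.sum_div, atomMass,
      Fintype.sum_prod_type]
    refine Finset.sum_congr rfl fun j _ => ?_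
    have e : ∀ x : F, sceneryDir a b u m (j, x) = ⌊((a ^ m : ℕ) : ℝ) * rot a b u j⌋ :=
      fun _ => rfl
    simp only [e]
    by_cases hj : ⌊((a ^ m : ℕ) : ℝ) * rot a b u j⌋ = sceneryDir a b u m ω
    · simp only [hj, if_true]
      simp only [unif, Finset.sum_const, Finset.card_univ, Fintype.card_prod, Fintype.card_fin,
        nsmul_eq_mul]
      push_cast
      field_simp
    · simp only [if_neg hj, Finset.sum_const_zero, Nat.cast_zero, zero_div]
  rw [hmass, div_le_div_iff₀ hn0 (by positivity)]
  have : (a : ℝ) ^ m * (((Finset.range n).filter fun j =>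
          ⌊((a ^ m : ℕ) : ℝ) * rot a b u j⌋ = sceneryDir a b u m ω).card : ℝ) ≤ 4 * n := by
    exact_mod_cast hv
  linarith

theorem le_ent_sceneryWord_past [NeZero n] [Nonempty F] (ha : 2 ≤ a) (hab : a < b)
    (hS : IsInvariant a b S) (hu : u ∈ Ico (0 : ℝ) 1) (hF : ↑F ⊆ S ∩ sline b s u c)
    (hinj : InjOn (fun p : ℝ × ℝ => ⌊(a : ℝ) ^ n * p.1⌋) F) (m : ℕ) :
    m * (Real.log F.card - m * Real.log (2 * a * b)) / n
      ≤ ent (unif (Fin n × F)) (fun ω => (sceneryWord a b u m ω, sceneryPast a b u ω))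
        - ent (unif (Fin n × F)) (sceneryPast a b u) := by
  have hb : 2 ≤ b := by omega
  have hΛ : 0 ≤ Real.log (2 * a * b) := Real.log_nonneg (by
    exact_mod_cast Nat.one_le_iff_ne_zero.2 (by positivity))
  have h := le_ent_increment (n := n) (m := m) (F := F) (fun j x => word a b u j x)
    (B := m * Real.log (2 * a * b)) ?_ ?_
  · rw [Fintype.card_coe] at h
    refine h.trans_eq (congrArg₂ _ (ent_congr unif_nonneg fun ω ω' _ _ => ?_) rfl)
    simp only [sceneryWord, sceneryPast, Prod.mk.injEq]
    constructor
    · rintro ⟨h1, h2, h3⟩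
      refine ⟨h2, ?_⟩
      rw [word_add ha hb hu, word_add ha hb hu, h1, h3]
    · rintro ⟨h2, h3⟩
      rw [h2] at h3
      obtain ⟨h4, h5⟩ := word_eq_of_word_add_eq ha hb hu h3
      rw [h2]
      exact ⟨h5, rfl, h4⟩
  · intro i hi x y hxy
    obtain ⟨l, rfl⟩ := Nat.exists_eq_add_of_le hi
    exact Subtype.ext (hinj x.2 y.2 (congrArg Prod.fst (word_eq_of_word_add_eq ha hb hu hxy).1))
  · intro i hi
    refine (ent_le_log_card unif_nonneg sum_unif fun x _ =>
      word_mem_wordBox ha hab hu i (hS.subset (hF x.2).1)).trans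
      ((log_card_wordBox_le ha hab i).trans ?_)
    gcongr

end Scenery

section Recovery

variable {a b : ℕ} {u c s : ℝ} {S : Set (ℝ × ℝ)}

theorem abs_word_sub_le (ha : 2 ≤ a) (hb : 2 ≤ b) (hu : u ∈ Ico (0 : ℝ) 1) {p p' : ℝ × ℝ}
    (hp : p ∈ sline b s u c) (hp' : p' ∈ sline b s u c) (m : ℕ) :
    |(((word a b u m p).2.1 : ℝ) - (word a b u m p').2.1)
      - s * (b : ℝ) ^ rot a b u m * ((word a b u m p).1 - (word a b u m p').1)| ≤ 1 + |s| * b := by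
  have h2 := pow_btime_mul_rpow ha hb u m
  have h3 : (b : ℝ) ^ btime a b u m * p.2 - (b : ℝ) ^ btime a b u m * p'.2
      = s * (b : ℝ) ^ rot a b u m * ((a : ℝ) ^ m * p.1 - (a : ℝ) ^ m * p'.1) := by
    simp only [sline, mem_ofPred_eq] at hp hp'
    rw [hp, hp']
    linear_combination s * (p.1 - p'.1) * h2
  have h5 := rpow_rot_mem hb (rot_mem ha hb hu m)
  set B := (b : ℝ) ^ rot a b u m
  simp only [word]
  set x := (a : ℝ) ^ m * p.1
  set x' := (a : ℝ) ^ m * p'.1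
  set y := (b : ℝ) ^ btime a b u m * p.2
  set y' := (b : ℝ) ^ btime a b u m * p'.2
  have e : ((⌊y⌋ : ℝ) - ⌊y'⌋) - s * B * (⌊x⌋ - ⌊x'⌋)
      = s * B * (Int.fract x - Int.fract x') - (Int.fract y - Int.fract y') := by
    simp only [Int.fract]
    linear_combination h3
  have hf : ∀ x x' : ℝ, |Int.fract x - Int.fract x'| ≤ 1 := by
    intro x x'
    rw [abs_le]
    constructor <;> linarith [Int.fract_nonneg x, Int.fract_nonneg x', Int.fract_lt_one x,
      Int.fract_lt_one x']
  have hB : (0 : ℝ) ≤ B := by linarith [h5.1]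
  rw [e]
  calc _ ≤ |s * B * (Int.fract x - Int.fract x')| + |Int.fract y - Int.fract y'| := abs_sub _ _
    _ ≤ |s| * b * 1 + 1 := by
        refine add_le_add ?_ (hf y y')
        rw [abs_mul, abs_mul, abs_of_nonneg hB]
        have h6 := h5.2
        have h7 := hf x x'
        gcongr
    _ = _ := by ring

theorem abs_sub_le_rpow_sub {B : ℝ} (hB : 2 ≤ B) {x y : ℝ} (hx : 0 ≤ x) (hy : 0 ≤ y) :
    |x - y| ≤ 2 * |B ^ x - B ^ y| := by
  wlog h : y ≤ x generalizing x y
  · rw [abs_sub_comm, abs_sub_comm (B ^ x)]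
    exact this hy hx (le_of_not_ge h)
  have hB0 : 0 < B := by linarith
  have h1 : B ^ x = B ^ y * B ^ (x - y) := by rw [← Real.rpow_add hB0]; congr 1; ring
  have h2 : 1 ≤ B ^ y := Real.one_le_rpow (by linarith) hy
  have h3 : (x - y) * Real.log B + 1 ≤ B ^ (x - y) := by
    rw [Real.rpow_def_of_pos hB0, mul_comm]
    exact Real.add_one_le_exp _
  have h4 : (1 : ℝ) / 2 ≤ Real.log B := by
    have := Real.log_le_log (by norm_num) hB
    linarith [Real.log_two_gt_d9]
  have h5 : (x - y) / 2 ≤ B ^ (x - y) - 1 := by nlinarith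
  have h6 : 0 ≤ B ^ (x - y) - 1 := le_trans (by linarith) h5
  rw [abs_of_nonneg (sub_nonneg.2 h), abs_of_nonneg (by rw [h1]; nlinarith)]
  rw [h1]
  nlinarith

/-- Two words on a common slice that are far apart determine its direction. -/
theorem abs_direction_sub_le (ha : 2 ≤ a) (hb : 2 ≤ b) (hs : s ≠ 0) {τ₁ τ₂ c₁ c₂ : ℝ}
    (hτ₁ : τ₁ ∈ Ico (0 : ℝ) 1) (hτ₂ : τ₂ ∈ Ico (0 : ℝ) 1) {p₁ p₁' p₂ p₂' : ℝ × ℝ}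
    (h₁ : p₁ ∈ sline b s τ₁ c₁) (h₁' : p₁' ∈ sline b s τ₁ c₁)
    (h₂ : p₂ ∈ sline b s τ₂ c₂) (h₂' : p₂' ∈ sline b s τ₂ c₂) {k l : ℕ}
    (e : word a b τ₁ (k + l) p₁ = word a b τ₂ (k + l) p₂)
    (e' : word a b τ₁ (k + l) p₁' = word a b τ₂ (k + l) p₂')
    (hfar : ¬ |(word a b τ₁ (k + l) p₁).1 / (a : ℤ) ^ l
      - (word a b τ₁ (k + l) p₁').1 / (a : ℤ) ^ l| ≤ 1) :
    |(a : ℝ) ^ (k + l) * τ₁ - (a : ℝ) ^ (k + l) * τ₂| ≤ a ^ k * (4 * (1 + |s| * b) / |s|) := by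
  have i₁ := abs_word_sub_le ha hb hτ₁ h₁ h₁' (k + l)
  have i₂ := abs_word_sub_le ha hb hτ₂ h₂ h₂' (k + l)
  rw [← e, ← e'] at i₂
  have hσ : rot a b τ₁ (k + l) - rot a b τ₂ (k + l) = τ₁ - τ₂ := by
    have : btime a b τ₁ (k + l) = btime a b τ₂ (k + l) := congrArg (fun z => z.2.2) e
    rw [rot, rot, this]
    ring
  have hle := abs_sub_le_rpow_sub (B := b) (by exact_mod_cast hb)
    (rot_mem ha hb hτ₁ (k + l)).1 (rot_mem ha hb hτ₂ (k + l)).1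
  rw [hσ] at hle
  set B₁ := (b : ℝ) ^ rot a b τ₁ (k + l)
  set B₂ := (b : ℝ) ^ rot a b τ₂ (k + l)
  set x := (word a b τ₁ (k + l) p₁).1
  set x' := (word a b τ₁ (k + l) p₁').1
  set E := ((word a b τ₁ (k + l) p₁).2.1 : ℝ) - (word a b τ₁ (k + l) p₁').2.1
  have hapos : (0 : ℤ) < (a : ℤ) ^ l := by positivity
  have hD : (a : ℤ) ^ l ≤ |x - x'| := by
    rw [not_le] at hfar
    have hx := Int.emod_add_mul_ediv x ((a : ℤ) ^ l)
    have hx' := Int.emod_add_mul_ediv x' ((a : ℤ) ^ l)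
    have r1 := Int.emod_nonneg x hapos.ne'
    have r2 := Int.emod_lt_of_pos x hapos
    have r1' := Int.emod_nonneg x' hapos.ne'
    have r2' := Int.emod_lt_of_pos x' hapos
    rcases lt_abs.1 hfar with h | h
    · refine le_trans ?_ (le_abs_self _)
      nlinarith
    · refine le_trans ?_ (neg_le_abs _)
      nlinarith
  have hD' : (a : ℝ) ^ l ≤ |(x : ℝ) - x'| := by exact_mod_cast hD
  have hs' : 0 < |s| := abs_pos.2 hs
  have ha' : (0 : ℝ) < a := by positivity
  have h3 : |s| * |B₁ - B₂| * (a : ℝ) ^ l ≤ 2 * (1 + |s| * b) := by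
    calc |s| * |B₁ - B₂| * (a : ℝ) ^ l ≤ |s| * |B₁ - B₂| * |(x : ℝ) - x'| := by gcongr
      _ = |(E - s * B₂ * (x - x')) - (E - s * B₁ * (x - x'))| := by
          rw [← abs_mul, ← abs_mul]
          congr 1
          ring
      _ ≤ _ := (abs_sub _ _).trans (by linarith)
  rw [← mul_sub, abs_mul, abs_of_pos (by positivity), pow_add, mul_assoc]
  gcongr
  rw [le_div_iff₀ hs']
  calc (a : ℝ) ^ l * |τ₁ - τ₂| * |s| ≤ (a : ℝ) ^ l * (2 * |B₁ - B₂|) * |s| := by gcongr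
    _ = 2 * (|s| * |B₁ - B₂| * (a : ℝ) ^ l) := by ring
    _ ≤ _ := by linarith

theorem abs_floor_sub_floor_le {x y R : ℝ} (h : |x - y| ≤ R) : |⌊x⌋ - ⌊y⌋| ≤ ⌈R⌉₊ + 1 := by
  have h7 := Nat.le_ceil R
  have e1 := Int.floor_le x
  have e2 := Int.lt_floor_add_one x
  have e3 := Int.floor_le y
  have e4 := Int.lt_floor_add_one y
  rw [abs_le] at h ⊢
  have i1 : (⌊x⌋ : ℝ) - ⌊y⌋ < ⌈R⌉₊ + 1 := by linarith
  have i2 : (⌊y⌋ : ℝ) - ⌊x⌋ < ⌈R⌉₊ + 1 := by linarith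
  have j1 : ⌊x⌋ - ⌊y⌋ < (⌈R⌉₊ : ℤ) + 1 := by exact_mod_cast i1
  have j2 : ⌊y⌋ - ⌊x⌋ < (⌈R⌉₊ : ℤ) + 1 := by exact_mod_cast i2
  constructor <;> omega

/-- The number of directions, per unit of scale, compatible with two words far apart. -/
noncomputable def dirMult (b : ℕ) (s : ℝ) : ℝ := 2 * (4 * (1 + |s| * b) / |s|) + 5

theorem one_le_dirMult (b : ℕ) (s : ℝ) : 1 ≤ dirMult b s := by
  have : 0 ≤ 4 * (1 + |s| * b) / |s| := by positivity
  unfold dirMult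
  linarith

variable {n : ℕ} {F : Finset (ℝ × ℝ)}

/-- The bush estimate for the sceneries of a slice. -/
theorem exists_scenery_bush [NeZero n] [Nonempty F] (ha : 2 ≤ a) (hb : 2 ≤ b) (hs : s ≠ 0)
    (hS : IsInvariant a b S) (hu : u ∈ Ico (0 : ℝ) 1) (hF : ↑F ⊆ S ∩ sline b s u c) (k l : ℕ) :
    ∃ t : ℝ, 0 ≤ t ∧ t ≤ 1 ∧
      ent (unif (Fin n × F)) (fun ω => (sceneryWord a b u (k + l) ω, sceneryPast a b u ω))
          - ent (unif (Fin n × F)) (sceneryPast a b u)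
        ≤ Real.log 2 + (t * Real.log (3 * mult b s ^ 2 * maxCount a b s S l)
          + (1 - t) * Real.log (mult b s * maxCount a b s S (k + l))) ∧
      ent (unif (Fin n × F)) (fun ω => (sceneryWord a b u (k + l) ω, sceneryDir a b u (k + l) ω))
          + (ent (unif (Fin n × F)) (fun ω => (sceneryWord a b u (k + l) ω, sceneryPast a b u ω))
          - ent (unif (Fin n × F)) (sceneryPast a b u))
        ≤ 2 * ent (unif (Fin n × F)) (sceneryWord a b u (k + l))
          + (t * Real.log ((a : ℝ) ^ (k + l)) + (1 - t) * Real.log (dirMult b s * a ^ k)) := by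
  refine ent_bush unif_nonneg sum_unif (sceneryPast a b u) (sceneryWord a b u (k + l))
    (sceneryDir a b u (k + l))
    (fun w w' => |w.1 / (a : ℤ) ^ l - w'.1 / (a : ℤ) ^ l| ≤ 1) ?_ ?_ ?_ ?_
  · intro ω _
    obtain ⟨T, hT, hc⟩ := exists_scenery_card_le (s := s) ha hb hS hu c ω.1 (k + l)
      (word a b u ω.1 ω.2)
    refine ⟨T, fun ω' _ e => ?_, by exact_mod_cast hc⟩
    simp only [sceneryPast, Prod.mk.injEq] at e
    rw [e.1] at hT
    exact hT _ (hF ω'.2.2) (by rw [← e.2, e.1])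
  · intro ω _
    obtain ⟨T, hT, hc⟩ := exists_near_scenery_card_le (s := s) ha hb hS hu c ω.1 k l
      (word a b u ω.1 ω.2) ((sceneryWord a b u (k + l) ω).1 / (a : ℤ) ^ l)
    refine ⟨T, fun ω' _ e hn => ?_, by exact_mod_cast hc⟩
    simp only [sceneryPast, Prod.mk.injEq] at e
    rw [e.1] at hT
    exact hT _ (hF ω'.2.2) (by rw [← e.2, e.1]) hn
  · intro ω ω' _ _ _ hfar
    by_cases hex : ∃ ν ν' : Fin n × F, sceneryPast a b u ν = sceneryPast a b u ν' ∧
      sceneryWord a b u (k + l) ν = sceneryWord a b u (k + l) ω ∧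
      sceneryWord a b u (k + l) ν' = sceneryWord a b u (k + l) ω'
    · obtain ⟨ν, ν', hP, hw, hw'⟩ := hex
      set R := (a : ℝ) ^ k * (4 * (1 + |s| * b) / |s|) with hR
      have hR0 : 0 ≤ R := by positivity
      refine ⟨Finset.Icc (sceneryDir a b u (k + l) ν - (⌈R⌉₊ + 1))
        (sceneryDir a b u (k + l) ν + (⌈R⌉₊ + 1)), fun ν₂ ν₂' _ _ hP₂ hw₂ hw₂' => ?_, ?_⟩
      · simp only [sceneryPast, Prod.mk.injEq] at hP hP₂
        have key : ∀ ν ν' : Fin n × F, (ν.1 : ℕ) = ν'.1 → word a b u ν.1 ν.2 = word a b u ν'.1 ν'.2 →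
            ∃ c, pt a b u ν.1 ν.2 ∈ sline b s (rot a b u ν.1) c ∧
              pt a b u ν'.1 ν'.2 ∈ sline b s (rot a b u ν.1) c := by
          intro ν ν' e1 e2
          refine ⟨_, pt_mem_sline ha hb (hF ν.2.2).2 _, ?_⟩
          rw [e2, e1]
          exact pt_mem_sline ha hb (hF ν'.2.2).2 _
        obtain ⟨c₁, m₁, m₁'⟩ := key ν₂ ν₂' hP₂.1 hP₂.2
        obtain ⟨c₂, m₂, m₂'⟩ := key ν ν' hP.1 hP.2
        have hle := abs_direction_sub_le ha hb hs (rot_mem ha hb hu _) (rot_mem ha hb hu _)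
          m₁ m₁' m₂ m₂' (k := k) (l := l) (hw₂.trans hw.symm) ?_ ?_
        · have hle := abs_floor_sub_floor_le hle
          rw [abs_le] at hle
          rw [Finset.mem_Icc, sceneryDir, sceneryDir, Nat.cast_pow]
          constructor <;> linarith [hle.1, hle.2]
        · have h := hw₂'.trans hw'.symm
          simp only [sceneryWord] at h
          rw [hP₂.1, hP.1]
          exact h
        · rw [← hw₂, ← hw₂'] at hfar
          simp only [sceneryWord] at hfar
          rw [hP₂.1] at hfar ⊢
          exact hfar
      · rw [Int.card_Icc]
        have e : (sceneryDir a b u (k + l) ν + ((⌈R⌉₊ : ℤ) + 1) + 1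
            - (sceneryDir a b u (k + l) ν - (⌈R⌉₊ + 1))).toNat = 2 * ⌈R⌉₊ + 3 := by omega
        rw [e]
        have h1 := Nat.ceil_lt_add_one hR0
        have h2 : (1 : ℝ) ≤ (a : ℝ) ^ k := one_le_pow₀ (by exact_mod_cast (by omega : 1 ≤ a))
        have h3 : dirMult b s * a ^ k = 2 * R + 5 * a ^ k := by rw [dirMult, hR]; ring
        rw [h3]
        push_cast
        linarith
    · refine ⟨∅, fun ν ν' _ _ e1 e2 e3 => absurd ⟨ν, ν', e1, e2, e3⟩ hex, ?_⟩
      have := one_le_dirMult b s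
      simp only [Finset.card_empty, Nat.cast_zero]
      positivity
  · refine ⟨Finset.Ico 0 (a ^ (k + l)), fun ω _ => ?_, ?_⟩
    · have := floor_pow_mul_mem (c := a) (m := k + l) (rot_mem ha hb hu ω.1) (by omega)
      simpa [sceneryDir] using this
    · rw [Int.card_Ico, sub_zero, ← Nat.cast_pow, Int.toNat_natCast, Nat.cast_pow]

end Recovery

section Growth

variable {a b : ℕ} {s : ℝ} {S : Set (ℝ × ℝ)}

/-- A slice of `S` meeting as many `a`-adic intervals of generation `n` as possible, represented
by a finite set with one point in each of these intervals. -/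
structure IsMaxSlice (a b : ℕ) (s : ℝ) (S : Set (ℝ × ℝ)) (n : ℕ) (u c : ℝ)
    (F : Finset (ℝ × ℝ)) : Prop where
  mem : u ∈ Ico (0 : ℝ) 1
  subset : ↑F ⊆ S ∩ sline b s u c
  injOn : InjOn (fun p : ℝ × ℝ => ⌊(a : ℝ) ^ n * p.1⌋) F
  card_eq : F.card = maxCount a b s S n

theorem exists_forall_div_le (x ε : ℝ) (hε : 0 < ε) : ∃ n₀ : ℕ, ∀ n : ℕ, n₀ ≤ n → x / n ≤ ε := by
  have h := tendsto_const_div_atTop_nhds_zero_nat x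
  obtain ⟨n₀, h⟩ := Filter.eventually_atTop.1 (h.eventually_le_const hε)
  exact ⟨n₀, h⟩

/-- One step of the entropy growth: the entropy rate drops at larger scales unless the words have
dimension at least `log a + g`. -/
theorem exists_ent_sceneryWord_step (ha : 2 ≤ a) (hab : a < b) (hs : s ≠ 0)
    (hS : IsInvariant a b S) (hα : Irrational (Real.logb b a)) {g ε C : ℝ} (hg : 0 < g)
    (hε : 0 < ε)
    (hlow : ∀ n, g * n - Real.log (mult b s) ≤ Real.log (maxCount a b s S n))
    (hup : ∀ n, Real.log (maxCount a b s S n) ≤ (g + ε) * n + C) (hM : ∀ n, 1 ≤ maxCount a b s S n)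
    (q k N : ℕ) (hq : 1 ≤ q) :
    ∃ n₀ : ℕ, ∀ (n : ℕ) [NeZero n], n₀ ≤ n → ∀ (u c : ℝ) (F : Finset (ℝ × ℝ)) [Nonempty F],
      IsMaxSlice a b s S n u c F →
      ent (unif (Fin n × F)) (sceneryWord a b u (N * (q * k))) ≤
        N * (2 * ent (unif (Fin n × F)) (sceneryWord a b u (q * k))
          - (q * k : ℕ) * (Real.log a + g)
          + q * (ε * (q * k : ℕ) + (1 + Real.log 2 + Real.log 3 + 2 * Real.log (mult b s) + C)) / g
            * Real.log a + k * Real.log a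
          + (Real.log (dirMult b s) + Real.log 4 + Real.log 2 + Real.log 3 + 2))
        + (q * k : ℕ) * Real.log a + 2 := by
  have hb : 2 ≤ b := by omega
  have hl2 := Real.log_pos (by norm_num : (1:ℝ) < 2)
  have hla : 0 ≤ Real.log a := Real.log_nonneg (by exact_mod_cast (by omega : 1 ≤ a))
  obtain ⟨l, hl⟩ : ∃ l, q * k = k + l := by
    obtain ⟨q', rfl⟩ := Nat.exists_eq_add_of_le' hq
    exact ⟨q' * k, by ring⟩
  have hmq : ((q * k : ℕ) : ℝ) = q * k := by push_cast; rfl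
  set m := q * k with hm
  have hkl : (m : ℝ) = k + l := by exact_mod_cast hl
  set Λ := Real.log (2 * a * b) with hΛ
  obtain ⟨n₁, h₁⟩ := exists_le_ent_sceneryDir ha hb hα m
  obtain ⟨n₂, h₂⟩ := exists_forall_div_le (m * (Real.log (mult b s) + m * Λ)) 1 one_pos
  obtain ⟨n₃, h₃⟩ := exists_forall_div_le ((N * m : ℕ) * ((N * m : ℕ) * Λ)) 1 one_pos
  obtain ⟨n₄, h₄⟩ := exists_forall_div_le ((N * m : ℕ) * (m * Real.log a)) 1 one_pos
  refine ⟨n₁ + n₂ + n₃ + n₄, fun n _ hn u c F _ hF => ?_⟩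
  have hn0 : (0 : ℝ) < n := by exact_mod_cast Nat.pos_of_ne_zero (NeZero.ne n)
  specialize h₁ n (by omega) u hF.mem F
  specialize h₂ n (by omega)
  specialize h₃ n (by omega)
  specialize h₄ n (by omega)
  have hstat := ent_sceneryWord_mul_le (n := n) ha hab hS hF.mem hF.subset N m
  have hincr := le_ent_sceneryWord_past ha hab hS hF.mem hF.subset hF.injOn m
  obtain ⟨t, ht0, ht1, hb1, hb2⟩ := exists_scenery_bush (n := n) ha hb hs hS hF.mem hF.subset k l
  rw [← hl] at hb1 hb2
  set H := ent (unif (Fin n × F)) (sceneryWord a b u m)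
  set HU := ent (unif (Fin n × F)) (sceneryDir a b u m)
  set HWU := ent (unif (Fin n × F)) (fun ω => (sceneryWord a b u m ω, sceneryDir a b u m ω))
  set I := ent (unif (Fin n × F)) (fun ω => (sceneryWord a b u m ω, sceneryPast a b u ω))
    - ent (unif (Fin n × F)) (sceneryPast a b u)
  rw [← hΛ] at hstat hincr
  have hm0 : (0 : ℝ) ≤ m := by positivity
  have hk0 : (0 : ℝ) ≤ k := by positivity
  have hI : m * g - 1 ≤ I := by
    refine le_trans ?_ hincr
    have h5 := hlow n
    rw [← hF.card_eq] at h5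
    have h6 : m * g - m * (Real.log (mult b s) + m * Λ) / n
        = m * ((g * n - Real.log (mult b s)) - m * Λ) / n := by field_simp; ring
    calc m * g - 1 ≤ m * g - m * (Real.log (mult b s) + m * Λ) / n := by linarith
      _ = _ := h6
      _ ≤ _ := by gcongr
  have hc1 : (1 : ℝ) ≤ mult b s := by exact_mod_cast (by unfold mult; omega : 1 ≤ mult b s)
  have hc0 : 0 ≤ Real.log (mult b s) := Real.log_nonneg hc1
  have hMl : (0 : ℝ) < maxCount a b s S l := by exact_mod_cast hM l
  have hMm : (0 : ℝ) < maxCount a b s S m := by exact_mod_cast hM m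
  have hd := Real.log_nonneg (one_le_dirMult b s)
  have hl3 : 0 ≤ Real.log 3 := Real.log_nonneg (by norm_num)
  rw [Real.log_mul (by positivity) hMl.ne', Real.log_mul (by norm_num) (by positivity),
    Real.log_pow, Real.log_mul (by positivity) hMm.ne'] at hb1
  push_cast at hb1
  have htk : t * k * g ≤ ε * m + (1 + Real.log 2 + Real.log 3 + 2 * Real.log (mult b s) + C) := by
    have i1 : t * (Real.log 3 + 2 * Real.log (mult b s) + Real.log (maxCount a b s S l))
        ≤ t * (Real.log 3 + 2 * Real.log (mult b s) + ((g + ε) * l + C)) := by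
      have := hup l
      gcongr
    have i2 : (1 - t) * (Real.log (mult b s) + Real.log (maxCount a b s S m))
        ≤ (1 - t) * (Real.log 3 + 2 * Real.log (mult b s) + ((g + ε) * m + C)) := by
      have := hup m
      refine mul_le_mul_of_nonneg_left (by linarith) (by linarith)
    have i3 : t * (Real.log 3 + 2 * Real.log (mult b s) + ((g + ε) * l + C))
        + (1 - t) * (Real.log 3 + 2 * Real.log (mult b s) + ((g + ε) * m + C))
        = Real.log 3 + 2 * Real.log (mult b s) + (g + ε) * m + C - (g + ε) * (t * k) := by
      rw [hkl]; ring
    have i4 : 0 ≤ ε * (t * k) := by positivity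
    nlinarith
  have htm : t * m * Real.log a ≤ q * (ε * m
      + (1 + Real.log 2 + Real.log 3 + 2 * Real.log (mult b s) + C)) / g * Real.log a := by
    have : t * m ≤ q * (ε * m
      + (1 + Real.log 2 + Real.log 3 + 2 * Real.log (mult b s) + C)) / g := by
      rw [le_div_iff₀ hg]
      calc t * m * g = q * (t * k * g) := by rw [hmq]; ring
        _ ≤ _ := by gcongr
    gcongr
  rw [Real.log_pow, Real.log_mul (by have := one_le_dirMult b s; positivity) (by positivity),
    Real.log_pow] at hb2
  have hQ0 : (1 - t) * (Real.log (dirMult b s) + k * Real.log a)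
      ≤ Real.log (dirMult b s) + k * Real.log a := by
    have : 0 ≤ t * (Real.log (dirMult b s) + k * Real.log a) := by positivity
    linarith
  have e3 : ((N * m : ℕ) : ℝ) / n * ((N * m : ℕ) * Λ) ≤ 1 := by
    refine le_trans (le_of_eq ?_) h₃
    ring
  have e4 : ((N * m : ℕ) : ℝ) / n * (m * Real.log a) ≤ 1 := by
    refine le_trans (le_of_eq ?_) h₄
    ring
  have hl21 : Real.log 2 ≤ 1 := by linarith [Real.log_two_lt_d9]
  have hfin : Real.log 2 + Real.log 3 + ((N * m : ℕ) : ℝ) / n * (m * Real.log a) + (HWU - HU)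
      ≤ 2 * H - m * (Real.log a + g)
          + q * (ε * m + (1 + Real.log 2 + Real.log 3 + 2 * Real.log (mult b s) + C)) / g
            * Real.log a + k * Real.log a
          + (Real.log (dirMult b s) + Real.log 4 + Real.log 2 + Real.log 3 + 2) := by
    have htm' := (mul_assoc t m (Real.log a)).symm.trans_le htm
    have hmul := mul_add (m : ℝ) (Real.log a) g
    generalize q * (ε * m + (1 + Real.log 2 + Real.log 3 + 2 * Real.log (mult b s) + C)) / g
      * Real.log a = X at htm' ⊢
    linarith only [hb2, h₁, hI, htm', hQ0, e4, hmul]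
  have hN := mul_le_mul_of_nonneg_left hfin (Nat.cast_nonneg (α := ℝ) N)
  linarith only [hN, hstat, e3, hl21]

/-- If `S` has maximal slices of exponential growth rate `g`, then the number of its words grows at
rate at least `log a + g`. -/
theorem log_add_le_of_card_word_le (ha : 2 ≤ a) (hab : a < b) (hs : s ≠ 0)
    (hS : IsInvariant a b S) (hα : Irrational (Real.logb b a)) {g D κ : ℝ} (hg : 0 < g)
    (hlow : ∀ n, g * n - Real.log (mult b s) ≤ Real.log (maxCount a b s S n))
    (hup : ∀ ε > 0, ∃ C, ∀ n, Real.log (maxCount a b s S n) ≤ (g + ε) * n + C)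
    (hM : ∀ n, 1 ≤ maxCount a b s S n)
    (hbox : ∀ m : ℕ, ∃ T : Finset (ℤ × ℤ × ℕ),
      (∀ u ∈ Ico (0 : ℝ) 1, ∀ p ∈ S, word a b u m p ∈ T) ∧ (T.card : ℝ) ≤ κ * Real.exp (D * m)) :
    Real.log a + g ≤ D := by
  by_contra! hD
  have hb : 2 ≤ b := by omega
  set γ := Real.log a + g - D with hγ
  have hγ0 : 0 < γ := by linarith
  have hla : 0 < Real.log a := Real.log_pos (by exact_mod_cast (by omega : 1 < a))
  set Λ := Real.log (2 * a * b) with hΛ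
  obtain ⟨N, hN⟩ := exists_nat_ge (Real.log a / (γ / 8) + 1)
  obtain ⟨q, hq⟩ := exists_nat_ge (Real.log a / (γ / 8) + 1)
  have hdiv : 0 < Real.log a / (γ / 8) := by positivity
  have hN1 : 1 ≤ N := by
    have : (1 : ℝ) ≤ N := by linarith
    exact_mod_cast this
  have hq1' : (1 : ℝ) ≤ q := by linarith
  have hq1 : 1 ≤ q := by exact_mod_cast hq1'
  have hNγ : Real.log a ≤ N * (γ / 8) := by
    rw [← div_le_iff₀ (by positivity)]; linarith
  have hqγ : Real.log a ≤ q * (γ / 8) := by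
    rw [← div_le_iff₀ (by positivity)]; linarith
  set ε := γ / 8 * g / (q * Real.log a) with hε
  have hε0 : 0 < ε := by positivity
  have hεq : q * ε / g * Real.log a = γ / 8 := by rw [hε]; field_simp
  obtain ⟨C, hupC⟩ := hup ε hε0
  set C₃ := 1 + Real.log 2 + Real.log 3 + 2 * Real.log (mult b s) + C
  set C₄ := Real.log (dirMult b s) + Real.log 4 + Real.log 2 + Real.log 3 + 2
  obtain ⟨k₀, hk₀⟩ := exists_nat_ge ((Real.log κ + q * C₃ / g * Real.log a + C₄ + 2) / (γ / 8))
  obtain ⟨r, hr⟩ := exists_nat_gt (Λ / (γ / 2))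
  choose n₀ hn₀ using fun k => exists_ent_sceneryWord_step ha hab hs hS hα hg hε0 hlow hupC hM
    q k N hq1
  set k : ℕ → ℕ := fun i => (k₀ + 1) * N ^ i with hk
  set n := 1 + ∑ i ∈ Finset.range r, n₀ (k i) with hn
  have hnle : ∀ i < r, n₀ (k i) ≤ n := fun i hi => by
    have := Finset.single_le_sum (f := fun i => n₀ (k i)) (fun _ _ => Nat.zero_le _)
      (Finset.mem_range.2 hi)
    omega
  have : NeZero n := ⟨by omega⟩
  obtain ⟨u, hu, c, F, hF, hinj, hcard⟩ := exists_finset_maxCount ha hS s n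
  have hmax : IsMaxSlice a b s S n u c F := ⟨hu, hF, hinj, hcard⟩
  have : Nonempty F := by
    have : 0 < F.card := hcard ▸ hM n
    exact (Finset.card_pos.1 this).to_subtype
  set H : ℕ → ℝ := fun m => ent (unif (Fin n × F)) (sceneryWord a b u m) with hH
  have hstep : ∀ i < r, H (q * k (i + 1)) ≤ N * (H (q * k i) - γ / 2 * (q * k i : ℕ)) := by
    intro i hi
    have h := hn₀ (k i) n (hnle i hi) u c F hmax
    have hidx : N * (q * k i) = q * k (i + 1) := by simp only [hk, pow_succ]; ring
    rw [hidx] at h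
    change H (q * k (i + 1)) ≤ N * (2 * H (q * k i) - _ + _ + _ + _) + _ + 2 at h
    obtain ⟨T, hT, hTc⟩ := hbox (q * k i)
    have hHT : H (q * k i) ≤ Real.log κ + D * (q * k i : ℕ) := by
      have h1 : H (q * k i) ≤ Real.log T.card := ent_le_log_card unif_nonneg sum_unif fun ω _ =>
        hT _ (rot_mem ha hb hu _) _ (pt_mem hS (hF ω.2.2).1 _)
      obtain ⟨x⟩ := ‹Nonempty F›
      have hTpos : (0 : ℝ) < T.card := by
        exact_mod_cast Finset.card_pos.2 ⟨_, hT u hu x (hF x.2).1⟩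
      have hκ : 0 < κ := by
        have := hTpos.trans_le hTc
        exact pos_of_mul_pos_left this (Real.exp_pos _).le
      refine h1.trans ((Real.log_le_log hTpos hTc).trans_eq ?_)
      rw [Real.log_mul hκ.ne' (Real.exp_pos _).ne', Real.log_exp]
    have hki : (k₀ : ℝ) ≤ (q * k i : ℕ) := by
      have : k₀ + 1 ≤ q * k i := by
        calc k₀ + 1 = 1 * ((k₀ + 1) * 1) := by ring
          _ ≤ q * ((k₀ + 1) * N ^ i) := by gcongr; exact Nat.one_le_pow _ _ hN1
      exact_mod_cast (by omega : k₀ ≤ q * k i)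
    have hqk : ((q * k i : ℕ) : ℝ) = q * k i := by push_cast; rfl
    set m : ℝ := ((q * k i : ℕ) : ℝ)
    have hm0 : 0 ≤ m := by positivity
    have hconst : Real.log κ + q * C₃ / g * Real.log a + C₄ + 2 ≤ m * (γ / 8) := by
      rw [← div_le_iff₀ (by positivity)]; linarith
    have hsplit : q * (ε * m + C₃) / g * Real.log a = γ / 8 * m + q * C₃ / g * Real.log a := by
      rw [← hεq]; ring
    have hklog : (k i : ℝ) * Real.log a ≤ m * (γ / 8) := by
      rw [hqk]
      calc (k i : ℝ) * Real.log a ≤ k i * (q * (γ / 8)) := by gcongr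
        _ = _ := by ring
    have hmlog : m * Real.log a ≤ N * (m * (γ / 8)) := by
      calc m * Real.log a ≤ m * (N * (γ / 8)) := by gcongr
        _ = _ := by ring
    have hN1' : (1 : ℝ) ≤ N := by exact_mod_cast hN1
    rw [hsplit] at h
    have hin : 2 * H (q * k i) - m * (Real.log a + g) + (γ / 8 * m + q * C₃ / g * Real.log a)
        + k i * Real.log a + C₄ + m * (γ / 8) + 2 ≤ H (q * k i) - γ / 2 * m := by
      have : m * (Real.log a + g) = m * γ + D * m := by rw [hγ]; ring
      linarith
    have := mul_le_mul_of_nonneg_left hin (Nat.cast_nonneg (α := ℝ) N)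
    nlinarith
  have hchain : ∀ i ≤ r, H (q * k i) ≤ (q * k i : ℕ) * (Λ - i * (γ / 2)) := by
    intro i
    induction i with
    | zero =>
      intro _
      simpa using ent_sceneryWord_le (n := n) ha hab hS hu hF (q * k 0)
    | succ i ih =>
      intro hi
      have h1 := ih (by omega)
      refine (hstep i (by omega)).trans ?_
      have hidx : ((q * k (i + 1) : ℕ) : ℝ) = N * (q * k i : ℕ) := by
        simp only [hk, pow_succ]; push_cast; ring
      rw [hidx, mul_assoc]
      refine mul_le_mul_of_nonneg_left ?_ (Nat.cast_nonneg N)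
      push_cast at h1 ⊢
      linarith
  have hend := hchain r le_rfl
  have h0 : 0 ≤ H (q * k r) := ent_nonneg unif_nonneg sum_unif _
  have hpos : (0 : ℝ) < (q * k r : ℕ) := by
    have : 0 < q * k r := by simp only [hk]; positivity
    exact_mod_cast this
  rw [div_lt_iff₀ (by positivity)] at hr
  nlinarith

end Growth

section UpperBound

variable {a b : ℕ} {s : ℝ} {S : Set (ℝ × ℝ)}

/-- The exponential growth rate of the maximal slices. -/
theorem exists_growth_rate (ha : 2 ≤ a) (hb : 2 ≤ b) (hS : IsInvariant a b S) (hne : S.Nonempty)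
    (s : ℝ) : ∃ g : ℝ, 0 ≤ g ∧
      (∀ n : ℕ, g * n - Real.log (mult b s) ≤ Real.log (maxCount a b s S n)) ∧
      ∀ ε > 0, ∃ C, ∀ n : ℕ, Real.log (maxCount a b s S n) ≤ (g + ε) * n + C := by
  have hM : ∀ n, (1 : ℝ) ≤ maxCount a b s S n := fun n => by
    exact_mod_cast one_le_maxCount ha hS hne s n
  have hc : (1 : ℝ) ≤ mult b s := by exact_mod_cast (by unfold mult; omega : 1 ≤ mult b s)
  have hlM := fun n => Real.log_nonneg (hM n)
  have hlc := Real.log_nonneg hc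
  set v : ℕ → ℝ := fun n => Real.log (maxCount a b s S n) + Real.log (mult b s) with hv
  have hv0 : ∀ n, 0 ≤ v n := fun n => add_nonneg (hlM n) hlc
  have hsub : Subadditive v := fun k l => by
    have h1 := hM k
    have h2 := hM l
    have h := Real.log_le_log (by linarith [hM (k + l)])
      (Nat.cast_le (α := ℝ).2 (maxCount_add_le ha hb hS s k l))
    push_cast at h
    rw [Real.log_mul (by positivity) (by positivity), Real.log_mul (by positivity)
      (by positivity)] at h
    simp only [hv]
    linarith
  have hbdd : BddBelow (range fun n : ℕ => v n / n) :=
    ⟨0, by rintro _ ⟨n, rfl⟩; exact div_nonneg (hv0 n) (Nat.cast_nonneg n)⟩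
  refine ⟨hsub.lim, ge_of_tendsto' (hsub.tendsto_lim hbdd)
    fun n => div_nonneg (hv0 n) (Nat.cast_nonneg n), fun n => ?_, fun ε hε => ?_⟩
  · rcases n.eq_zero_or_pos with rfl | hn
    · simp only [Nat.cast_zero, mul_zero]
      linarith [hlM 0]
    · have h := hsub.lim_le_div hbdd hn.ne'
      rw [le_div_iff₀ (by exact_mod_cast hn)] at h
      simp only [hv] at h
      linarith
  · have h := (hsub.tendsto_lim hbdd).eventually_le_const (lt_add_of_pos_right hsub.lim hε)
    obtain ⟨n₀, h⟩ := Filter.eventually_atTop.1 h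
    refine ⟨∑ i ∈ Finset.range (n₀ + 1), v i, fun n => ?_⟩
    have hsum : 0 ≤ ∑ i ∈ Finset.range (n₀ + 1), v i := Finset.sum_nonneg fun i _ => hv0 i
    have hlv : Real.log (maxCount a b s S n) ≤ v n := by simp only [hv]; linarith
    have hg : 0 ≤ hsub.lim := ge_of_tendsto' (hsub.tendsto_lim hbdd)
      fun n => div_nonneg (hv0 n) (Nat.cast_nonneg n)
    rcases le_or_gt n n₀ with hn | hn
    · have := Finset.single_le_sum (f := v) (fun i _ => hv0 i)
        (Finset.mem_range.2 (Nat.lt_succ_of_le hn))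
      have : 0 ≤ (hsub.lim + ε) * n := by positivity
      linarith
    · have h := h n hn.le
      rw [div_le_iff₀ (by exact_mod_cast (by omega : 0 < n))] at h
      linarith

/-- Slices have dimension at most the normalised growth rate. -/
theorem dimH_slice_le (ha : 2 ≤ a) (hS : IsInvariant a b S) (hne : S.Nonempty) {g : ℝ} (hg : 0 ≤ g)
    (hup : ∀ ε > 0, ∃ C, ∀ n : ℕ, Real.log (maxCount a b s S n) ≤ (g + ε) * n + C) (c : ℝ) :
    dimH (S ∩ sline b s 0 c) ≤ ENNReal.ofReal (g / Real.log a) := by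
  have hla : 0 < Real.log a := Real.log_pos (by exact_mod_cast (by omega : 1 < a))
  refine le_of_forall_gt_imp_ge_of_dense fun d' hd' => ?_
  induction d' with
  | top => exact le_top
  | coe d =>
  have hd : g / Real.log a < d := by
    rw [← ENNReal.ofReal_coe_nnreal] at hd'
    exact (ENNReal.ofReal_lt_ofReal_iff_of_nonneg (by positivity)).1 hd'
  rw [div_lt_iff₀ hla] at hd
  obtain ⟨C, hC⟩ := hup (d * Real.log a - g) (by linarith)
  refine dimH_le_of_hausdorffMeasure_ne_top (ne_top_of_le_ne_top
    (b := ENNReal.ofReal (Real.exp C * (1 + |s|) ^ (d : ℝ))) ENNReal.ofReal_ne_top ?_)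
  set X : ℕ → Set ℤ := xset a b s S 0 c
  have hX : ∀ m, (X m).Finite := finite_xset ha hS 0 c
  have : ∀ m, Fintype (X m) := fun m => (hX m).fintype
  set t : ∀ m, X m → Set (ℝ × ℝ) := fun m z =>
    {p | p ∈ S ∩ sline b s 0 c ∧ ⌊(a : ℝ) ^ m * p.1⌋ = z}
  set r : ℕ → ℝ := fun m => (1 + |s|) * ((a : ℝ) ^ m)⁻¹
  have ha1 : (1 : ℝ) < a := by exact_mod_cast (by omega : 1 < a)
  have hr0 : ∀ m, 0 ≤ r m := fun m => by positivity
  have hdiam : ∀ m (z : X m), Metric.ediam (t m z) ≤ ENNReal.ofReal (r m) := by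
    intro m z
    refine Metric.ediam_le fun p hp p' hp' => ?_
    rw [edist_dist]
    refine ENNReal.ofReal_le_ofReal ?_
    have h1 := Int.abs_sub_lt_one_of_floor_eq_floor (hp.2.trans hp'.2.symm)
    have ham : (0 : ℝ) < (a : ℝ) ^ m := by positivity
    rw [← mul_sub, abs_mul, abs_of_pos ham] at h1
    have h2 : |p.1 - p'.1| ≤ ((a : ℝ) ^ m)⁻¹ := by
      rw [inv_eq_one_div, le_div_iff₀' ham]
      exact h1.le
    have e1 : p.2 = s * (b : ℝ) ^ (0 : ℝ) * p.1 + c := hp.1.2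
    have e2 : p'.2 = s * (b : ℝ) ^ (0 : ℝ) * p'.1 + c := hp'.1.2
    have h3 : |p.2 - p'.2| = |s| * |p.1 - p'.1| := by
      rw [e1, e2, ← abs_mul, Real.rpow_zero]
      ring_nf
    rw [Prod.dist_eq, Real.dist_eq, Real.dist_eq, h3]
    have h4 := abs_nonneg s
    have h5 := abs_nonneg (p.1 - p'.1)
    have h6 := mul_le_mul_of_nonneg_left h2 h4
    simp only [r]
    refine max_le ?_ ?_ <;> nlinarith
  have hr : Filter.Tendsto (fun m => ENNReal.ofReal (r m)) Filter.atTop (nhds 0) := by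
    rw [← ENNReal.ofReal_zero]
    refine ENNReal.tendsto_ofReal ?_
    have := (tendsto_pow_atTop_nhds_zero_of_lt_one (r := (a : ℝ)⁻¹) (by positivity)
      (inv_lt_one_of_one_lt₀ ha1)).const_mul (1 + |s|)
    simpa [r] using this
  refine (Measure.hausdorffMeasure_le_liminf_sum d _ _ hr t (Filter.Eventually.of_forall hdiam)
    (Filter.Eventually.of_forall fun m p hp => ?_)).trans ?_
  · exact mem_iUnion.2 ⟨⟨_, p, hp, rfl⟩, hp, rfl⟩
  refine Filter.liminf_le_of_frequently_le' (Filter.Frequently.of_forall fun m => ?_)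
  have hM : (1 : ℝ) ≤ maxCount a b s S m := by exact_mod_cast one_le_maxCount ha hS hne s m
  calc ∑ z : X m, Metric.ediam (t m z) ^ (d : ℝ) ≤ ∑ z : X m, ENNReal.ofReal (r m ^ (d : ℝ)) := by
        refine Finset.sum_le_sum fun z _ => ?_
        rw [← ENNReal.ofReal_rpow_of_nonneg (hr0 m) (by positivity : (0 : ℝ) ≤ d)]
        exact ENNReal.rpow_le_rpow (hdiam m z) d.2
    _ = ENNReal.ofReal ((X m).ncard * r m ^ (d : ℝ)) := by
        rw [Finset.sum_const, Finset.card_univ, ← Nat.card_eq_fintype_card, Nat.card_coe_set_eq,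
          nsmul_eq_mul, ENNReal.ofReal_mul (by positivity), ENNReal.ofReal_natCast]
    _ ≤ _ := by
        refine ENNReal.ofReal_le_ofReal ?_
        have h1 : ((X m).ncard : ℝ) ≤ maxCount a b s S m := by
          exact_mod_cast ncard_xset_le_maxCount ha hS (by simp) c m
        have h2 : (maxCount a b s S m : ℝ) ≤ Real.exp (d * Real.log a * m + C) := by
          rw [← Real.log_le_iff_le_exp (by linarith)]
          linarith [hC m]
        have h3 : r m ^ (d : ℝ) = (1 + |s|) ^ (d : ℝ) * Real.exp (-(d * Real.log a * m)) := by
          simp only [r]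
          rw [Real.mul_rpow (by positivity) (by positivity)]
          congr 1
          rw [Real.rpow_def_of_pos (by positivity), Real.log_inv, Real.log_pow]
          ring_nf
        have hK : 0 ≤ (1 + |s|) ^ (d : ℝ) := by positivity
        calc (X m).ncard * r m ^ (d : ℝ)
            ≤ Real.exp (d * Real.log a * m + C) * r m ^ (d : ℝ) := by
              have : 0 ≤ r m ^ (d : ℝ) := Real.rpow_nonneg (hr0 m) _
              gcongr
              linarith
          _ = _ := by
            rw [h3, mul_left_comm, ← Real.exp_add, mul_comm]
            ring_nf

end UpperBound

section BoxCounting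

theorem exists_pow_inv_rpow_le {a : ℕ} (ha : 2 ≤ a) {d e ε : ℝ} (hd : 0 < d) (he : 0 ≤ e)
    (he1 : e ≤ 1) (hε : 0 < ε) :
    ∃ n : ℕ, e ≤ (a : ℝ)⁻¹ ^ n ∧ ((a : ℝ)⁻¹ ^ n) ^ d ≤ (a : ℝ) ^ d * e ^ d + ε := by
  have ha1 : (1 : ℝ) < a := by exact_mod_cast (by omega : 1 < a)
  have ha0 : (0 : ℝ) < (a : ℝ)⁻¹ := by positivity
  have hlt : (a : ℝ)⁻¹ < 1 := inv_lt_one_of_one_lt₀ ha1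
  rcases he.eq_or_lt with rfl | he0
  · obtain ⟨n, hn⟩ := exists_pow_lt_of_lt_one (Real.rpow_pos_of_pos hε d⁻¹) hlt
    refine ⟨n, by positivity, ?_⟩
    have := Real.rpow_le_rpow (by positivity) hn.le hd.le
    rw [Real.rpow_inv_rpow hε.le hd.ne'] at this
    rw [Real.zero_rpow hd.ne']
    linarith
  · obtain ⟨n, h1, h2⟩ := exists_nat_pow_near_of_lt_one he0 he1 ha0 hlt
    refine ⟨n, h2, ?_⟩
    have h3 : (a : ℝ)⁻¹ ^ n ≤ a * e := by
      rw [pow_succ, ← div_eq_mul_inv, div_lt_iff₀ (by positivity)] at h1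
      linarith
    rw [← Real.mul_rpow (by positivity) he]
    have := Real.rpow_le_rpow (by positivity) h3 hd.le
    linarith

/-- A compact set of zero Hausdorff measure has efficient finite covers by sets of diameter
comparable to powers of `a`. -/
theorem exists_cover_of_hausdorffMeasure_eq_zero {X : Type*} [MetricSpace X] [MeasurableSpace X]
    [BorelSpace X] {K : Set X} (hK : IsCompact K) {d : ℝ} (hd : 0 < d) (h0 : μH[d] K = 0)
    {a : ℕ} (ha : 2 ≤ a) {η : ℝ} (hη : 0 < η) :
    ∃ (I : Finset ℕ) (n : ℕ → ℕ) (U : ℕ → Set X), K ⊆ ⋃ i ∈ I, U i ∧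
      (∀ i, ∀ p ∈ U i, ∀ p' ∈ U i, dist p p' ≤ 3 * (a : ℝ)⁻¹ ^ n i) ∧
      ∑ i ∈ I, ((a : ℝ)⁻¹ ^ n i) ^ d ≤ η := by
  have ha0 : (0 : ℝ) < a := by positivity
  have hη' : 0 < η / 2 / (a : ℝ) ^ d := by positivity
  have hlt : ⨅ (t : ℕ → Set X) (_ : K ⊆ ⋃ n, t n) (_ : ∀ n, Metric.ediam (t n) ≤ 1),
      ∑' n, ⨆ _ : (t n).Nonempty, Metric.ediam (t n) ^ d < ENNReal.ofReal (η / 2 / (a : ℝ) ^ d) := by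
    refine lt_of_le_of_lt ?_ (ENNReal.ofReal_pos.2 hη')
    rw [← h0, Measure.hausdorffMeasure_apply]
    exact le_iSup₂_of_le (1 : ENNReal) one_pos le_rfl
  simp only [iInf_lt_iff] at hlt
  obtain ⟨t, hKt, ht1, hsum⟩ := hlt
  set e : ℕ → ℝ := fun i => (Metric.ediam (t i)).toReal with he
  have hfin : ∀ i, Metric.ediam (t i) ≠ ⊤ := fun i => ne_top_of_le_ne_top ENNReal.one_ne_top (ht1 i)
  have he1 : ∀ i, e i ≤ 1 := fun i => by
    simpa using ENNReal.toReal_mono ENNReal.one_ne_top (ht1 i)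
  choose n hn1 hn2 using fun i => exists_pow_inv_rpow_le ha hd (e := e i) ENNReal.toReal_nonneg
    (he1 i) (ε := η / 2 / 2 / 2 ^ i) (by positivity)
  have hpos : ∀ i, 0 < (a : ℝ)⁻¹ ^ n i := fun i => by positivity
  obtain ⟨I, hI⟩ := hK.elim_finite_subcover (fun i => Metric.thickening ((a : ℝ)⁻¹ ^ n i) (t i))
    (fun i => Metric.isOpen_thickening)
    (hKt.trans (iUnion_mono fun i => Metric.self_subset_thickening (hpos i) _))
  refine ⟨I, n, _, hI, fun i p hp p' hp' => ?_, ?_⟩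
  · obtain ⟨q, hq, hpq⟩ := Metric.mem_thickening_iff.1 hp
    obtain ⟨q', hq', hpq'⟩ := Metric.mem_thickening_iff.1 hp'
    have h1 : dist q q' ≤ e i := by
      rw [dist_edist]
      exact ENNReal.toReal_mono (hfin i) (Metric.edist_le_ediam_of_mem hq hq')
    have h2 := dist_triangle4_right p p' q q'
    linarith [hn1 i]
  · have hs1 : ∑ i ∈ I, e i ^ d ≤ η / 2 / (a : ℝ) ^ d := by
      rw [← ENNReal.ofReal_le_ofReal_iff hη'.le,
        ENNReal.ofReal_sum_of_nonneg fun i _ => Real.rpow_nonneg ENNReal.toReal_nonneg _]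
      refine le_trans ?_ hsum.le
      refine le_trans (Finset.sum_le_sum fun i _ => ?_) (ENNReal.sum_le_tsum I)
      rw [← ENNReal.ofReal_rpow_of_nonneg ENNReal.toReal_nonneg hd.le,
        ENNReal.ofReal_toReal (hfin i)]
      rcases (t i).eq_empty_or_nonempty with h | h
      · simp [h, hd]
      · exact le_iSup (fun _ : (t i).Nonempty => Metric.ediam (t i) ^ d) h
    have hs2 : ∑ i ∈ I, η / 2 / 2 / 2 ^ i ≤ η / 2 :=
      sum_le_hasSum I (fun i _ => by positivity) (hasSum_geometric_two' (η / 2))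
    calc ∑ i ∈ I, ((a : ℝ)⁻¹ ^ n i) ^ d
        ≤ ∑ i ∈ I, ((a : ℝ) ^ d * e i ^ d + η / 2 / 2 / 2 ^ i) :=
          Finset.sum_le_sum fun i _ => hn2 i
      _ = (a : ℝ) ^ d * ∑ i ∈ I, e i ^ d + ∑ i ∈ I, η / 2 / 2 / 2 ^ i := by
          rw [Finset.sum_add_distrib, Finset.mul_sum]
      _ ≤ (a : ℝ) ^ d * (η / 2 / (a : ℝ) ^ d) + η / 2 := by gcongr
      _ = η := by field_simp; ring

variable {a b : ℕ} {S : Set (ℝ × ℝ)}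

/-- The words of generation `m` of points of `S`, for all phases. -/
def wordSet (a b : ℕ) (S : Set (ℝ × ℝ)) (m : ℕ) : Set (ℤ × ℤ × ℕ) :=
  {w | ∃ u ∈ Ico (0 : ℝ) 1, ∃ p ∈ S, word a b u m p = w}

theorem finite_wordSet (ha : 2 ≤ a) (hab : a < b) (hS : IsInvariant a b S) (m : ℕ) :
    (wordSet a b S m).Finite := by
  refine (wordBox a b m).finite_toSet.subset ?_
  rintro _ ⟨u, hu, p, hp, rfl⟩
  exact word_mem_wordBox ha hab hu m (hS.subset hp)

theorem btime_mem_Icc {u : ℝ} (hu : u ∈ Ico (0 : ℝ) 1) (n : ℕ) :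
    btime a b u n ∈ Finset.Icc (⌈n * Real.logb b a⌉₊ - 1) ⌈n * Real.logb b a⌉₊ := by
  rw [Finset.mem_Icc, tsub_le_iff_right]
  constructor
  · refine Nat.ceil_le.2 ?_
    have := Nat.le_ceil (n * Real.logb b a - u)
    push_cast
    unfold btime
    linarith [hu.2]
  · exact Nat.ceil_mono (by linarith [hu.1])

/-- A set of diameter at most `3 * a ^ (-n)` meets a bounded number of words of generation `n`. -/
theorem exists_word_card_le (ha : 2 ≤ a) (hab : a < b) {V : Set (ℝ × ℝ)} {n : ℕ}
    (hV : ∀ p ∈ V, ∀ p' ∈ V, dist p p' ≤ 3 * (a : ℝ)⁻¹ ^ n) :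
    ∃ T : Finset (ℤ × ℤ × ℕ), (∀ u ∈ Ico (0 : ℝ) 1, ∀ p ∈ V, word a b u n p ∈ T) ∧
      T.card ≤ 18 * (6 * b + 3) := by
  rcases V.eq_empty_or_nonempty with rfl | ⟨q, hq⟩
  · exact ⟨∅, by simp, by simp⟩
  classical
  have hb : 2 ≤ b := by omega
  set I := Finset.Icc (⌈n * Real.logb b a⌉₊ - 1) ⌈n * Real.logb b a⌉₊
  refine ⟨I.biUnion fun t => Finset.Icc (⌊(a : ℝ) ^ n * q.1⌋ - 4) (⌊(a : ℝ) ^ n * q.1⌋ + 4) ×ˢ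
    Finset.Icc (⌊(b : ℝ) ^ t * q.2⌋ - (3 * b + 1 : ℕ)) (⌊(b : ℝ) ^ t * q.2⌋ + (3 * b + 1 : ℕ))
      ×ˢ {t}, fun u hu p hp => ?_, ?_⟩
  · refine Finset.mem_biUnion.2 ⟨_, btime_mem_Icc hu n, ?_⟩
    have hd := hV p hp q hq
    rw [Prod.dist_eq, max_le_iff, Real.dist_eq, Real.dist_eq, inv_pow, ← div_eq_mul_inv] at hd
    have han : (0 : ℝ) < (a : ℝ) ^ n := by positivity
    have h1 : |(a : ℝ) ^ n * p.1 - (a : ℝ) ^ n * q.1| ≤ (3 : ℕ) := by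
      rw [← mul_sub, abs_mul, abs_of_pos han]
      exact_mod_cast (le_div_iff₀' han).1 hd.1
    have hbt : (b : ℝ) ^ btime a b u n ≤ (a : ℝ) ^ n * b := by
      have e := pow_btime_mul_rpow ha hb u n
      have r1 := (rpow_rot_mem hb hu).1
      have r2 := (rpow_rot_mem hb (rot_mem ha hb hu n)).2
      have hp0 : (0 : ℝ) ≤ (b : ℝ) ^ btime a b u n := by positivity
      calc (b : ℝ) ^ btime a b u n ≤ (b : ℝ) ^ btime a b u n * (b : ℝ) ^ u :=
            le_mul_of_one_le_right hp0 r1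
        _ = _ := e
        _ ≤ _ := by gcongr
    have h2 : |(b : ℝ) ^ btime a b u n * p.2 - (b : ℝ) ^ btime a b u n * q.2|
        ≤ (3 * b : ℕ) := by
      rw [← mul_sub, abs_mul, abs_of_pos (by positivity)]
      have h3 := (le_div_iff₀' han).1 hd.2
      calc (b : ℝ) ^ btime a b u n * |p.2 - q.2| ≤ (a : ℝ) ^ n * b * |p.2 - q.2| := by gcongr
        _ = b * ((a : ℝ) ^ n * |p.2 - q.2|) := by ring
        _ ≤ b * 3 := by gcongr
        _ = _ := by push_cast; ring
    have h1 := abs_le.1 (abs_floor_sub_floor_le h1)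
    have h2 := abs_le.1 (abs_floor_sub_floor_le h2)
    rw [Nat.ceil_natCast] at h1 h2
    simp only [word, Finset.mem_product, Finset.mem_Icc, Finset.mem_singleton, and_true]
    push_cast at h1 h2 ⊢
    refine ⟨⟨?_, ?_⟩, ?_, ?_⟩ <;> linarith
  · have hI : I.card ≤ 2 := by
      rw [Nat.card_Icc]
      omega
    refine (Finset.card_biUnion_le_card_mul _ _ (9 * (6 * b + 3)) fun t _ => ?_).trans
      ((Nat.mul_le_mul_right _ hI).trans_eq (by ring))
    simp only [Finset.card_product, Int.card_Icc, Finset.card_singleton, mul_one]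
    refine Nat.mul_le_mul (by omega) (by omega)

/-- Words of generation `n + m` of points whose word of generation `n` lies in a given set. -/
theorem exists_word_add_card_le (ha : 2 ≤ a) (hab : a < b) (hS : IsInvariant a b S)
    {V : Set (ℝ × ℝ)} (hVS : V ⊆ S) {n : ℕ} (T : Finset (ℤ × ℤ × ℕ))
    (hT : ∀ u ∈ Ico (0 : ℝ) 1, ∀ p ∈ V, word a b u n p ∈ T) (m : ℕ) :
    ∃ T' : Finset (ℤ × ℤ × ℕ), (∀ u ∈ Ico (0 : ℝ) 1, ∀ p ∈ V, word a b u (n + m) p ∈ T') ∧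
      T'.card ≤ T.card * (wordSet a b S m).ncard := by
  classical
  have hb : 2 ≤ b := by omega
  refine ⟨Finset.image₂ (fun z w : ℤ × ℤ × ℕ => ((a : ℤ) ^ m * z.1 + w.1,
    (b : ℤ) ^ w.2.2 * z.2.1 + w.2.1, z.2.2 + w.2.2)) T (finite_wordSet ha hab hS m).toFinset,
    fun u hu p hp => ?_, ?_⟩
  · rw [word_add ha hb hu]
    exact Finset.mem_image₂_of_mem (hT u hu p hp) ((Set.Finite.mem_toFinset _).2
      ⟨_, rot_mem ha hb hu n, _, pt_mem hS (hVS hp) n, rfl⟩)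
  · rw [Set.ncard_eq_toFinset_card _ (finite_wordSet ha hab hS m)]
    exact Finset.card_image₂_le _ _ _

/-- The number of words of `S` grows at a rate at most the dimension of a compact set containing
`S`. -/
theorem exists_word_card_le_exp (ha : 2 ≤ a) (hab : a < b) (hS : IsInvariant a b S)
    {K : Set (ℝ × ℝ)} (hK : IsCompact K) (hSK : S ⊆ K) {d : ℝ} (hd : 0 < d) (h0 : μH[d] K = 0) :
    ∃ κ : ℝ, ∀ m : ℕ, ∃ T : Finset (ℤ × ℤ × ℕ),
      (∀ u ∈ Ico (0 : ℝ) 1, ∀ p ∈ S, word a b u m p ∈ T) ∧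
        (T.card : ℝ) ≤ κ * Real.exp (d * Real.log a * m) := by
  set k : ℕ := 18 * (6 * b + 3) with hk
  have hk1 : (1 : ℝ) < k := by exact_mod_cast (by omega : 1 < k)
  have ha1 : (1 : ℝ) < a := by exact_mod_cast (by omega : 1 < a)
  have hla : 0 < Real.log a := Real.log_pos ha1
  obtain ⟨I, n, U, hU, hdiam, hsum⟩ :=
    exists_cover_of_hausdorffMeasure_eq_zero hK hd h0 ha (η := (k : ℝ)⁻¹) (by positivity)
  set W : ℕ → ℕ := fun m => (wordSet a b S m).ncard
  have hexp : ∀ n : ℕ, ((a : ℝ)⁻¹ ^ n) ^ d = Real.exp (-(d * Real.log a * n)) := fun n => by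
    rw [Real.rpow_def_of_pos (by positivity), Real.log_pow, Real.log_inv]
    ring_nf
  have hn0 : ∀ i ∈ I, 1 ≤ n i := by
    intro i hi
    by_contra! h
    have h1 := (Finset.single_le_sum (f := fun i => ((a : ℝ)⁻¹ ^ n i) ^ d)
      (fun _ _ => by positivity) hi).trans hsum
    have h2 := inv_lt_one_of_one_lt₀ hk1
    simp only [Nat.lt_one_iff.1 h, pow_zero, Real.one_rpow] at h1
    linarith
  have hrec : ∀ m, (∀ i ∈ I, n i ≤ m) → W m ≤ k * ∑ i ∈ I, W (m - n i) := by
    classical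
    intro m hm
    choose T hT hTc using fun i => exists_word_card_le ha hab (V := S ∩ U i) (n := n i)
      fun p hp p' hp' => hdiam i p hp.2 p' hp'.2
    choose T' hT' hTc' using fun i => exists_word_add_card_le ha hab hS
      (V := S ∩ U i) inter_subset_left (T i) (hT i) (m - n i)
    have hsub : wordSet a b S m ⊆ (I.biUnion T' : Finset _) := by
      rintro _ ⟨u, hu, p, hp, rfl⟩
      obtain ⟨i, hi, hpi⟩ := mem_iUnion₂.1 (hU (hSK hp))
      refine Finset.mem_coe.2 (Finset.mem_biUnion.2 ⟨i, hi, ?_⟩)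
      have := hT' i u hu p ⟨hp, hpi⟩
      rwa [Nat.add_sub_cancel' (hm i hi)] at this
    calc W m ≤ (I.biUnion T').card := by
          rw [← Set.ncard_coe_finset]
          exact Set.ncard_le_ncard hsub (Finset.finite_toSet _)
      _ ≤ ∑ i ∈ I, (T' i).card := Finset.card_biUnion_le
      _ ≤ ∑ i ∈ I, k * W (m - n i) := Finset.sum_le_sum fun i _ =>
          (hTc' i).trans (Nat.mul_le_mul_right _ (hTc i))
      _ = _ := by rw [Finset.mul_sum]
  set M := ∑ i ∈ I, n i
  have hM : ∀ i ∈ I, n i ≤ M := fun i hi => Finset.single_le_sum (fun _ _ => Nat.zero_le _) hi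
  set κ : ℝ := ∑ m ∈ Finset.range M, (W m : ℝ)
  have hκ0 : 0 ≤ κ := Finset.sum_nonneg fun _ _ => Nat.cast_nonneg _
  have hW : ∀ m, (W m : ℝ) ≤ κ * Real.exp (d * Real.log a * m) := by
    intro m
    induction m using Nat.strong_induction_on with
    | _ m ih =>
    rcases lt_or_ge m M with hm | hm
    · have h1 : (W m : ℝ) ≤ κ := Finset.single_le_sum (f := fun m => (W m : ℝ))
        (fun _ _ => Nat.cast_nonneg _) (Finset.mem_range.2 hm)
      have h2 : 1 ≤ Real.exp (d * Real.log a * m) := Real.one_le_exp (by positivity)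
      exact h1.trans (le_mul_of_one_le_right hκ0 h2)
    · calc (W m : ℝ) ≤ k * ∑ i ∈ I, (W (m - n i) : ℝ) := by
            exact_mod_cast hrec m fun i hi => (hM i hi).trans hm
        _ ≤ k * ∑ i ∈ I, κ * Real.exp (d * Real.log a * m) * ((a : ℝ)⁻¹ ^ n i) ^ d := by
            gcongr with i hi
            refine (ih (m - n i) (by have := hn0 i hi; have := hM i hi; omega)).trans_eq ?_
            rw [hexp, mul_assoc κ, ← Real.exp_add, Nat.cast_sub ((hM i hi).trans hm)]
            ring_nf
        _ = κ * Real.exp (d * Real.log a * m) * (k * ∑ i ∈ I, ((a : ℝ)⁻¹ ^ n i) ^ d) := by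
            rw [← Finset.mul_sum]; ring
        _ ≤ κ * Real.exp (d * Real.log a * m) * 1 := by
            gcongr
            calc k * ∑ i ∈ I, ((a : ℝ)⁻¹ ^ n i) ^ d ≤ k * (k : ℝ)⁻¹ := by gcongr
              _ = 1 := mul_inv_cancel₀ (by positivity)
        _ = _ := mul_one _
  refine ⟨κ, fun m => ⟨(finite_wordSet ha hab hS m).toFinset, fun u hu p hp => ?_, ?_⟩⟩
  · exact (Set.Finite.mem_toFinset _).2 ⟨u, hu, p, hp, rfl⟩
  · rw [← Set.ncard_eq_toFinset_card _ (finite_wordSet ha hab hS m)]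
    exact hW m

end BoxCounting

variable {a b : ℕ}

theorem fract_pow_mul_mem {c : ℕ} {A : Set ℝ} (h : ∀ x ∈ A, Int.fract ((c : ℝ) * x) ∈ A) {x : ℝ}
    (hx : x ∈ A) (hx1 : x ∈ Ico (0 : ℝ) 1) (i : ℕ) : Int.fract ((c : ℝ) ^ i * x) ∈ A := by
  induction i with
  | zero => simpa [Int.fract_eq_self.2 hx1] using hx
  | succ i ih =>
    rw [← fract_pow_mul_fract, pow_one]
    exact h _ ih

theorem isInvariant_prod {A B : Set ℝ} (hA : A ⊆ Icc 0 1) (hB : B ⊆ Icc 0 1)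
    (hAinv : ∀ x ∈ A, Int.fract ((a : ℝ) * x) ∈ A)
    (hBinv : ∀ x ∈ B, Int.fract ((b : ℝ) * x) ∈ B) :
    IsInvariant a b ((A \ {1}) ×ˢ (B \ {1})) where
  subset := prod_mono (fun _ h => ⟨(hA h.1).1, (hA h.1).2.lt_of_ne h.2⟩)
    fun _ h => ⟨(hB h.1).1, (hB h.1).2.lt_of_ne h.2⟩
  fract_mem p hp i j := by
    have h1 : p.1 ∈ Ico (0 : ℝ) 1 := ⟨(hA hp.1.1).1, (hA hp.1.1).2.lt_of_ne hp.1.2⟩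
    have h2 : p.2 ∈ Ico (0 : ℝ) 1 := ⟨(hB hp.2.1).1, (hB hp.2.1).2.lt_of_ne hp.2.2⟩
    exact ⟨⟨fract_pow_mul_mem hAinv hp.1.1 h1 i, (Int.fract_lt_one _).ne⟩,
      ⟨fract_pow_mul_mem hBinv hp.2.1 h2 j, (Int.fract_lt_one _).ne⟩⟩

/-- The dimension bound for slices of an invariant set contained in a compact set. -/
theorem dimH_invariant_slice_le (ha : 2 ≤ a) (hab : a < b)
    (hindep : ∀ m n : ℕ, a ^ m = b ^ n → m = 0 ∧ n = 0) {s : ℝ} (hs : s ≠ 0) {S K : Set (ℝ × ℝ)}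
    (hS : IsInvariant a b S) (hK : IsCompact K) (hSK : S ⊆ K) (c : ℝ) :
    dimH (S ∩ sline b s 0 c) ≤ max (dimH K) 1 - 1 := by
  have hb : 2 ≤ b := by omega
  rcases S.eq_empty_or_nonempty with rfl | hne
  · simp
  obtain ⟨g, hg0, hlow, hup⟩ := exists_growth_rate ha hb hS hne s
  refine (dimH_slice_le ha hS hne hg0 hup c).trans ?_
  rcases hg0.eq_or_lt with rfl | hg
  · simp
  refine ENNReal.le_sub_of_add_le_right ENNReal.one_ne_top (le_max_of_le_left ?_)
  have hla : 0 < Real.log a := Real.log_pos (by exact_mod_cast (by omega : 1 < a))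
  refine le_of_forall_gt_imp_ge_of_dense fun d' hd' => ?_
  induction d' with
  | top => exact le_top
  | coe d =>
  have hd : (0 : ℝ) < d := by exact_mod_cast (zero_le.trans_lt hd' : (0 : ENNReal) < d)
  obtain ⟨κ, hκ⟩ := exists_word_card_le_exp ha hab hS hK hSK hd (hausdorffMeasure_of_dimH_lt hd')
  have h := log_add_le_of_card_word_le ha hab hs hS (irrational_logb ha hb hindep) hg hlow hup
    (one_le_maxCount ha hS hne s) hκ
  rw [← ENNReal.ofReal_one, ← ENNReal.ofReal_add (by positivity) zero_le_one,
    ← ENNReal.ofReal_coe_nnreal]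
  refine ENNReal.ofReal_le_ofReal ?_
  rw [div_add_one hla.ne', div_le_iff₀ hla]
  linarith

end ShmerkinWu

/-- **Theorem A (Shmerkin–Wu theorem / Furstenberg's slicing conjecture).**
If `A, B ⊆ [0,1]` are closed, forward invariant under multiplication by `a`, `b`
respectively (with `2 ≤ a < b` multiplicatively independent), and `C = A × B`,
then every line of nonzero slope meets `C` in Hausdorff dimension at most
`max {dimH C, 1} - 1`. -/
theorem shmerkin_wu
    (a b : ℕ) (ha : 2 ≤ a) (hab : a < b)
    (hindep : ∀ m n : ℕ, a ^ m = b ^ n → m = 0 ∧ n = 0)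
    (A B : Set ℝ) (hAcl : IsClosed A) (hBcl : IsClosed B)
    (hA1 : A ⊆ Set.Icc 0 1) (hB1 : B ⊆ Set.Icc 0 1)
    (hAinv : ∀ x ∈ A, Int.fract ((a : ℝ) * x) ∈ A)
    (hBinv : ∀ y ∈ B, Int.fract ((b : ℝ) * y) ∈ B)
    (C : Set (ℝ × ℝ)) (hC : C = A ×ˢ B)
    (s c : ℝ) (hs : s ≠ 0)
    (L : Set (ℝ × ℝ)) (hL : L = {p : ℝ × ℝ | p.2 = s * p.1 + c}) :
    dimH (C ∩ L) ≤ max (dimH C) 1 - 1 := by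
  subst hC hL
  have hS := ShmerkinWu.isInvariant_prod hA1 hB1 hAinv hBinv
  have hK : IsCompact (A ×ˢ B) :=
    (isCompact_Icc.of_isClosed_subset hAcl hA1).prod (isCompact_Icc.of_isClosed_subset hBcl hB1)
  have hmain := ShmerkinWu.dimH_invariant_slice_le ha hab hindep hs hS hK
    (prod_mono sdiff_subset sdiff_subset) c
  have hsub : A ×ˢ B ∩ {p : ℝ × ℝ | p.2 = s * p.1 + c} ⊆
      ((A \ {1}) ×ˢ (B \ {1}) ∩ ShmerkinWu.sline b s 0 c) ∪ {(1, s + c), ((1 - c) / s, 1)} := by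
    rintro ⟨x, y⟩ ⟨⟨hx, hy⟩, hxy : y = s * x + c⟩
    rcases eq_or_ne x 1 with rfl | hx1
    · exact Or.inr (Or.inl (by simp [hxy]))
    rcases eq_or_ne y 1 with rfl | hy1
    · refine Or.inr (Or.inr (Prod.ext ?_ rfl))
      rw [eq_div_iff hs]
      linarith
    · exact Or.inl ⟨⟨⟨hx, hx1⟩, hy, hy1⟩, by simpa [ShmerkinWu.sline] using hxy⟩
  refine (dimH_mono hsub).trans ?_
  rw [dimH_union, dimH_finite (toFinite {(1, s + c), ((1 - c) / s, 1)})]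
  exact max_le hmain zero_le
end

section
/- Let X and Y be metric spaces and let μ be a finite Borel measure on Y. Equip X × Y with the max-metric (dist((x,y),(x',y')) = max{dist(x,x'), dist(y,y')}). Let a > 0 and assume that for μ-almost every y ∈ Y: for every ε > 0 there exists r₀ > 0 such that μ(B(y,r)) ≤ r^(a−ε) for all 0 < r < r₀, where B(y,r) is the open ball of radius r around y. Let W ⊆ X × Y and set W_y := {x ∈ X : (x,y) ∈ W}. Then for μ-almost every y ∈ Y, dimH(W_y) + a ≤ max{dimH W, a}. -/
open MeasureTheory Set

open Filter Topology
open scoped ENNReal NNReal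

/-- A set of Hausdorff dimension less than `t` has fine covers with arbitrarily small
`t`-dimensional content. -/
theorem exists_cover_tsum_ediam_rpow_le {Z : Type*} [EMetricSpace Z] {W : Set Z} {t : ℝ}
    (hW : dimH W < ENNReal.ofReal t) {δ η : ℝ≥0∞} (hδ : 0 < δ) (hη : 0 < η) :
    ∃ U : ℕ → Set Z, W ⊆ ⋃ i, U i ∧ (∀ i, Metric.ediam (U i) ≤ δ) ∧
      ∑' i, Metric.ediam (U i) ^ t ≤ η := by
  borelize Z
  have ht : 0 < t := ENNReal.ofReal_pos.1 (bot_le.trans_lt hW)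
  have h0 : μH[t] W = 0 := by
    simpa [Real.coe_toNNReal t ht.le] using hausdorffMeasure_of_dimH_lt (d := t.toNNReal) hW
  rw [Measure.hausdorffMeasure_apply] at h0
  have h1 := (le_iSup₂ (f := fun (r : ℝ≥0∞) (_ : 0 < r) =>
    ⨅ (u : ℕ → Set Z) (_ : W ⊆ ⋃ n, u n) (_ : ∀ n, Metric.ediam (u n) ≤ r),
      ∑' n, ⨆ _ : (u n).Nonempty, Metric.ediam (u n) ^ t) δ hδ).trans_lt (h0.trans_lt hη)
  simp only [iInf_lt_iff] at h1
  obtain ⟨U, hWU, hU, hlt⟩ := h1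
  refine ⟨U, hWU, hU, le_trans (ENNReal.tsum_le_tsum fun i => ?_) hlt.le⟩
  rcases (U i).eq_empty_or_nonempty with h | h
  · simp [h, ht]
  · exact le_iSup (fun _ : (U i).Nonempty => Metric.ediam (U i) ^ t) h

/-- A set of small diameter `d` meeting the points whose small balls have `μ`-measure at most
`r ^ b` has measure at most a constant times `d ^ b`; multiplying by `d ^ s` avoids a
case distinction when `d = 0`. -/
theorem ediam_rpow_mul_measure_inter_le {Y : Type*} [PseudoMetricSpace Y] [MeasurableSpace Y]
    {μ : Measure Y} {b s r₀ : ℝ} (hs : 0 < s) {G : Set Y}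
    (hG : ∀ y ∈ G, ∀ r : ℝ, 0 < r → r < r₀ →
      μ (Metric.ball y r) ≤ ENNReal.ofReal (r ^ b))
    {P : Set Y} {d : ℝ≥0∞} (hP : Metric.ediam P ≤ d) (hd : d ≤ ENNReal.ofReal (r₀ / 3)) :
    d ^ s * μ (P ∩ G) ≤ ENNReal.ofReal (2 ^ b) * d ^ (s + b) := by
  rcases eq_or_ne d 0 with rfl | hd0
  · simp [hs]
  rcases (P ∩ G).eq_empty_or_nonempty with h | ⟨y, hyP, hyG⟩
  · simp [h]
  lift d to ℝ≥0 using ne_top_of_le_ne_top ENNReal.ofReal_ne_top hd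
  have hdpos : (0 : ℝ) < d := by
    have : d ≠ 0 := by simpa using hd0
    positivity
  have hdr : (d : ℝ) ≤ r₀ / 3 := by
    rw [← ENNReal.ofReal_coe_nnreal] at hd
    by_contra! hlt
    exact absurd hd (not_le.2 ((ENNReal.ofReal_lt_ofReal_iff hdpos).2 hlt))
  have hsub : P ∩ G ⊆ Metric.ball y (2 * d) := fun z hz => by
    have h1 : edist z y ≤ d := (Metric.edist_le_ediam_of_mem hz.1 hyP).trans hP
    rw [edist_nndist, ENNReal.coe_le_coe] at h1
    have h2 : dist z y ≤ d := by exact_mod_cast h1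
    rw [Metric.mem_ball]
    linarith
  have hm : μ (P ∩ G) ≤ ENNReal.ofReal ((2 * d) ^ b) :=
    (measure_mono hsub).trans (hG y hyG _ (by positivity) (by linarith))
  calc (d : ℝ≥0∞) ^ s * μ (P ∩ G) ≤ (d : ℝ≥0∞) ^ s * ENNReal.ofReal ((2 * d) ^ b) := by gcongr
    _ = ENNReal.ofReal (2 ^ b) * (d : ℝ≥0∞) ^ (s + b) := by
      rw [← ENNReal.ofReal_coe_nnreal, ENNReal.ofReal_rpow_of_pos hdpos,
        ENNReal.ofReal_rpow_of_pos hdpos, ← ENNReal.ofReal_mul (by positivity),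
        ← ENNReal.ofReal_mul (by positivity), Real.mul_rpow (by norm_num) hdpos.le,
        Real.rpow_add hdpos]
      congr 1
      ring

theorem ediam_slice_le {X Y : Type*} [PseudoEMetricSpace X] [PseudoEMetricSpace Y]
    (U : Set (X × Y)) (y : Y) : Metric.ediam {x : X | (x, y) ∈ U} ≤ Metric.ediam U :=
  Metric.ediam_le fun x hx x' hx' => by
    simpa [Prod.edist_eq] using Metric.edist_le_ediam_of_mem (s := U) hx hx'

/-- If `dimH W < s + b`, then almost every slice of `W` over points whose small balls have
measure at most `r ^ b` is null for the `s`-dimensional Hausdorff measure. -/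
theorem ae_hausdorffMeasure_slice_eq_zero {X Y : Type*} [MetricSpace X] [MetricSpace Y]
    [MeasurableSpace X] [BorelSpace X] [MeasurableSpace Y] [BorelSpace Y]
    {μ : Measure Y} {b s r₀ : ℝ} (hs : 0 < s) (hr₀ : 0 < r₀) {G : Set Y}
    (hG : ∀ y ∈ G, ∀ r : ℝ, 0 < r → r < r₀ →
      μ (Metric.ball y r) ≤ ENNReal.ofReal (r ^ b))
    {W : Set (X × Y)} (hW : dimH W < ENNReal.ofReal (s + b)) :
    ∀ᵐ y ∂μ, y ∈ G → μH[s] {x : X | (x, y) ∈ W} = 0 := by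
  obtain ⟨η, hη, hηsum⟩ := ENNReal.exists_pos_sum_of_countable' one_ne_zero ℕ
  have hδ (k : ℕ) : 0 < min (ENNReal.ofReal (r₀ / 3)) (k : ℝ≥0∞)⁻¹ := by
    simp [hr₀]
  choose U hWU hUδ hUη using fun k => exists_cover_tsum_ediam_rpow_le hW (hδ k) (hη k)
  let P : ℕ → ℕ → Set Y := fun k i => closure (Prod.snd '' U k i)
  have hPdiam (k i : ℕ) : Metric.ediam (P k i) ≤ Metric.ediam (U k i) := by
    simpa [P] using LipschitzWith.prod_snd.ediam_image_le (U k i)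
  have hPmeas (k i : ℕ) : MeasurableSet (P k i) := isClosed_closure.measurableSet
  let f : ℕ → Y → ℝ≥0∞ := fun k y =>
    ∑' i, (P k i).indicator (fun _ => Metric.ediam (U k i) ^ s) y
  have hfmeas (k : ℕ) : Measurable (f k) :=
    Measurable.tsum fun i => measurable_const.indicator (hPmeas k i)
  have hfint (k : ℕ) : ∫⁻ y in G, f k y ∂μ ≤ ENNReal.ofReal (2 ^ b) * η k := by
    rw [lintegral_tsum fun i => (measurable_const.indicator (hPmeas k i)).aemeasurable]
    calc ∑' i, ∫⁻ y in G, (P k i).indicator (fun _ => Metric.ediam (U k i) ^ s) y ∂μ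
        ≤ ∑' i, ENNReal.ofReal (2 ^ b) * Metric.ediam (U k i) ^ (s + b) :=
          ENNReal.tsum_le_tsum fun i => by
            rw [lintegral_indicator_const (hPmeas k i), Measure.restrict_apply (hPmeas k i)]
            exact ediam_rpow_mul_measure_inter_le hs hG (hPdiam k i)
              ((hUδ k i).trans (min_le_left _ _))
      _ ≤ ENNReal.ofReal (2 ^ b) * η k := by
          rw [ENNReal.tsum_mul_left]
          gcongr
          exact hUη k
  have hsum : ∫⁻ y in G, ∑' k, f k y ∂μ ≠ ∞ := by
    rw [lintegral_tsum fun k => (hfmeas k).aemeasurable]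
    refine ne_top_of_le_ne_top ?_ (ENNReal.tsum_le_tsum hfint)
    rw [ENNReal.tsum_mul_left]
    exact ENNReal.mul_ne_top ENNReal.ofReal_ne_top (hηsum.trans ENNReal.one_lt_top).ne
  have hae := ae_imp_of_ae_restrict (ae_lt_top (Measurable.tsum hfmeas) hsum)
  filter_upwards [hae] with y hy hyG
  have htend := ENNReal.tendsto_atTop_zero_of_tsum_ne_top (hy hyG).ne
  refine le_antisymm ?_ bot_le
  calc μH[s] {x : X | (x, y) ∈ W}
      ≤ liminf (fun k => ∑' i, Metric.ediam {x : X | (x, y) ∈ U k i} ^ s) atTop := by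
        refine Measure.hausdorffMeasure_le_liminf_tsum s _ (fun k : ℕ => (k : ℝ≥0∞)⁻¹)
          ENNReal.tendsto_inv_nat_nhds_zero _ (Eventually.of_forall fun k i => ?_)
          (Eventually.of_forall fun k x hx => ?_)
        · exact (ediam_slice_le _ y).trans ((hUδ k i).trans (min_le_right _ _))
        · simpa using hWU k hx
    _ ≤ liminf (fun k => f k y) atTop := by
        refine liminf_le_liminf (Eventually.of_forall fun k => ENNReal.tsum_le_tsum fun i => ?_)
        rcases {x : X | (x, y) ∈ U k i}.eq_empty_or_nonempty with h | ⟨x, hx⟩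
        · simp [h, hs]
        · have hyP : y ∈ P k i := subset_closure ⟨(x, y), hx, rfl⟩
          rw [indicator_of_mem hyP]
          exact ENNReal.rpow_le_rpow (ediam_slice_le _ y) hs.le
    _ = 0 := htend.liminf_eq

/-- **Generalized Marstrand slicing theorem.**
If `μ` is a finite Borel measure on `Y` satisfying `μ(B(y,r)) ≤ r^(a-o(1))` at
`μ`-a.e. `y`, then for any `W ⊆ X × Y` (with the max-metric on the product),
`dimH W_y + a ≤ max {dimH W, a}` for `μ`-a.e. `y`. -/
theorem generalized_marstrand
    {X Y : Type*} [MetricSpace X] [MetricSpace Y]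
    [MeasurableSpace Y] [BorelSpace Y]
    (μ : Measure Y) [IsFiniteMeasure μ]
    (a : ℝ) (ha : 0 < a)
    (hμ : ∀ᵐ y ∂μ, ∀ ε > 0, ∃ r₀ > 0, ∀ r : ℝ, 0 < r → r < r₀ →
      μ (Metric.ball y r) ≤ ENNReal.ofReal (r ^ (a - ε)))
    (W : Set (X × Y)) :
    ∀ᵐ y ∂μ, dimH {x : X | (x, y) ∈ W} + ENNReal.ofReal a
      ≤ max (dimH W) (ENNReal.ofReal a) := by
  borelize X
  rcases eq_or_ne (dimH W) ∞ with htop | htop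
  · simp [htop]
  set m : ℝ := (max (dimH W) (ENNReal.ofReal a)).toReal with hm
  have hmtop : max (dimH W) (ENNReal.ofReal a) ≠ ∞ := by simp [htop]
  have hmax : max (dimH W) (ENNReal.ofReal a) = ENNReal.ofReal m :=
    (ENNReal.ofReal_toReal hmtop).symm
  have ham : a ≤ m := (ENNReal.ofReal_le_iff_le_toReal hmtop).1 (le_max_right _ _)
  have hdim (n : ℕ) : ∀ᵐ y ∂μ,
      dimH {x : X | (x, y) ∈ W} ≤ ENNReal.ofReal (m - a + 2 * (1 / ((n : ℝ) + 1))) := by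
    set η : ℝ := 1 / ((n : ℝ) + 1)
    have hη : 0 < η := by positivity
    have hs : 0 < m - a + 2 * η := by linarith
    have hW : dimH W < ENNReal.ofReal (m - a + 2 * η + (a - η)) := by
      refine (le_max_left _ (ENNReal.ofReal a)).trans_lt ?_
      rw [hmax, ENNReal.ofReal_lt_ofReal_iff_of_nonneg (ha.le.trans ham)]
      linarith
    have hslice := ae_all_iff.2 fun N : ℕ => ae_hausdorffMeasure_slice_eq_zero (μ := μ)
      (G := {y | ∀ r : ℝ, 0 < r → r < 1 / ((N : ℝ) + 1) →
        μ (Metric.ball y r) ≤ ENNReal.ofReal (r ^ (a - η))})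
      hs Nat.one_div_pos_of_nat (fun _ hy => hy) hW
    filter_upwards [hμ, hslice] with y hy hzero
    obtain ⟨r₀, hr₀, hball⟩ := hy η hη
    obtain ⟨N, hN⟩ := exists_nat_one_div_lt hr₀
    refine dimH_le_of_hausdorffMeasure_ne_top (d := (m - a + 2 * η).toNNReal) ?_
    rw [Real.coe_toNNReal _ hs.le, hzero N fun r hr hrN => hball r hr (hrN.trans hN)]
    exact ENNReal.zero_ne_top
  filter_upwards [ae_all_iff.2 hdim] with y hy
  have hlim : Tendsto (fun n : ℕ => ENNReal.ofReal (m - a + 2 * (1 / ((n : ℝ) + 1)))) atTop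
      (𝓝 (ENNReal.ofReal (m - a))) := by
    refine ENNReal.tendsto_ofReal ?_
    simpa using (tendsto_one_div_add_atTop_nhds_zero_nat.const_mul (2 : ℝ)).const_add (m - a)
  calc dimH {x : X | (x, y) ∈ W} + ENNReal.ofReal a
      ≤ ENNReal.ofReal (m - a) + ENNReal.ofReal a := by
        gcongr
        exact ge_of_tendsto' hlim hy
    _ = max (dimH W) (ENNReal.ofReal a) := by
        rw [← ENNReal.ofReal_add (by linarith) ha.le, sub_add_cancel, hmax]
end

section
/- Let X and Y be metric spaces and let μ be a finite Borel measure on Y. Equip X × Y with the max-metric. Let a > 0 and suppose there exists r₀ > 0 such that μ(B(y,r)) ≤ r^a for every y ∈ Y and every 0 < r ≤ r₀. Let W ⊆ X × Y and set W_y := {x ∈ X : (x,y) ∈ W}. Then for μ-almost every y ∈ Y, dimH(W_y) ≤ max{dimH W, a} − a. -/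
open MeasureTheory Set
open scoped ENNReal NNReal Topology

/-- A set whose Hausdorff dimension is less than `d` has countable covers by sets of arbitrarily
small diameter, with arbitrarily small sum of the `d`-th powers of the diameters. -/
theorem exists_cover_tsum_ediam_rpow_lt {Z : Type*} [EMetricSpace Z] {W : Set Z} {d : ℝ≥0}
    (hW : dimH W < d) {r ε : ℝ≥0∞} (hr : 0 < r) (hε : 0 < ε) :
    ∃ t : ℕ → Set Z, W ⊆ ⋃ i, t i ∧ (∀ i, Metric.ediam (t i) ≤ r) ∧
      ∑' i, Metric.ediam (t i) ^ (d : ℝ) < ε := by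
  borelize Z
  have hd : (0 : ℝ) < d := by
    exact_mod_cast (zero_le (a := dimH W)).trans_lt hW
  have h0 := hausdorffMeasure_of_dimH_lt hW
  rw [Measure.hausdorffMeasure_apply] at h0
  simp only [ENNReal.iSup_eq_zero] at h0
  have h1 := (h0 r hr).trans_lt hε
  simp only [iInf_lt_iff] at h1
  obtain ⟨t, hWt, htr, hsum⟩ := h1
  refine ⟨t, hWt, htr, lt_of_le_of_lt (ENNReal.tsum_le_tsum fun i => ?_) hsum⟩
  rcases (t i).eq_empty_or_nonempty with h | h
  · simp [h, hd]
  · simp [h]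

/-- If the measure of a ball is at most the `a`-th power of its radius, then a set of small
positive diameter `δ` has measure at most `(2 * δ) ^ a`. -/
theorem measure_le_two_mul_rpow_of_ediam_le {Y : Type*} [MetricSpace Y] [MeasurableSpace Y]
    {μ : Measure Y} {a r₀ : ℝ}
    (hμ : ∀ y : Y, ∀ r : ℝ, 0 < r → r ≤ r₀ → μ (Metric.ball y r) ≤ ENNReal.ofReal (r ^ a))
    {B : Set Y} {δ : ℝ≥0∞} (hδ : δ ≠ 0) (hδr : 2 * δ ≤ ENNReal.ofReal r₀)
    (hB : Metric.ediam B ≤ δ) : μ B ≤ (2 * δ) ^ a := by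
  rcases B.eq_empty_or_nonempty with rfl | ⟨y, hy⟩
  · simp
  have htop : 2 * δ ≠ ∞ := ne_top_of_le_ne_top ENNReal.ofReal_ne_top hδr
  have hδtop : δ ≠ ∞ := by
    rintro rfl
    simp at htop
  have hpos : 0 < (2 * δ).toReal := ENNReal.toReal_pos (by simp [hδ]) htop
  have hr₀ : 0 < r₀ := by
    rw [← ENNReal.ofReal_pos]
    exact (pos_iff_ne_zero.2 (by simp [hδ])).trans_le hδr
  have hsub : B ⊆ Metric.ball y (2 * δ).toReal := by
    intro z hz
    rw [← Metric.eball_ofReal, ENNReal.ofReal_toReal htop, Metric.mem_eball]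
    calc edist z y ≤ δ := (Metric.edist_le_ediam_of_mem hz hy).trans hB
      _ < 2 * δ := by
        rw [two_mul]
        exact ENNReal.lt_add_right hδtop hδ
  calc μ B ≤ μ (Metric.ball y (2 * δ).toReal) := measure_mono hsub
    _ ≤ ENNReal.ofReal ((2 * δ).toReal ^ a) :=
      hμ y _ hpos (ENNReal.toReal_le_of_le_ofReal hr₀.le hδr)
    _ = (2 * δ) ^ a := by
      rw [← ENNReal.ofReal_rpow_of_pos hpos, ENNReal.ofReal_toReal htop]

/-- Integral bound for the weighted number of sets of a countable family of small sets containing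
a given point, for a measure with a power bound on the measure of balls. -/
theorem lintegral_tsum_indicator_le {Y : Type*} [MetricSpace Y] [MeasurableSpace Y] [BorelSpace Y]
    {μ : Measure Y} {a r₀ : ℝ} (ha : 0 < a)
    (hμ : ∀ y : Y, ∀ r : ℝ, 0 < r → r ≤ r₀ → μ (Metric.ball y r) ≤ ENNReal.ofReal (r ^ a))
    {d : ℝ} (had : a < d) {B : ℕ → Set Y} (hBm : ∀ i, MeasurableSet (B i)) {δ : ℕ → ℝ≥0∞}
    (hδr : ∀ i, 2 * δ i ≤ ENNReal.ofReal r₀) (hB : ∀ i, Metric.ediam (B i) ≤ δ i) :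
    ∫⁻ y, ∑' i, (B i).indicator (fun _ => δ i ^ (d - a)) y ∂μ ≤ 2 ^ a * ∑' i, δ i ^ d := by
  rw [lintegral_tsum fun i => (measurable_const.indicator (hBm i)).aemeasurable,
    ← ENNReal.tsum_mul_left]
  refine ENNReal.tsum_le_tsum fun i => ?_
  rw [lintegral_indicator_const (hBm i)]
  rcases eq_or_ne (δ i) 0 with h | h
  · simp [h, had]
  have htop : δ i ≠ ∞ := by
    intro h'
    simpa [h'] using hδr i
  calc δ i ^ (d - a) * μ (B i) ≤ δ i ^ (d - a) * (2 * δ i) ^ a := by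
        gcongr
        exact measure_le_two_mul_rpow_of_ediam_le hμ h (hδr i) (hB i)
    _ = 2 ^ a * (δ i ^ (d - a) * δ i ^ a) := by
        rw [ENNReal.mul_rpow_of_nonneg _ _ ha.le]
        ring
    _ = 2 ^ a * δ i ^ d := by
        rw [← ENNReal.rpow_add _ _ h htop, sub_add_cancel]

/-- Bound on the dimension of almost every slice, for an exponent `d` exceeding both `a` and the
dimension of the whole set. -/
theorem ae_dimH_slice_le_sub {X Y : Type*} [MetricSpace X] [MetricSpace Y]
    [MeasurableSpace Y] [BorelSpace Y] {μ : Measure Y} {a r₀ : ℝ} (ha : 0 < a) (hr₀ : 0 < r₀)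
    (hμ : ∀ y : Y, ∀ r : ℝ, 0 < r → r ≤ r₀ → μ (Metric.ball y r) ≤ ENNReal.ofReal (r ^ a))
    {W : Set (X × Y)} {d : ℝ≥0} (had : a < d) (hW : dimH W < d) :
    ∀ᵐ y ∂μ, dimH {x : X | (x, y) ∈ W} ≤ d - ENNReal.ofReal a := by
  borelize X
  have hρ (n : ℕ) : 0 < min (ENNReal.ofReal r₀ / 2) ((n : ℝ≥0∞)⁻¹) :=
    lt_min (ENNReal.div_pos (by simpa using hr₀) (by simp)) (by simp)
  have hε (n : ℕ) : (0 : ℝ≥0∞) < 2⁻¹ ^ n := pos_iff_ne_zero.2 (by simp)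
  choose t hWt htr hts using fun n => exists_cover_tsum_ediam_rpow_lt hW (hρ n) (hε n)
  set B : ℕ → ℕ → Set Y := fun n i => closure (Prod.snd '' t n i) with hBdef
  set f : ℕ → Y → ℝ≥0∞ := fun n y =>
    ∑' i, (B n i).indicator (fun _ => Metric.ediam (t n i) ^ ((d : ℝ) - a)) y
  have hBm (n i) : MeasurableSet (B n i) := isClosed_closure.measurableSet
  have hfm (n) : Measurable (f n) :=
    Measurable.tsum fun i => measurable_const.indicator (hBm n i)
  have hfint (n) : ∫⁻ y, f n y ∂μ ≤ 2 ^ a * 2⁻¹ ^ n := by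
    refine (lintegral_tsum_indicator_le ha hμ had (hBm n) (fun i => ?_) fun i => ?_).trans ?_
    · calc 2 * Metric.ediam (t n i) ≤ 2 * (ENNReal.ofReal r₀ / 2) := by
            gcongr
            exact (htr n i).trans (min_le_left _ _)
        _ = ENNReal.ofReal r₀ := ENNReal.mul_div_cancel (by simp) (by simp)
    · rw [hBdef, Metric.ediam_closure]
      simpa using LipschitzWith.prod_snd.ediam_image_le (t n i)
    · gcongr
      exact (hts n).le
  have hsum : ∫⁻ y, ∑' n, f n y ∂μ ≠ ∞ := by
    rw [lintegral_tsum fun n => (hfm n).aemeasurable]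
    refine ne_top_of_le_ne_top ?_ (ENNReal.tsum_le_tsum hfint)
    rw [ENNReal.tsum_mul_left, ENNReal.tsum_geometric]
    exact ENNReal.mul_ne_top (by simp) (by simp)
  filter_upwards [ae_lt_top (Measurable.tsum hfm) hsum] with y hy
  have hlim : Filter.Tendsto (fun n => f n y) Filter.atTop (𝓝 0) :=
    ENNReal.tendsto_atTop_zero_of_tsum_ne_top hy.ne
  set A : ℕ → ℕ → Set X := fun n i => {x | x ∈ Prod.fst '' t n i ∧ y ∈ B n i} with hAdef
  have hAle (n i) : Metric.ediam (A n i) ≤ Metric.ediam (t n i) :=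
    (Metric.ediam_mono fun x hx => hx.1).trans <| by
      simpa using LipschitzWith.prod_fst.ediam_image_le (t n i)
  have hmeas : μH[(d : ℝ) - a] {x : X | (x, y) ∈ W} = 0 := by
    refine le_antisymm ?_ zero_le
    refine (Measure.hausdorffMeasure_le_liminf_tsum (l := Filter.atTop) _ _ _
      ENNReal.tendsto_inv_nat_nhds_zero A
      (.of_forall fun n i => (hAle n i).trans ((htr n i).trans (min_le_right _ _)))
      (.of_forall fun n x hx => ?_)).trans ?_
    · obtain ⟨i, hi⟩ := mem_iUnion.1 (hWt n hx)
      exact mem_iUnion.2 ⟨i, ⟨_, hi, rfl⟩, subset_closure ⟨_, hi, rfl⟩⟩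
    · rw [← hlim.liminf_eq]
      refine Filter.liminf_le_liminf (.of_forall fun n => ENNReal.tsum_le_tsum fun i => ?_)
      by_cases hyB : y ∈ B n i
      · rw [indicator_of_mem hyB]
        exact ENNReal.rpow_le_rpow (hAle n i) (sub_pos.2 had).le
      · simp [hAdef, hyB, had]
  have hcoe : (((d - a.toNNReal : ℝ≥0)) : ℝ) = d - a := by
    rw [NNReal.coe_sub (Real.toNNReal_le_iff_le_coe.2 had.le), Real.coe_toNNReal _ ha.le]
  rw [← hcoe] at hmeas
  simpa [ENNReal.ofReal] using
    dimH_le_of_hausdorffMeasure_ne_top (hmeas.trans_ne ENNReal.zero_ne_top)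

/-- **Step 1 of the generalized Marstrand theorem.**
If `μ` is a finite Borel measure on `Y` with `μ(B(y,r)) ≤ r^a` uniformly for all
`y ∈ Y` and `0 < r ≤ r₀`, then for any `W ⊆ X × Y` (with the max-metric on the
product), `dimH W_y ≤ max {dimH W, a} - a` for `μ`-a.e. `y`. -/
theorem generalized_marstrand_uniform
    {X Y : Type*} [MetricSpace X] [MetricSpace Y]
    [MeasurableSpace Y] [BorelSpace Y]
    (μ : Measure Y) [IsFiniteMeasure μ]
    (a : ℝ) (ha : 0 < a)
    (r₀ : ℝ) (hr₀ : 0 < r₀)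
    (hμ : ∀ y : Y, ∀ r : ℝ, 0 < r → r ≤ r₀ →
      μ (Metric.ball y r) ≤ ENNReal.ofReal (r ^ a))
    (W : Set (X × Y)) :
    ∀ᵐ y ∂μ, dimH {x : X | (x, y) ∈ W}
      ≤ max (dimH W) (ENNReal.ofReal a) - ENNReal.ofReal a := by
  have key : ∀ᵐ y ∂μ, ∀ q : ℚ≥0, a < (q : ℝ≥0) → dimH W < (q : ℝ≥0) →
      dimH {x : X | (x, y) ∈ W} ≤ (q : ℝ≥0) - ENNReal.ofReal a := by
    simp only [ae_all_iff, Filter.eventually_imp_distrib_left]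
    exact fun q had hW => ae_dimH_slice_le_sub ha hr₀ hμ had hW
  filter_upwards [key] with y hy
  refine le_of_forall_gt_imp_ge_of_dense fun c hc => ?_
  obtain ⟨q, hq0, hq, hqc⟩ := ENNReal.lt_iff_exists_rat_btwn.1 <|
    (ENNReal.sub_lt_iff_lt_right ENNReal.ofReal_ne_top (le_max_right _ _)).1 hc
  lift q to ℚ≥0 using hq0
  have hcast : Real.toNNReal ((q : ℚ) : ℝ) = (q : ℝ≥0) := by
    ext
    rw [Real.coe_toNNReal _ (by positivity)]
    norm_cast
  rw [hcast] at hq hqc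
  obtain ⟨hqW, hqa⟩ := max_lt_iff.1 hq
  refine (hy q ?_ hqW).trans (tsub_le_iff_right.2 hqc.le)
  rw [← ENNReal.ofReal_coe_nnreal] at hqa
  exact (ENNReal.ofReal_lt_ofReal_iff_of_nonneg ha.le).1 hqa
end
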